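/- Let π ∈ ℤ[ρ] be a primary prime with p = π·π̄ ≡ 1 (mod 3). Then the elliptic Gauss sum is expressible as G_π(χ_π, f) = α_π·π̃², where the coefficient α_π = π̃^{−2}·G_π(χ_π, f) is an algebraic integer lying in ℤ[ρ]. Moreover α_π ≡ 1 (mod √−3) if p ≡ 7 (mod 18) (with f = φ), α_π ≡ −1 (mod √−3) if p ≡ 13 (mod 18) (with f = φ^{−1}), and α_π ≡ 0 (mod √−3) if p ≡ 1 (mod 18) (with f = ψ). -/

import Mathlib

open Complex BigOperators

noncomputable section

/-- `ρ = e^{2πi/3}`, a primitive cube root of unity. -/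
def ρ3 : ℂ := Complex.exp (2 * Real.pi * Complex.I / 3)

/-- The ring of Eisenstein integers `ℤ[ρ]`, realized as a subring of `ℂ`. -/
def O3 : Subring ℂ := Subring.closure {ρ3}

/-- `√−3 = i·√3`. -/
def sqrtm3 : ℂ := Complex.I * (Real.sqrt 3 : ℝ)

/-- The congruence `a ≡ b (mod c)` in `ℤ[ρ]`. -/
def ECong (a b c : ℂ) : Prop := ∃ d ∈ O3, a - b = c * d

/-- `a` and `b` are coprime in `ℤ[ρ]`. -/
def ECoprime (a b : ℂ) : Prop := ∃ u ∈ O3, ∃ v ∈ O3, u * a + v * b = 1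

/-- The real period `ϖ₁ = ∫₀¹ (1−x³)^{−2/3} dx`. -/
def varpi1 : ℝ := ∫ x in (0:ℝ)..(1:ℝ), (1 - x ^ 3) ^ (-(2:ℝ)/3)

/-- The points of the period lattice `ϖ₁·ℤ[ρ]`. -/
def ω3 (m : ℤ × ℤ) : ℂ := (varpi1 : ℂ) * ((m.1 : ℂ) + (m.2 : ℂ) * ρ3)

/-- The Weierstrass `℘`-function of the period lattice `ϖ₁·ℤ[ρ]`
(so that `℘′² = 4℘³ − 27`). -/
def wp3 (u : ℂ) : ℂ :=
  (u ^ 2)⁻¹ + ∑' m : ℤ × ℤ, if m = 0 then 0 else (((u - ω3 m) ^ 2)⁻¹ - ((ω3 m) ^ 2)⁻¹)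

/-- The derivative `℘′` of the Weierstrass `℘`-function of `ϖ₁·ℤ[ρ]`. -/
def wp3' (u : ℂ) : ℂ := ∑' m : ℤ × ℤ, (-2) * ((u - ω3 m) ^ 3)⁻¹

/-- The Weierstrass `ζ`-function of the period lattice `ϖ₁·ℤ[ρ]`. -/
def wzeta3 (u : ℂ) : ℂ :=
  u⁻¹ + ∑' m : ℤ × ℤ, if m = 0 then 0 else ((u - ω3 m)⁻¹ + (ω3 m)⁻¹ + u * ((ω3 m) ^ 2)⁻¹)

/-- The non-analytic doubly periodic function `Z(u) = ζ(ϖ₁u) − (2π/(√3·ϖ₁))·ū`. -/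
def Z3 (u : ℂ) : ℂ :=
  wzeta3 ((varpi1 : ℂ) * u) -
    ((2 * Real.pi / (Real.sqrt 3 * varpi1) : ℝ) : ℂ) * (starRingEnd ℂ) u

/-- The elliptic function `φ(u) = 6℘(ϖ₁u)/(9+℘′(ϖ₁u))` of period lattice `ℤ[ρ]`. -/
def phi3 (u : ℂ) : ℂ := 6 * wp3 ((varpi1 : ℂ) * u) / (9 + wp3' ((varpi1 : ℂ) * u))

/-- The elliptic function `ψ(u) = (9−℘′(ϖ₁u))/(9+℘′(ϖ₁u))` of period lattice `ℤ[ρ]`. -/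
def psi3 (u : ℂ) : ℂ := (9 - wp3' ((varpi1 : ℂ) * u)) / (9 + wp3' ((varpi1 : ℂ) * u))

/-- A residue class character modulo `β` on `ℤ[ρ]`. -/
structure IsResChar3 (β : ℂ) (χ : ℂ → ℂ) : Prop where
  periodic : ∀ a ∈ O3, ∀ b ∈ O3, ECong a b β → χ a = χ b
  map_mul : ∀ a ∈ O3, ∀ b ∈ O3, χ (a * b) = χ a * χ b
  map_one : χ 1 = 1
  vanish : ∀ a ∈ O3, ¬ ECoprime a β → χ a = 0

/-- The cubic residue character `χ_π = (·/π)₃` modulo a prime `π` with `p = π·π̄`: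
`χ_π(ν)³ = 1` and `χ_π(ν) ≡ ν^{(p−1)/3} (mod π)`. -/
structure IsCubicChar (π : ℂ) (p : ℕ) (χ : ℂ → ℂ) : Prop where
  resChar : IsResChar3 π χ
  cube : ∀ ν ∈ O3, ECoprime ν π → χ ν ^ 3 = 1
  euler : ∀ ν ∈ O3, ECoprime ν π → ECong (χ ν) (ν ^ ((p - 1) / 3)) π

/-- The elliptic Gauss sum `G_π(χ, f) = (1/3)·Σ_{ν ∈ (ℤ[ρ]/(π))^×} χ(ν)·f(ν/π)`,
computed via the integer representatives `1, …, p−1` of `(ℤ[ρ]/(π))^× ≅ (ℤ/p)^×`. -/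
def EGS3 (p : ℕ) (χ f : ℂ → ℂ) (π : ℂ) : ℂ :=
  (1/3 : ℂ) * ∑ r ∈ Finset.Icc 1 (p - 1), χ (r : ℂ) * f ((r : ℂ) / π)

/-- `S` is a third set of `(ℤ[ρ]/(π))^×`, i.e. `(ℤ[ρ]/(π))^× = S ∪ ρS ∪ ρ̄S`. -/
def IsThirdSet (π : ℂ) (S : Finset ℂ) : Prop :=
  (∀ ν ∈ S, ν ∈ O3 ∧ ECoprime ν π) ∧
  (∀ a ∈ O3, ECoprime a π →
    ∃ ν ∈ S, ∃ ε ∈ ({1, ρ3, ρ3 ^ 2} : Set ℂ), ECong a (ε * ν) π) ∧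
  (∀ ν ∈ S, ∀ μ ∈ S, ∀ ε ∈ ({1, ρ3, ρ3 ^ 2} : Set ℂ), ∀ ε' ∈ ({1, ρ3, ρ3 ^ 2} : Set ℂ),
    ECong (ε * ν) (ε' * μ) π → ν = μ ∧ ε = ε')

/-- `γ(S)` is the cube root of unity with `γ(S) ≡ −∏_{ν∈S} ν (mod π)`. -/
def IsGamma3 (π : ℂ) (S : Finset ℂ) (γ : ℂ) : Prop :=
  γ ^ 3 = 1 ∧ ECong γ (-(∏ ν ∈ S, ν)) π

/-- `L` is the value at `s = 1` of the analytic continuation of the Hecke `L`-series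
`L(s, χ̃) = Σ_𝔞 χ̃(𝔞)·N𝔞^{−s} = (1/6)·Σ_{ν ∈ ℤ[ρ]} χ₁(ν)·ν̄·|ν|^{−2s}` attached to the
weight-one Hecke character `χ̃((ν)) = χ₁(ν)·ν̄` of `ℚ(ρ)`. -/
def IsLValue3 (χ₁ : ℂ → ℂ) (L : ℂ) : Prop :=
  ∃ F : ℂ → ℂ, DifferentiableOn ℂ F {s : ℂ | 0 < s.re} ∧
    (∀ s : ℂ, 3/2 < s.re →
      F s = (1/6 : ℂ) *
        ∑' ν : O3, χ₁ (ν : ℂ) * (starRingEnd ℂ) (ν : ℂ) *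
          ((Complex.normSq (ν : ℂ) : ℂ) ^ (-s))) ∧
    F 1 = L

/-- `T` is a complete residue system modulo `β` in `ℤ[ρ]`. -/
def IsCRS3 (β : ℂ) (T : Finset ℂ) : Prop :=
  (∀ a ∈ T, a ∈ O3) ∧ (∀ a ∈ T, ∀ b ∈ T, ECong a b β → a = b) ∧
  (∀ z ∈ O3, ∃ a ∈ T, ECong z a β)

/-- `e^{2πi·S(z)}` where `S(a + b·ρ̄) = a`, i.e. `2πi·S(z) = (2π/√3)·(zρ − z̄ρ̄)`. -/
def eS3 (z : ℂ) : ℂ :=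
  Complex.exp (((2 * Real.pi / Real.sqrt 3 : ℝ) : ℂ) *
    (z * ρ3 - (starRingEnd ℂ) z * (starRingEnd ℂ) ρ3))

/-- `χ₀`: the character mod `3` giving the natural isomorphism `(ℤ[ρ]/(3))^× ≅ W`,
i.e. `χ₀(ν) = ε` for `ν ≡ ε (mod 3)`, `ε ∈ W = {±1, ±ρ, ±ρ̄}`. -/
def IsChi0₃ (χ₀ : ℂ → ℂ) : Prop :=
  IsResChar3 3 χ₀ ∧ ∀ ε ∈ ({1, -1, ρ3, -ρ3, ρ3 ^ 2, -ρ3 ^ 2} : Set ℂ), χ₀ ε = ε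

/-- `χ₀′`: the character mod `√−3` giving `(ℤ[ρ]/(√−3))^× ≅ {±1}`,
i.e. `χ₀′(ν) = δ` for `ν ≡ δ (mod √−3)`, `δ ∈ {±1}`. -/
def IsChi0'₃ (χ₀' : ℂ → ℂ) : Prop :=
  IsResChar3 sqrtm3 χ₀' ∧ χ₀' (-1) = -1

/-- The classical cubic (Kummer) Gauss sum `G₃(π) = Σ_{r=1}^{p−1} (r/π)₃·e^{2πir/p}`. -/
def G3sum (p : ℕ) (χ : ℂ → ℂ) : ℂ :=
  ∑ r ∈ Finset.Icc 1 (p - 1), χ (r : ℂ) * Complex.exp (2 * Real.pi * Complex.I * (r : ℂ) / (p : ℂ))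

open scoped PeriodPair

/-! ### The Eisenstein integers -/

theorem ρ3_eq : ρ3 = -1 / 2 + (Real.sqrt 3 / 2 : ℝ) * Complex.I := by
  have h : (2 * Real.pi * Complex.I / 3 : ℂ) = ((Real.pi - Real.pi / 3 : ℝ) : ℂ) * Complex.I := by
    push_cast; ring
  rw [ρ3, h, Complex.exp_mul_I, ← Complex.ofReal_cos, ← Complex.ofReal_sin, Real.cos_pi_sub,
    Real.sin_pi_sub, Real.cos_pi_div_three, Real.sin_pi_div_three]
  push_cast; ring

theorem sqrt_three_sq : ((Real.sqrt 3 : ℝ) : ℂ) ^ 2 = 3 := by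
  rw [← Complex.ofReal_pow, Real.sq_sqrt (by norm_num)]; norm_num

theorem ρ3_quad : ρ3 ^ 2 + ρ3 + 1 = 0 := by
  rw [ρ3_eq]; push_cast
  linear_combination (Complex.I ^ 2 / 4) * sqrt_three_sq + 3 / 4 * Complex.I_sq

theorem ρ3_sq : ρ3 ^ 2 = -1 - ρ3 := by linear_combination ρ3_quad

theorem ρ3_cube : ρ3 ^ 3 = 1 := by linear_combination (ρ3 - 1) * ρ3_quad

theorem ρ3_ne_zero : ρ3 ≠ 0 := fun h => by simpa [h] using ρ3_cube

theorem ρ3_im_pos : 0 < ρ3.im := by rw [ρ3_eq]; simp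

theorem ρ3_ne_one : ρ3 ≠ 1 := fun h => by simpa [h] using ρ3_im_pos

theorem conj_ρ3 : (starRingEnd ℂ) ρ3 = ρ3 ^ 2 := by
  rw [ρ3_sq, ρ3_eq]
  simp only [map_add, map_mul, map_div₀, map_neg, map_one, Complex.conj_ofReal, Complex.conj_I,
    map_ofNat]
  ring

theorem int_add_mul_ρ3_eq_zero {a b : ℝ} (h : (a : ℂ) + b * ρ3 = 0) : a = 0 ∧ b = 0 := by
  have him := congrArg Complex.im h
  have hre := congrArg Complex.re h
  simp at him hre
  have hb : b = 0 := him.resolve_right ρ3_im_pos.ne'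
  subst hb
  simpa using hre

theorem mem_O3_iff {x : ℂ} : x ∈ O3 ↔ ∃ a b : ℤ, x = a + b * ρ3 := by
  constructor
  · intro hx
    induction hx using Subring.closure_induction with
    | mem x hx => exact ⟨0, 1, by rw [Set.mem_singleton_iff.1 hx]; simp⟩
    | zero => exact ⟨0, 0, by simp⟩
    | one => exact ⟨1, 0, by simp⟩
    | add x y _ _ hx hy =>
      obtain ⟨a, b, rfl⟩ := hx
      obtain ⟨c, d, rfl⟩ := hy
      exact ⟨a + c, b + d, by push_cast; ring⟩
    | neg x _ hx =>
      obtain ⟨a, b, rfl⟩ := hx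
      exact ⟨-a, -b, by push_cast; ring⟩
    | mul x y _ _ hx hy =>
      obtain ⟨a, b, rfl⟩ := hx
      obtain ⟨c, d, rfl⟩ := hy
      refine ⟨a * c - b * d, a * d + b * c - b * d, ?_⟩
      push_cast
      linear_combination (b * d : ℂ) * ρ3_quad
  · rintro ⟨a, b, rfl⟩
    exact add_mem (intCast_mem _ a) (mul_mem (intCast_mem _ b) (Subring.subset_closure rfl))

theorem ρ3_mem : ρ3 ∈ O3 := Subring.subset_closure rfl

theorem conj_mem_O3 {x : ℂ} (hx : x ∈ O3) : (starRingEnd ℂ) x ∈ O3 := by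
  obtain ⟨a, b, rfl⟩ := mem_O3_iff.1 hx
  simpa [conj_ρ3] using
    add_mem (intCast_mem O3 a) (mul_mem (intCast_mem O3 b) (pow_mem ρ3_mem 2))

/-! ### Hexagonal lattices -/

/-- The hexagonal lattice `w·ℤ[ρ]` as a pair of periods. -/
def hexPair (w : ℝ) (hw : 0 < w) : PeriodPair where
  ω₁ := w
  ω₂ := w * ρ3
  indep := by
    rw [LinearIndependent.pair_iff]
    intro a b h
    have h' : ((a * w : ℝ) : ℂ) + (b * w : ℝ) * ρ3 = 0 := by
      simp at h; push_cast; linear_combination h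
    simpa [hw.ne'] using int_add_mul_ρ3_eq_zero h'

section Hex

variable {w : ℝ} {hw : 0 < w}

theorem mem_hex_iff {z : ℂ} : z ∈ (hexPair w hw).lattice ↔ ∃ a ∈ O3, z = w * a := by
  rw [PeriodPair.mem_lattice]
  constructor
  · rintro ⟨m, n, rfl⟩
    exact ⟨m + n * ρ3, mem_O3_iff.2 ⟨m, n, rfl⟩, by simp [hexPair]; ring⟩
  · rintro ⟨a, ha, rfl⟩
    obtain ⟨m, n, rfl⟩ := mem_O3_iff.1 ha
    exact ⟨m, n, by simp [hexPair]; ring⟩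

theorem mul_mem_hex {a z : ℂ} (ha : a ∈ O3) (hz : z ∈ (hexPair w hw).lattice) :
    a * z ∈ (hexPair w hw).lattice := by
  obtain ⟨b, hb, rfl⟩ := mem_hex_iff.1 hz
  exact mem_hex_iff.2 ⟨a * b, mul_mem ha hb, by ring⟩

theorem conj_mem_hex {z : ℂ} (hz : z ∈ (hexPair w hw).lattice) :
    (starRingEnd ℂ) z ∈ (hexPair w hw).lattice := by
  obtain ⟨b, hb, rfl⟩ := mem_hex_iff.1 hz
  exact mem_hex_iff.2 ⟨_, conj_mem_O3 hb, by simp⟩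

variable (w hw) in
/-- Multiplication by `ρ` on a hexagonal lattice. -/
def hexRot : (hexPair w hw).lattice ≃ (hexPair w hw).lattice where
  toFun l := ⟨ρ3 * l, mul_mem_hex ρ3_mem l.2⟩
  invFun l := ⟨ρ3 ^ 2 * l, mul_mem_hex (pow_mem ρ3_mem 2) l.2⟩
  left_inv l := by ext; simp only; linear_combination (l : ℂ) * ρ3_cube
  right_inv l := by ext; simp only; linear_combination (l : ℂ) * ρ3_cube

variable (w hw) in
/-- Complex conjugation on a hexagonal lattice. -/
def hexConj : (hexPair w hw).lattice ≃ (hexPair w hw).lattice where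
  toFun l := ⟨(starRingEnd ℂ) l, conj_mem_hex l.2⟩
  invFun l := ⟨(starRingEnd ℂ) l, conj_mem_hex l.2⟩
  left_inv l := by ext; simp
  right_inv l := by ext; simp

local notation "ℒ" => hexPair w hw

theorem hex_P_rho (z : ℂ) : (ℒ).weierstrassP (ρ3 * z) = ρ3 * (ℒ).weierstrassP z := by
  simp only [PeriodPair.weierstrassP]
  rw [← (hexRot w hw).tsum_eq, ← tsum_mul_left]
  congr 1; ext l
  simp only [hexRot, Equiv.coe_fn_mk, ← mul_sub, mul_pow, one_div, mul_inv]
  have : (ρ3 ^ 2)⁻¹ = ρ3 := inv_eq_of_mul_eq_one_right (by linear_combination ρ3_cube)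
  rw [this]

theorem hex_P'_rho (z : ℂ) : (ℒ).derivWeierstrassP (ρ3 * z) = (ℒ).derivWeierstrassP z := by
  simp only [PeriodPair.derivWeierstrassP]
  rw [← (hexRot w hw).tsum_eq]
  congr 2; ext l
  simp only [hexRot, Equiv.coe_fn_mk, ← mul_sub, mul_pow, ρ3_cube, one_mul]

theorem hex_P_conj (z : ℂ) : (ℒ).weierstrassP ((starRingEnd ℂ) z) =
    (starRingEnd ℂ) ((ℒ).weierstrassP z) := by
  simp only [PeriodPair.weierstrassP]
  rw [← (hexConj w hw).tsum_eq, Complex.conj_tsum]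
  congr 1; ext l
  simp [hexConj]

theorem hex_P'_conj (z : ℂ) : (ℒ).derivWeierstrassP ((starRingEnd ℂ) z) =
    (starRingEnd ℂ) ((ℒ).derivWeierstrassP z) := by
  simp only [PeriodPair.derivWeierstrassP]
  rw [← (hexConj w hw).tsum_eq, map_neg, Complex.conj_tsum]
  congr 2; ext l
  simp only [hexConj, Equiv.coe_fn_mk, map_div₀, map_ofNat, map_pow, map_sub]

theorem hex_g₂ : (ℒ).g₂ = 0 := by
  have h : (ℒ).G 4 = ρ3 ^ 2 * (ℒ).G 4 := by
    conv_lhs => rw [PeriodPair.G, ← (hexRot w hw).tsum_eq]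
    rw [PeriodPair.G, ← tsum_mul_left]
    congr 1; ext l
    simp only [hexRot, Equiv.coe_fn_mk, mul_pow, mul_inv]
    congr 1
    exact inv_eq_of_mul_eq_one_right (by linear_combination (ρ3 ^ 3 + 1) * ρ3_cube)
  have h1 : (1 - ρ3 ^ 2) * (ℒ).G 4 = 0 := by linear_combination h
  have h2 : 1 - ρ3 ^ 2 ≠ 0 := by
    intro h
    apply ρ3_ne_one
    linear_combination ρ3 * h + ρ3_cube
  rw [PeriodPair.g₂, (mul_eq_zero.1 h1).resolve_left h2, mul_zero]

theorem hex_g₃_conj : (starRingEnd ℂ) (ℒ).g₃ = (ℒ).g₃ := by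
  simp only [PeriodPair.g₃, PeriodPair.G, map_mul, map_ofNat]
  conv_rhs => rw [← (hexConj w hw).tsum_eq]
  rw [Complex.conj_tsum]
  congr 2; ext l
  simp [hexConj]

theorem hex_P'_sq {z : ℂ} (hz : z ∉ (ℒ).lattice) :
    (ℒ).derivWeierstrassP z ^ 2 = 4 * (ℒ).weierstrassP z ^ 3 - (ℒ).g₃ := by
  rw [(ℒ).derivWeierstrassP_sq z hz, hex_g₂]; ring

variable (w hw) in
/-- Scaling between hexagonal lattices. -/
def hexScale (w' : ℝ) (hw' : 0 < w') : (hexPair w hw).lattice ≃ (hexPair w' hw').lattice where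
  toFun l := ⟨w' / w * l, by
    obtain ⟨a, ha, h⟩ := mem_hex_iff.1 l.2
    have h1 : (w : ℂ) ≠ 0 := by exact_mod_cast hw.ne'
    exact mem_hex_iff.2 ⟨a, ha, by rw [h]; field_simp⟩⟩
  invFun l := ⟨w / w' * l, by
    obtain ⟨a, ha, h⟩ := mem_hex_iff.1 l.2
    have h1 : (w' : ℂ) ≠ 0 := by exact_mod_cast hw'.ne'
    exact mem_hex_iff.2 ⟨a, ha, by rw [h]; field_simp⟩⟩
  left_inv l := by
    ext
    have h1 : (w : ℂ) ≠ 0 := by exact_mod_cast hw.ne'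
    have h2 : (w' : ℂ) ≠ 0 := by exact_mod_cast hw'.ne'
    simp only; field_simp
  right_inv l := by
    ext
    have h1 : (w : ℂ) ≠ 0 := by exact_mod_cast hw.ne'
    have h2 : (w' : ℂ) ≠ 0 := by exact_mod_cast hw'.ne'
    simp only; field_simp

theorem hex_g₃_scale {w' : ℝ} {hw' : 0 < w'} :
    (w : ℂ) ^ 6 * (hexPair w hw).g₃ = (w' : ℂ) ^ 6 * (hexPair w' hw').g₃ := by
  simp only [PeriodPair.g₃, PeriodPair.G]
  conv_rhs => rw [← (hexScale w hw w' hw').tsum_eq]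
  rw [← tsum_mul_left, ← tsum_mul_left, ← tsum_mul_left, ← tsum_mul_left]
  congr 1; funext l
  have h1 : (w : ℂ) ≠ 0 := by exact_mod_cast hw.ne'
  have h2 : (w' : ℂ) ≠ 0 := by exact_mod_cast hw'.ne'
  simp only [hexScale, Equiv.coe_fn_mk]
  field_simp

end Hex

/-! ### Analytic preliminaries -/

section Analytic

open Filter Topology

/-- Identity principle for meromorphic functions on the plane. -/
theorem Meromorphic.eq_zero_of_frequently {F : ℂ → ℂ} (hF : Meromorphic F) {z₀ : ℂ}
    (h0 : ∃ᶠ z in 𝓝[≠] z₀, F z = 0) (z : ℂ) : ∀ᶠ u in 𝓝[≠] z, F u = 0 := by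
  have h1 : meromorphicOrderAt F z₀ = ⊤ := by
    by_contra h
    exact h0 ((meromorphicOrderAt_ne_top_iff_eventually_ne_zero (hF z₀)).1 h)
  rw [← meromorphicOrderAt_eq_top_iff]
  by_contra h
  exact (meromorphicOn_univ.2 hF).meromorphicOrderAt_ne_top_of_isPreconnected
    isPreconnected_univ (Set.mem_univ z) (Set.mem_univ z₀) h h1

theorem eq_zero_of_frequently_eq_zero {F : ℂ → ℂ} {z : ℂ} (hc : ContinuousAt F z)
    (h : ∃ᶠ u in 𝓝[≠] z, F u = 0) : F z = 0 := by
  by_contra hne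
  exact h ((hc.eventually_ne hne).filter_mono nhdsWithin_le_nhds)

theorem Meromorphic.apply_eq_zero {F : ℂ → ℂ} (hF : Meromorphic F) {z₀ z : ℂ}
    (h0 : ∃ᶠ z in 𝓝[≠] z₀, F z = 0) (hc : ContinuousAt F z) : F z = 0 :=
  eq_zero_of_frequently_eq_zero hc (hF.eq_zero_of_frequently h0 z).frequently

end Analytic

/-! ### The functions parametrising the Fermat cubic -/


/-- A hexagonal period lattice with invariant `g₃ = 27`. -/
class Hex27 (L : PeriodPair) : Prop where
  exists_hex : ∃ (w : ℝ) (hw : 0 < w), L = hexPair w hw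
  g₃_eq : L.g₃ = 27

/-- The function `6℘/(9+℘′)`. -/
def sF (L : PeriodPair) (z : ℂ) : ℂ := 6 * ℘[L] z / (9 + ℘'[L] z)

open Classical in
/-- The function `(℘′−9)/(9+℘′)`, with its limit value on the lattice. -/
def cF (L : PeriodPair) (z : ℂ) : ℂ :=
  if z ∈ L.lattice then 1 else (℘'[L] z - 9) / (9 + ℘'[L] z)

/-- The points which are not poles of `sF` and `cF`. -/
def Reg (L : PeriodPair) (z : ℂ) : Prop := 9 + ℘'[L] z ≠ 0

section Fermat

open Filter Topology

variable {L : PeriodPair}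

theorem sF_of_mem {z : ℂ} (hz : z ∈ L.lattice) : sF L z = 0 := by
  have := L.weierstrassP_coe ⟨z, hz⟩
  simp_all [sF]

theorem cF_of_mem {z : ℂ} (hz : z ∈ L.lattice) : cF L z = 1 := if_pos hz

theorem cF_of_notMem {z : ℂ} (hz : z ∉ L.lattice) :
    cF L z = (℘'[L] z - 9) / (9 + ℘'[L] z) := if_neg hz

theorem reg_of_mem {z : ℂ} (hz : z ∈ L.lattice) : Reg L z := by
  have := L.derivWeierstrassP_coe ⟨z, hz⟩
  simp_all [Reg]

theorem mem_compl_lattice_nhds {z : ℂ} (hz : z ∉ L.lattice) : ∀ᶠ u in 𝓝 z, u ∉ L.lattice :=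
  L.isClosed_lattice.isOpen_compl.mem_nhds hz

theorem notMem_lattice_nhdsNE (z : ℂ) : ∀ᶠ u in 𝓝[≠] z, u ∉ L.lattice := by
  have h := L.compl_lattice_sdiff_singleton_mem_nhds z
  filter_upwards [nhdsWithin_le_nhds h, self_mem_nhdsWithin] with u hu hne hm
  exact hu ⟨hm, hne⟩

theorem analyticAt_P {z : ℂ} (hz : z ∉ L.lattice) : AnalyticAt ℂ ℘[L] z :=
  L.analyticOnNhd_weierstrassP z hz

theorem analyticAt_P' {z : ℂ} (hz : z ∉ L.lattice) : AnalyticAt ℂ ℘'[L] z :=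
  L.analyticOnNhd_derivWeierstrassP z hz

/-- Laurent data at a lattice point. -/
theorem exists_laurent {l : ℂ} (hl : l ∈ L.lattice) : ∃ A B : ℂ → ℂ,
    AnalyticAt ℂ A l ∧ AnalyticAt ℂ B l ∧ A l = 0 ∧ B l = -2 ∧
    ∀ z ≠ l, (z - l) ^ 3 * ℘[L] z = A z ∧ (z - l) ^ 3 * ℘'[L] z = B z := by
  have h1 := L.analyticAt_weierstrassPExcept l
  have h2 := L.analyticAt_derivWeierstrassPExcept l
  refine ⟨fun z => (z - l) ^ 3 * ℘[L - l] z + ((z - l) - (z - l) ^ 3 * (l ^ 2)⁻¹),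
    fun z => (z - l) ^ 3 * ℘'[L - l] z - 2, by fun_prop, by fun_prop, by simp, by simp, ?_⟩
  intro z hz
  have hz' : z - l ≠ 0 := sub_ne_zero.2 hz
  have e1 := L.weierstrassPExcept_add ⟨l, hl⟩ z
  have e2 := L.derivWeierstrassPExcept_sub ⟨l, hl⟩ z
  simp only at e1 e2
  constructor
  · rw [← e1, one_div (l ^ 2)]; field_simp
  · rw [← e2]; field_simp

theorem sF_analyticAt {z : ℂ} (hz : Reg L z) : AnalyticAt ℂ (sF L) z := by
  by_cases hl : z ∈ L.lattice
  · obtain ⟨A, B, hA, hB, hA0, hB0, h⟩ := exists_laurent hl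
    have hden : 9 * (z - z) ^ 3 + B z ≠ 0 := by simp [hB0]
    have : AnalyticAt ℂ (fun u => 6 * A u / (9 * (u - z) ^ 3 + B u)) z := by fun_prop (disch := assumption)
    refine this.congr (Eventually.of_forall fun u => ?_)
    rcases eq_or_ne u z with rfl | hu
    · simp [hA0, sF_of_mem hl]
    · have : (u - z) ^ 3 ≠ 0 := pow_ne_zero _ (sub_ne_zero.2 hu)
      simp only [sF, ← (h u hu).1, ← (h u hu).2]
      rw [← mul_div_mul_left _ (9 + ℘'[L] u) this]
      ring
  · have h1 := analyticAt_P hl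
    have h2 := analyticAt_P' hl
    have h3 : 9 + ℘'[L] z ≠ 0 := hz
    unfold sF
    fun_prop (disch := assumption)

theorem cF_analyticAt {z : ℂ} (hz : Reg L z) : AnalyticAt ℂ (cF L) z := by
  by_cases hl : z ∈ L.lattice
  · obtain ⟨A, B, hA, hB, hA0, hB0, h⟩ := exists_laurent hl
    have hden : 9 * (z - z) ^ 3 + B z ≠ 0 := by simp [hB0]
    have : AnalyticAt ℂ (fun u => (B u - 9 * (u - z) ^ 3) / (9 * (u - z) ^ 3 + B u)) z := by
      fun_prop (disch := assumption)
    refine this.congr ?_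
    filter_upwards [eventually_nhdsWithin_iff.1 (notMem_lattice_nhdsNE (L := L) z)] with u hu'
    rcases eq_or_ne u z with rfl | hu
    · simp [hB0, cF_of_mem hl]
    · have : (u - z) ^ 3 ≠ 0 := pow_ne_zero _ (sub_ne_zero.2 hu)
      simp only [cF_of_notMem (hu' hu), ← (h u hu).2]
      rw [← mul_div_mul_left _ (9 + ℘'[L] u) this]
      ring
  · have h2 := analyticAt_P' hl
    have h3 : 9 + ℘'[L] z ≠ 0 := hz
    have : AnalyticAt ℂ (fun u => (℘'[L] u - 9) / (9 + ℘'[L] u)) z := by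
      fun_prop (disch := assumption)
    refine this.congr ?_
    filter_upwards [mem_compl_lattice_nhds hl] with u hu
    rw [cF_of_notMem hu]

theorem sF_meromorphic : Meromorphic (sF L) := by
  intro z
  have h1 := L.meromorphic_weierstrassP z
  have h2 := L.meromorphic_derivWeierstrassP z
  unfold sF
  fun_prop

theorem cF_meromorphic : Meromorphic (cF L) := by
  intro z
  have h2 := L.meromorphic_derivWeierstrassP z
  have : MeromorphicAt (fun u => (℘'[L] u - 9) / (9 + ℘'[L] u)) z := by fun_prop
  refine this.congr ?_
  filter_upwards [notMem_lattice_nhdsNE z] with u hu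
  rw [cF_of_notMem hu]

theorem P'_ne_nhdsNE {l : ℂ} (hl : l ∈ L.lattice) (a : ℂ) : ∀ᶠ z in 𝓝[≠] l, ℘'[L] z ≠ a := by
  obtain ⟨A, B, hA, hB, hA0, hB0, h⟩ := exists_laurent hl
  have hc : ContinuousAt (fun z => B z - a * (z - l) ^ 3) l := by
    have := hB.continuousAt; fun_prop
  have h0 : (fun z => B z - a * (z - l) ^ 3) l ≠ 0 := by simp [hB0]
  filter_upwards [nhdsWithin_le_nhds (hc.eventually_ne h0), self_mem_nhdsWithin] with z hz hne he
  apply hz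
  rw [← (h z hne).2, he]; ring

theorem reg_nhds {z : ℂ} (hz : Reg L z) : ∀ᶠ u in 𝓝 z, Reg L u := by
  by_cases hl : z ∈ L.lattice
  · have h := eventually_nhdsWithin_iff.1 (P'_ne_nhdsNE hl (-9))
    filter_upwards [h] with u hu
    rcases eq_or_ne u z with rfl | hne
    · exact hz
    · exact fun h => hu hne (by linear_combination h)
  · have h2 := (analyticAt_P' hl).continuousAt
    have : ContinuousAt (fun u => 9 + ℘'[L] u) z := by fun_prop
    exact this.eventually_ne hz

/-- Poles are isolated. -/
theorem reg_nhdsNE (z : ℂ) : ∀ᶠ u in 𝓝[≠] z, Reg L u := by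
  by_contra hn
  have hF : Meromorphic (fun u => 9 + ℘'[L] u) := by
    intro z
    have h2 := L.meromorphic_derivWeierstrassP z
    fun_prop
  have h := hF.eq_zero_of_frequently (z₀ := z) 
    ((Filter.not_eventually.1 hn).mono fun u hu => not_not.1 hu) 0
  have := (h.and (P'_ne_nhdsNE L.lattice.zero_mem (-9))).exists
  obtain ⟨u, h1, h2⟩ := this
  exact h2 (by linear_combination h1)

variable [Hex27 L]

theorem P'_sq {z : ℂ} (hz : z ∉ L.lattice) : ℘'[L] z ^ 2 = 4 * ℘[L] z ^ 3 - 27 := by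
  obtain ⟨w, hw, rfl⟩ := Hex27.exists_hex (L := L)
  rw [hex_P'_sq hz, Hex27.g₃_eq]

theorem sF_cube_add {z : ℂ} (hz : Reg L z) : sF L z ^ 3 + cF L z ^ 3 = 1 := by
  by_cases hl : z ∈ L.lattice
  · simp [sF_of_mem hl, cF_of_mem hl]
  · have h3 : 9 + ℘'[L] z ≠ 0 := hz
    rw [sF, cF_of_notMem hl]
    field_simp
    linear_combination -54 * P'_sq hl

theorem deriv_P' {z : ℂ} (hz : z ∉ L.lattice) (h0 : ℘'[L] z ≠ 0) :
    deriv ℘'[L] z = 6 * ℘[L] z ^ 2 := by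
  have h1 : HasDerivAt ℘[L] (℘'[L] z) z := by
    rw [← L.deriv_weierstrassP]
    exact (analyticAt_P hz).differentiableAt.hasDerivAt
  have h2 := (analyticAt_P' hz).differentiableAt.hasDerivAt
  have h3 := h2.fun_pow 2
  have h4 : HasDerivAt (fun u => 4 * ℘[L] u ^ 3 - 27) _ z := ((h1.fun_pow 3).const_mul 4).sub_const 27
  have h5 : (fun u => ℘'[L] u ^ 2) =ᶠ[𝓝 z] fun u => 4 * ℘[L] u ^ 3 - 27 := by
    filter_upwards [mem_compl_lattice_nhds hz] with u hu using P'_sq hu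
  have h6 := h3.unique (h4.congr_of_eventuallyEq h5)
  norm_num at h6
  have : 2 * ℘'[L] z * (deriv ℘'[L] z - 6 * ℘[L] z ^ 2) = 0 := by linear_combination h6
  have := (mul_eq_zero.1 this).resolve_left (mul_ne_zero two_ne_zero h0)
  linear_combination this

theorem deriv_sF_cF_aux {z : ℂ} (hz : z ∉ L.lattice) (h0 : ℘'[L] z ≠ 0) (h3 : 9 + ℘'[L] z ≠ 0) :
    deriv (sF L) z = -3 * cF L z ^ 2 ∧ deriv (cF L) z = 3 * sF L z ^ 2 := by
  have h1 : HasDerivAt ℘[L] (℘'[L] z) z := by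
    rw [← L.deriv_weierstrassP]
    exact (analyticAt_P hz).differentiableAt.hasDerivAt
  have h2 := (analyticAt_P' hz).differentiableAt.hasDerivAt
  rw [deriv_P' hz h0] at h2
  constructor
  · have := ((h1.const_mul 6).div (h2.const_add 9) h3).deriv
    refine Eq.trans this ?_
    rw [cF_of_notMem hz]
    field_simp
    linear_combination 9 * P'_sq hz
  · have h4 : cF L =ᶠ[𝓝 z] fun u => (℘'[L] u - 9) / (9 + ℘'[L] u) := by
      filter_upwards [mem_compl_lattice_nhds hz] with u hu using cF_of_notMem hu
    rw [h4.deriv_eq]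
    have := ((h2.sub_const 9).fun_div (h2.const_add 9) h3).deriv
    refine Eq.trans this ?_
    rw [sF]
    field_simp
    ring

theorem deriv_sF {z : ℂ} (hz : Reg L z) : deriv (sF L) z = -3 * cF L z ^ 2 := by
  have hF : Meromorphic (fun u => deriv (sF L) u + 3 * cF L u ^ 2) := by
    intro u
    have h1 := (sF_meromorphic (L := L)).deriv u
    have h2 := cF_meromorphic (L := L) u
    fun_prop
  have hc : ContinuousAt (fun u => deriv (sF L) u + 3 * cF L u ^ 2) z := by
    have h1 := (sF_analyticAt hz).deriv.continuousAt
    have h2 := (cF_analyticAt hz).continuousAt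
    fun_prop
  have := hF.apply_eq_zero (z₀ := 0) (z := z) ?_ hc
  · linear_combination this
  · refine Eventually.frequently ?_
    filter_upwards [notMem_lattice_nhdsNE (L := L) 0, P'_ne_nhdsNE L.lattice.zero_mem 0,
      reg_nhdsNE 0] with u h1 h2 h3
    rw [(deriv_sF_cF_aux h1 h2 h3).1]; ring

theorem deriv_cF {z : ℂ} (hz : Reg L z) : deriv (cF L) z = 3 * sF L z ^ 2 := by
  have hF : Meromorphic (fun u => deriv (cF L) u - 3 * sF L u ^ 2) := by
    intro u
    have h1 := (cF_meromorphic (L := L)).deriv u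
    have h2 := sF_meromorphic (L := L) u
    fun_prop
  have hc : ContinuousAt (fun u => deriv (cF L) u - 3 * sF L u ^ 2) z := by
    have h1 := (cF_analyticAt hz).deriv.continuousAt
    have h2 := (sF_analyticAt hz).continuousAt
    fun_prop
  have := hF.apply_eq_zero (z₀ := 0) (z := z) ?_ hc
  · linear_combination this
  · refine Eventually.frequently ?_
    filter_upwards [notMem_lattice_nhdsNE (L := L) 0, P'_ne_nhdsNE L.lattice.zero_mem 0,
      reg_nhdsNE 0] with u h1 h2 h3
    rw [(deriv_sF_cF_aux h1 h2 h3).2]; ring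

theorem hasDerivAt_sF {z : ℂ} (hz : Reg L z) : HasDerivAt (sF L) (-3 * cF L z ^ 2) z :=
  deriv_sF hz ▸ (sF_analyticAt hz).differentiableAt.hasDerivAt

theorem hasDerivAt_cF {z : ℂ} (hz : Reg L z) : HasDerivAt (cF L) (3 * sF L z ^ 2) z :=
  deriv_cF hz ▸ (cF_analyticAt hz).differentiableAt.hasDerivAt

end Fermat

section Law

open Filter Topology

variable {L : PeriodPair}

theorem P'_add {z l : ℂ} (hl : l ∈ L.lattice) : ℘'[L] (z + l) = ℘'[L] z :=
  L.derivWeierstrassP_add_coe z ⟨l, hl⟩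

theorem reg_add_iff {z l : ℂ} (hl : l ∈ L.lattice) : Reg L (z + l) ↔ Reg L z := by
  rw [Reg, Reg, P'_add hl]

theorem sF_add {z l : ℂ} (hl : l ∈ L.lattice) : sF L (z + l) = sF L z := by
  rw [sF, sF, P'_add hl, L.weierstrassP_add_coe z ⟨l, hl⟩]

theorem cF_add {z l : ℂ} (hl : l ∈ L.lattice) : cF L (z + l) = cF L z := by
  rw [cF, cF, P'_add hl]
  congr 1
  exact propext (Submodule.add_mem_iff_left _ hl)

theorem sF_congr {z z' : ℂ} (h : z - z' ∈ L.lattice) : sF L z = sF L z' := by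
  rw [← sF_add (z := z') h]; congr 1; ring

theorem cF_congr {z z' : ℂ} (h : z - z' ∈ L.lattice) : cF L z = cF L z' := by
  rw [← cF_add (z := z') h]; congr 1; ring

theorem reg_congr {z z' : ℂ} (h : z - z' ∈ L.lattice) : Reg L z ↔ Reg L z' := by
  rw [← reg_add_iff (z := z') h]; congr! 1; ring

theorem sF_zero : sF L 0 = 0 := sF_of_mem L.lattice.zero_mem

theorem cF_zero : cF L 0 = 1 := cF_of_mem L.lattice.zero_mem

theorem reg_zero : Reg L 0 := reg_of_mem L.lattice.zero_mem

theorem cF_ne_zero_iff {z : ℂ} (hz : Reg L z) : cF L z ≠ 0 ↔ Reg L (-z) := by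
  by_cases hl : z ∈ L.lattice
  · simp [cF_of_mem hl, reg_of_mem (neg_mem hl)]
  · rw [cF_of_notMem hl, div_ne_zero_iff, Reg, L.derivWeierstrassP_neg]
    refine ⟨fun h h' => h.1 (by linear_combination -h'), fun h => ⟨fun h' => h (by linear_combination -h'), hz⟩⟩

theorem sF_neg {z : ℂ} (hz : Reg L z) (hc : cF L z ≠ 0) : sF L (-z) = -sF L z / cF L z := by
  by_cases hl : z ∈ L.lattice
  · simp [sF_of_mem hl, sF_of_mem (neg_mem hl)]
  · have h1 := (cF_ne_zero_iff hz).1 hc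
    rw [Reg] at hz h1
    rw [cF_of_notMem hl] at hc ⊢
    rw [sF, sF, L.weierstrassP_neg]
    rw [L.derivWeierstrassP_neg] at h1 ⊢
    have h2 : ℘'[L] z - 9 ≠ 0 := fun h => h1 (by linear_combination -h)
    field_simp
    ring

theorem cF_neg {z : ℂ} (hz : Reg L z) (hc : cF L z ≠ 0) : cF L (-z) = 1 / cF L z := by
  by_cases hl : z ∈ L.lattice
  · simp [cF_of_mem hl, cF_of_mem (neg_mem hl)]
  · have h1 := (cF_ne_zero_iff hz).1 hc
    have hl' : -z ∉ L.lattice := by rwa [neg_mem_iff]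
    rw [Reg] at hz h1
    rw [cF_of_notMem hl] at hc ⊢
    rw [cF_of_notMem hl']
    rw [L.derivWeierstrassP_neg] at h1 ⊢
    have h2 : ℘'[L] z - 9 ≠ 0 := fun h => h1 (by linear_combination -h)
    field_simp
    ring

/-- Zeros of `cF` are isolated. -/
theorem cF_ne_zero_nhdsNE (z : ℂ) : ∀ᶠ u in 𝓝[≠] z, cF L u ≠ 0 := by
  by_contra hn
  have h := (cF_meromorphic (L := L)).apply_eq_zero (z := 0)
    ((Filter.not_eventually.1 hn).mono fun u hu => not_not.1 hu) (cF_analyticAt reg_zero).continuousAt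
  simp [cF_zero] at h

variable [Hex27 L]

theorem mul_mem_lattice {a z : ℂ} (ha : a ∈ O3) (hz : z ∈ L.lattice) : a * z ∈ L.lattice := by
  obtain ⟨w, hw, rfl⟩ := Hex27.exists_hex (L := L)
  exact mul_mem_hex ha hz

theorem ρ3_mul_mem_iff {z : ℂ} : ρ3 * z ∈ L.lattice ↔ z ∈ L.lattice := by
  refine ⟨fun h => ?_, mul_mem_lattice ρ3_mem⟩
  have := mul_mem_lattice (pow_mem ρ3_mem 2) h
  rwa [← mul_assoc, ← pow_succ, ρ3_cube, one_mul] at this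

theorem P'_rho (z : ℂ) : ℘'[L] (ρ3 * z) = ℘'[L] z := by
  obtain ⟨w, hw, rfl⟩ := Hex27.exists_hex (L := L)
  exact hex_P'_rho z

theorem P_rho (z : ℂ) : ℘[L] (ρ3 * z) = ρ3 * ℘[L] z := by
  obtain ⟨w, hw, rfl⟩ := Hex27.exists_hex (L := L)
  exact hex_P_rho z

theorem reg_rho {z : ℂ} : Reg L (ρ3 * z) ↔ Reg L z := by rw [Reg, Reg, P'_rho]

theorem sF_rho (z : ℂ) : sF L (ρ3 * z) = ρ3 * sF L z := by
  rw [sF, sF, P'_rho, P_rho]; ring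

theorem cF_rho (z : ℂ) : cF L (ρ3 * z) = cF L z := by
  rw [cF, cF, P'_rho]
  congr 1
  exact propext ρ3_mul_mem_iff

theorem eventually_const_of_deriv {f : ℂ → ℂ} {z : ℂ} (h : ∀ᶠ u in 𝓝 z, HasDerivAt f 0 u) :
    ∀ᶠ u in 𝓝 z, f u = f z := by
  obtain ⟨r, hr, hb⟩ := Metric.eventually_nhds_iff_ball.1 h
  obtain ⟨a, ha⟩ := Metric.isOpen_ball.exists_is_const_of_deriv_eq_zero
    (convex_ball z r).isPreconnected (fun u hu => (hb u hu).differentiableAt.differentiableWithinAt)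
    (fun u hu => (hb u hu).deriv)
  filter_upwards [Metric.ball_mem_nhds z hr] with u hu
  rw [ha u hu, ha z (Metric.mem_ball_self hr)]

theorem law_nhds_zero {t : ℂ} (ht : Reg L t) (hc : cF L t ≠ 0) : ∀ᶠ u in 𝓝 0,
    sF L u + cF L u ^ 2 * sF L (t - u) * cF L (t - u) =
      sF L t * (cF L (t - u) + sF L u * cF L u * sF L (t - u) ^ 2) ∧
    cF L u * cF L (t - u) ^ 2 - sF L u ^ 2 * sF L (t - u) =
      cF L t * (cF L (t - u) + sF L u * cF L u * sF L (t - u) ^ 2) := by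
  set D : ℂ → ℂ := fun u => cF L (t - u) + sF L u * cF L u * sF L (t - u) ^ 2 with hD
  set N : ℂ → ℂ := fun u => sF L u + cF L u ^ 2 * sF L (t - u) * cF L (t - u) with hN
  set M : ℂ → ℂ := fun u => cF L u * cF L (t - u) ^ 2 - sF L u ^ 2 * sF L (t - u) with hM
  have hsub : Tendsto (fun u : ℂ => t - u) (𝓝 0) (𝓝 t) := by
    have : ContinuousAt (fun u : ℂ => t - u) 0 := by fun_prop
    simpa [ContinuousAt] using this
  have e1 : ∀ᶠ u in 𝓝 (0 : ℂ), Reg L u := reg_nhds reg_zero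
  have e2 : ∀ᶠ u in 𝓝 (0 : ℂ), Reg L (t - u) := hsub.eventually (reg_nhds ht)
  have key : ∀ᶠ u in 𝓝 (0 : ℂ), Reg L u ∧ Reg L (t - u) ∧
    HasDerivAt D (6 * cF L u * sF L (t - u) * (sF L u * cF L (t - u) ^ 2 - cF L u ^ 2 * sF L (t - u))) u ∧
    HasDerivAt N (6 * cF L u * sF L (t - u) * (sF L u ^ 2 * cF L (t - u) - cF L u * sF L (t - u) ^ 2)) u ∧
    HasDerivAt M (6 * cF L u * sF L (t - u) * (sF L u * cF L u - cF L (t - u) * sF L (t - u))) u := by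
    filter_upwards [e1, e2] with u h1 h2
    have hs := hasDerivAt_sF h1
    have hc := hasDerivAt_cF h1
    have hS := (hasDerivAt_sF h2).comp u ((hasDerivAt_id u).const_sub t)
    have hC := (hasDerivAt_cF h2).comp u ((hasDerivAt_id u).const_sub t)
    have q1 := sF_cube_add h1
    have q2 := sF_cube_add h2
    refine ⟨h1, h2, ?_, ?_, ?_⟩
    · refine (hC.add ((hs.mul hc).mul (hS.pow 2))).congr_deriv ?_
      simp only [Function.comp, Pi.mul_apply, Pi.pow_apply]
      linear_combination (3 * sF L (t - u) ^ 2) * q1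
    · refine (hs.add (((hc.pow 2).mul hS).mul hC)).congr_deriv ?_
      simp only [Function.comp, Pi.mul_apply, Pi.pow_apply]
      linear_combination (3 * cF L u ^ 2) * q2
    · refine ((hc.mul (hC.pow 2)).sub ((hs.pow 2).mul hS)).congr_deriv ?_
      simp only [Function.comp, Pi.pow_apply]
      ring
  have hD0 : D 0 = cF L t := by simp [hD, sF_zero]
  have hN0 : N 0 = sF L t * cF L t := by simp [hN, sF_zero, cF_zero]
  have hM0 : M 0 = cF L t ^ 2 := by simp [hM, sF_zero, cF_zero]
  have hDne : ∀ᶠ u in 𝓝 (0 : ℂ), D u ≠ 0 := by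
    obtain ⟨-, -, h, -⟩ := key.self_of_nhds
    exact h.continuousAt.eventually_ne (by rwa [hD0])
  have k1 : ∀ᶠ u in 𝓝 (0 : ℂ), HasDerivAt (fun u => N u / D u) 0 u := by
    filter_upwards [key, hDne] with u ⟨h1, h2, dD, dN, dM⟩ h0
    have q1 := sF_cube_add h1
    have q2 := sF_cube_add h2
    refine (dN.fun_div dD h0).congr_deriv ?_
    rw [div_eq_zero_iff]; left
    simp only [hN, hD]
    generalize sF L u = s at *
    generalize cF L u = c at *
    generalize sF L (t - u) = S at *
    generalize cF L (t - u) = C at *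
    linear_combination (6 * c * S) * ((S^2*C*c) * q1 - (s*c^2*S)*q2)
  have k2 : ∀ᶠ u in 𝓝 (0 : ℂ), HasDerivAt (fun u => M u / D u) 0 u := by
    filter_upwards [key, hDne] with u ⟨h1, h2, dD, dN, dM⟩ h0
    have q1 := sF_cube_add h1
    have q2 := sF_cube_add h2
    refine (dM.fun_div dD h0).congr_deriv ?_
    rw [div_eq_zero_iff]; left
    simp only [hM, hD]
    generalize sF L u = s at *
    generalize cF L u = c at *
    generalize sF L (t - u) = S at *
    generalize cF L (t - u) = C at *
    linear_combination (6 * c * S) * ((C^2 * S) * q1 - (s*c*C)*q2)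
  filter_upwards [hDne, eventually_const_of_deriv k1, eventually_const_of_deriv k2] with u h0 h1 h2
  rw [hD0, div_eq_div_iff h0 hc] at h1 h2
  rw [hN0] at h1
  rw [hM0] at h2
  exact ⟨mul_right_cancel₀ hc (by linear_combination h1),
    mul_right_cancel₀ hc (by linear_combination h2)⟩

theorem meromorphic_comp_affine {f : ℂ → ℂ} (hf : Meromorphic f) (a b : ℂ) :
    Meromorphic fun u => f (a * u + b) := fun z =>
  MeromorphicAt.comp_analyticAt (f := f) (g := fun u => a * u + b) (hf _) (by fun_prop)

theorem law_of_ne_zero {u v : ℂ} (hu : Reg L u) (hv : Reg L v) (ht : Reg L (u + v))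
    (hc : cF L (u + v) ≠ 0) :
    sF L u + cF L u ^ 2 * sF L v * cF L v =
      sF L (u + v) * (cF L v + sF L u * cF L u * sF L v ^ 2) ∧
    cF L u * cF L v ^ 2 - sF L u ^ 2 * sF L v =
      cF L (u + v) * (cF L v + sF L u * cF L u * sF L v ^ 2) := by
  have key := law_nhds_zero ht hc
  set t := u + v with htdef
  have hv' : t - u = v := by rw [htdef]; ring
  have mS : Meromorphic fun u => sF L (t - u) := by
    simpa [sub_eq_neg_add] using meromorphic_comp_affine (sF_meromorphic (L := L)) (-1) t
  have mC : Meromorphic fun u => cF L (t - u) := by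
    simpa [sub_eq_neg_add] using meromorphic_comp_affine (cF_meromorphic (L := L)) (-1) t
  have cs := (sF_analyticAt hu).continuousAt
  have cc := (cF_analyticAt hu).continuousAt
  have cS : ContinuousAt (fun u => sF L (t - u)) u :=
    ContinuousAt.comp (f := fun u : ℂ => t - u) (g := sF L) (by
      simpa only [hv'] using (sF_analyticAt hv).continuousAt) (by fun_prop)
  have cC : ContinuousAt (fun u => cF L (t - u)) u :=
    ContinuousAt.comp (f := fun u : ℂ => t - u) (g := cF L) (by
      simpa only [hv'] using (cF_analyticAt hv).continuousAt) (by fun_prop)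
  constructor
  · have := Meromorphic.apply_eq_zero (F := fun u => sF L u + cF L u ^ 2 * sF L (t - u) * cF L (t - u) -
      sF L t * (cF L (t - u) + sF L u * cF L u * sF L (t - u) ^ 2)) (z₀ := 0) (z := u) ?_ ?_ ?_
    · rw [hv'] at this; linear_combination this
    · intro z
      have m1 := mS z; have m2 := mC z
      have m3 := sF_meromorphic (L := L) z; have m4 := cF_meromorphic (L := L) z
      fun_prop
    · refine Eventually.frequently (Filter.Eventually.filter_mono nhdsWithin_le_nhds ?_)
      filter_upwards [key] with z hz
      rw [hz.1]; ring
    · fun_prop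
  · have := Meromorphic.apply_eq_zero (F := fun u => cF L u * cF L (t - u) ^ 2 - sF L u ^ 2 * sF L (t - u) -
      cF L t * (cF L (t - u) + sF L u * cF L u * sF L (t - u) ^ 2)) (z₀ := 0) (z := u) ?_ ?_ ?_
    · rw [hv'] at this; linear_combination this
    · intro z
      have m1 := mS z; have m2 := mC z
      have m3 := sF_meromorphic (L := L) z; have m4 := cF_meromorphic (L := L) z
      fun_prop
    · refine Eventually.frequently (Filter.Eventually.filter_mono nhdsWithin_le_nhds ?_)
      filter_upwards [key] with z hz
      rw [hz.2]; ring
    · fun_prop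

theorem tendsto_add_nhdsNE (u v : ℂ) : Tendsto (fun z => u + z) (𝓝[≠] v) (𝓝[≠] (u + v)) := by
  refine tendsto_nhdsWithin_of_tendsto_nhds_of_eventually_within _ ?_ ?_
  · exact (Continuous.tendsto (by fun_prop) v).mono_left nhdsWithin_le_nhds
  · filter_upwards [self_mem_nhdsWithin] with z hz h
    exact hz (add_left_cancel h)

/-- The addition law. -/
theorem addition_law {u v : ℂ} (hu : Reg L u) (hv : Reg L v) (ht : Reg L (u + v)) :
    sF L (u + v) * (cF L v + sF L u * cF L u * sF L v ^ 2) =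
      sF L u + cF L u ^ 2 * sF L v * cF L v ∧
    cF L (u + v) * (cF L v + sF L u * cF L u * sF L v ^ 2) =
      cF L u * cF L v ^ 2 - sF L u ^ 2 * sF L v := by
  have key : ∀ᶠ z in 𝓝[≠] v, Reg L z ∧ Reg L (u + z) ∧ cF L (u + z) ≠ 0 :=
    (reg_nhdsNE v).and (((tendsto_add_nhdsNE u v).eventually (reg_nhdsNE _)).and
      ((tendsto_add_nhdsNE u v).eventually (cF_ne_zero_nhdsNE _)))
  have cs := (sF_analyticAt hv).continuousAt
  have cc := (cF_analyticAt hv).continuousAt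
  have cS : ContinuousAt (fun z => sF L (u + z)) v :=
    ContinuousAt.comp (f := fun z : ℂ => u + z) (sF_analyticAt ht).continuousAt (by fun_prop)
  have cC : ContinuousAt (fun z => cF L (u + z)) v :=
    ContinuousAt.comp (f := fun z : ℂ => u + z) (cF_analyticAt ht).continuousAt (by fun_prop)
  constructor
  · have := eq_zero_of_frequently_eq_zero (z := v)
      (F := fun z => sF L (u + z) * (cF L z + sF L u * cF L u * sF L z ^ 2) -
        (sF L u + cF L u ^ 2 * sF L z * cF L z)) (by fun_prop) ?_
    · linear_combination this
    · refine Eventually.frequently (key.mono fun z ⟨h1, h2, h3⟩ => ?_)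
      rw [(law_of_ne_zero hu h1 h2 h3).1]; ring
  · have := eq_zero_of_frequently_eq_zero (z := v)
      (F := fun z => cF L (u + z) * (cF L z + sF L u * cF L u * sF L z ^ 2) -
        (cF L u * cF L z ^ 2 - sF L u ^ 2 * sF L z)) (by fun_prop) ?_
    · linear_combination this
    · refine Eventually.frequently (key.mono fun z ⟨h1, h2, h3⟩ => ?_)
      rw [(law_of_ne_zero hu h1 h2 h3).2]; ring

/-- The sum of two regular points is regular as soon as the denominator does not vanish. -/
theorem reg_add_of_ne_zero {u v : ℂ} (hu : Reg L u) (hv : Reg L v)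
    (hD : cF L v + sF L u * cF L u * sF L v ^ 2 ≠ 0) : Reg L (u + v) := by
  by_contra hn
  have hP : ℘'[L] (u + v) = -9 := by
    have := not_not.1 hn
    linear_combination this
  have hl : u + v ∉ L.lattice := fun h => hn (reg_of_mem h)
  have key : ∀ᶠ z in 𝓝[≠] v, Reg L z ∧ Reg L (u + z) ∧ u + z ∉ L.lattice :=
    (reg_nhdsNE v).and (((tendsto_add_nhdsNE u v).eventually (reg_nhdsNE _)).and
      ((tendsto_add_nhdsNE u v).eventually (notMem_lattice_nhdsNE _)))
  have cs := (sF_analyticAt hv).continuousAt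
  have cc := (cF_analyticAt hv).continuousAt
  have cP : ContinuousAt (fun z => ℘'[L] (u + z)) v :=
    ContinuousAt.comp (f := fun z : ℂ => u + z) (analyticAt_P' hl).continuousAt (by fun_prop)
  have := eq_zero_of_frequently_eq_zero (z := v)
    (F := fun z => (℘'[L] (u + z) - 9) * (cF L z + sF L u * cF L u * sF L z ^ 2) -
      (9 + ℘'[L] (u + z)) * (cF L u * cF L z ^ 2 - sF L u ^ 2 * sF L z)) (by fun_prop) ?_
  · simp only [hP] at this
    exact hD (by linear_combination (-1 / 18 : ℂ) * this)
  · refine Eventually.frequently (key.mono fun z ⟨h1, h2, h3⟩ => ?_)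
    have h4 := (addition_law hu h1 h2).2
    have h5 : 9 + ℘'[L] (u + z) ≠ 0 := h2
    rw [cF_of_notMem h3, div_mul_eq_mul_div, div_eq_iff h5] at h4
    rw [h4]; ring

end Law

section Liouville

open Filter Topology

variable {L : PeriodPair}

theorem liouville_periodic {f : ℂ → ℂ} (hf : Meromorphic f)
    (hper : ∀ l ∈ L.lattice, ∀ z, f (z + l) = f z) (hord : ∀ z, 0 ≤ meromorphicOrderAt f z) :
    ∃ k, ∀ z, ∀ᶠ u in 𝓝[≠] z, f u = k := by
  have hfo : MeromorphicOn f Set.univ := fun z _ => hf z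
  set g := toMeromorphicNFOn f Set.univ with hg
  have hfg (z : ℂ) : f =ᶠ[𝓝[≠] z] g := (hfo.toMeromorphicNFOn_eq_self_on_nhdsNE (Set.mem_univ z)).symm
  have han (z : ℂ) : AnalyticAt ℂ g z := by
    refine (meromorphicNFOn_toMeromorphicNFOn f Set.univ
      (Set.mem_univ z)).meromorphicOrderAt_nonneg_iff_analyticAt.1 ?_
    rw [meromorphicOrderAt_toMeromorphicNFOn hfo (Set.mem_univ z)]
    exact hord z
  have hdiff : Differentiable ℂ g := fun z => (han z).differentiableAt
  have hgper (z l : ℂ) (hl : l ∈ L.lattice) : g (z + l) = g z := by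
    refine sub_eq_zero.1 (eq_zero_of_frequently_eq_zero (F := fun z => g (z + l) - g z) (z := z) ?_ ?_)
    · exact ((hdiff.continuous.comp (continuous_id.add continuous_const)).sub
        hdiff.continuous).continuousAt
    · apply Eventually.frequently
      have h1 := (tendsto_add_nhdsNE l z).eventually (hfg (l + z))
      filter_upwards [hfg z, h1] with u h2 h3
      rw [← h2, add_comm u l, ← h3, add_comm l u, hper l hl, sub_self]
  have hb : Bornology.IsBounded (Set.range g) :=
    (IsZLattice.isCompact_range_of_periodic L.lattice g hdiff.continuous hgper).isBounded
  exact ⟨g 0, fun z => (hfg z).mono fun u hu => hu.trans (hdiff.apply_eq_apply_of_bounded hb u 0)⟩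

theorem exists_P_eq (x : ℂ) : ∃ z ∉ L.lattice, ℘[L] z = x := by
  by_contra! hn
  have hm : Meromorphic fun z => (℘[L] z - x)⁻¹ :=
    fun z => ((L.meromorphic_weierstrassP z).sub (MeromorphicAt.const x z)).inv
  have hlat (z : ℂ) (hz : z ∈ L.lattice) : 0 < meromorphicOrderAt (fun z => (℘[L] z - x)⁻¹) z := by
    have h1 : meromorphicOrderAt (fun z => ℘[L] z - x) z = -2 := by
      have h2 := L.order_weierstrassP z hz
      have h3 : 0 ≤ meromorphicOrderAt (fun _ : ℂ => -x) z := analyticAt_const.meromorphicOrderAt_nonneg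
      have h4 := meromorphicOrderAt_add_eq_left_of_lt (f₁ := ℘[L]) (MeromorphicAt.const (-x) z)
        (by rw [h2]; exact lt_of_lt_of_le (by decide) h3)
      rw [h2] at h4
      simpa [sub_eq_add_neg, Pi.add_def] using h4
    have h2 := meromorphicOrderAt_inv (f := fun z => ℘[L] z - x) (x := z)
    rw [h1] at h2
    have h3 : meromorphicOrderAt (fun z => (℘[L] z - x)⁻¹) z = - -2 := h2
    rw [h3]; decide
  have hoff (z : ℂ) (hz : z ∉ L.lattice) : AnalyticAt ℂ (fun z => (℘[L] z - x)⁻¹) z :=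
    ((analyticAt_P hz).sub analyticAt_const).inv (sub_ne_zero.2 (hn z hz))
  obtain ⟨k, hk⟩ := liouville_periodic (L := L) hm
    (fun l hl z => by rw [L.weierstrassP_add_coe z ⟨l, hl⟩]) (fun z => by
      by_cases hz : z ∈ L.lattice
      · exact (hlat z hz).le
      · exact (hoff z hz).meromorphicOrderAt_nonneg)
  have hk0 : k = 0 := by
    have h1 := tendsto_zero_of_meromorphicOrderAt_pos (hlat 0 L.lattice.zero_mem)
    have h2 : Tendsto (fun z => (℘[L] z - x)⁻¹) (𝓝[≠] 0) (𝓝 k) :=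
      tendsto_const_nhds.congr' ((hk 0).mono fun u hu => hu.symm)
    exact tendsto_nhds_unique h2 h1
  obtain ⟨u, hu, hu'⟩ := ((hk 0).and (notMem_lattice_nhdsNE (L := L) 0)).exists
  rw [hk0, inv_eq_zero, sub_eq_zero] at hu
  exact hn u hu' hu

theorem cF_eq_one_imp {z : ℂ} (hz : Reg L z) (h : cF L z = 1) : z ∈ L.lattice := by
  by_contra hl
  rw [cF_of_notMem hl, div_eq_one_iff_eq hz] at h
  have : (18 : ℂ) = 0 := by linear_combination -h
  norm_num at this

variable [Hex27 L]

theorem exists_sF_cF_eq {a b : ℂ} (h : a ^ 3 + b ^ 3 = 1) : ∃ z, Reg L z ∧ sF L z = a ∧ cF L z = b := by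
  by_cases hb : b = 1
  · have ha : a = 0 := by
      rw [hb] at h
      exact pow_eq_zero_iff (n := 3) (by norm_num) |>.1 (by linear_combination h)
    exact ⟨0, reg_zero, by rw [sF_zero, ha], by rw [cF_zero, hb]⟩
  have hb' : 1 - b ≠ 0 := sub_ne_zero.2 (Ne.symm hb)
  obtain ⟨z, hz, hx⟩ := exists_P_eq (L := L) (3 * a / (1 - b))
  have key (z : ℂ) (hz : z ∉ L.lattice) (hx : ℘[L] z = 3 * a / (1 - b))
      (hy : ℘'[L] z = 9 * (1 + b) / (1 - b)) : ∃ z, Reg L z ∧ sF L z = a ∧ cF L z = b := by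
    have h9 : 9 + ℘'[L] z = 18 / (1 - b) := by rw [hy]; field_simp; ring
    have h9' : 9 + ℘'[L] z ≠ 0 := by rw [h9]; exact div_ne_zero (by norm_num) hb'
    refine ⟨z, h9', ?_, ?_⟩
    · rw [sF, h9, hx]; field_simp; ring
    · rw [cF_of_notMem hz, h9, hy]; field_simp; ring
  have hy : (℘'[L] z - 9 * (1 + b) / (1 - b)) * (℘'[L] z + 9 * (1 + b) / (1 - b)) = 0 := by
    have := P'_sq hz
    rw [hx] at this
    have h4 : ℘'[L] z ^ 2 - (9 * (1 + b) / (1 - b)) ^ 2 = 0 := by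
      rw [this]
      field_simp
      linear_combination 108 * h
    linear_combination h4
  rcases mul_eq_zero.1 hy with hy | hy
  · exact key z hz hx (by linear_combination hy)
  · refine key (-z) (by rwa [neg_mem_iff]) (by rw [L.weierstrassP_neg, hx]) ?_
    rw [L.derivWeierstrassP_neg]; linear_combination -hy

theorem sub_mem_of_eq_of_ne_zero {u v : ℂ} (hu : Reg L u) (hv : Reg L v) (hs : sF L u = sF L v)
    (hc : cF L u = cF L v) (hc0 : cF L v ≠ 0) : u - v ∈ L.lattice := by
  have hv' := (cF_ne_zero_iff hv).1 hc0
  have hu' := (cF_ne_zero_iff hu).1 (hc ▸ hc0)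
  have h1 := sF_cube_add hv
  by_cases hD : 1 + sF L v ^ 3 = 0
  · have hD' : cF L u + sF L (-v) * cF L (-v) * sF L u ^ 2 ≠ 0 := by
      rw [sF_neg hv hc0, cF_neg hv hc0, hs, hc]
      intro h
      field_simp at h
      have h2 : cF L v ^ 3 = sF L v ^ 3 := by linear_combination h
      rw [h2] at h1
      have : (3 : ℂ) = 0 := by linear_combination 2 * hD - h1
      norm_num at this
    have hr := reg_add_of_ne_zero hv' hu hD'
    have h2 := (addition_law hv' hu hr).2
    have h3 : cF L (-v + u) = 1 := by
      refine mul_right_cancel₀ hD' (h2.trans ?_)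
      rw [sF_neg hv hc0, cF_neg hv hc0, hs, hc]
      field_simp
      ring
    simpa [sub_eq_neg_add] using cF_eq_one_imp hr h3
  · have hD' : cF L (-v) + sF L u * cF L u * sF L (-v) ^ 2 ≠ 0 := by
      rw [sF_neg hv hc0, cF_neg hv hc0, hs, hc]
      intro h
      field_simp at h
      exact hD (by linear_combination h)
    have hr := reg_add_of_ne_zero hu hv' hD'
    have h2 := (addition_law hu hv' hr).2
    have h3 : cF L (u + -v) = 1 := by
      refine mul_right_cancel₀ hD' (h2.trans ?_)
      rw [sF_neg hv hc0, cF_neg hv hc0, hs, hc]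
      field_simp
      ring
    simpa [sub_eq_add_neg] using cF_eq_one_imp hr h3

theorem add_of_cF_eq_zero {z v : ℂ} (hz : Reg L z) (hz0 : cF L z = 0) (hv : Reg L v)
    (hc : cF L v ≠ 0) : Reg L (z + v) ∧ sF L (z + v) = sF L z / cF L v ∧
      cF L (z + v) = -(sF L z ^ 2 * sF L v) / cF L v := by
  have hD : cF L v + sF L z * cF L z * sF L v ^ 2 ≠ 0 := by simpa [hz0] using hc
  have hr := reg_add_of_ne_zero hz hv hD
  obtain ⟨h1, h2⟩ := addition_law hz hv hr
  rw [hz0] at h1 h2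
  refine ⟨hr, ?_, ?_⟩
  · field_simp; linear_combination h1
  · field_simp; linear_combination h2

theorem exists_generic : ∃ v, Reg L v ∧ sF L v ≠ 0 ∧ cF L v ≠ 0 := by
  obtain ⟨a, ha⟩ := IsAlgClosed.exists_pow_nat_eq (2 : ℂ) (n := 3) (by norm_num)
  obtain ⟨v, hv, hs, hc⟩ := exists_sF_cF_eq (L := L) (a := a) (b := -1) (by rw [ha]; norm_num)
  refine ⟨v, hv, ?_, ?_⟩
  · rw [hs]; rintro rfl; norm_num at ha
  · rw [hc]; norm_num

theorem sub_mem_of_eq {u v : ℂ} (hu : Reg L u) (hv : Reg L v) (hs : sF L u = sF L v)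
    (hc : cF L u = cF L v) : u - v ∈ L.lattice := by
  by_cases hc0 : cF L v = 0
  · obtain ⟨w, hw, hws, hwc⟩ := exists_generic (L := L)
    obtain ⟨h1, h2, h3⟩ := add_of_cF_eq_zero hu (hc.trans hc0) hw hwc
    obtain ⟨h1', h2', h3'⟩ := add_of_cF_eq_zero hv hc0 hw hwc
    have hsv : sF L v ≠ 0 := by
      intro h
      have := sF_cube_add hv
      simp [h, hc0] at this
    have := sub_mem_of_eq_of_ne_zero h1 h1' (by rw [h2, h2', hs]) (by rw [h3, h3', hs])
      (by rw [h3']; simp [hsv, hws, hwc])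
    simpa using this
  · exact sub_mem_of_eq_of_ne_zero hu hv hs hc hc0

theorem three_mul_mem_of_cF_eq_zero {z : ℂ} (hz : Reg L z) (h0 : cF L z = 0) :
    3 * z ∈ L.lattice := by
  obtain ⟨v, hv, hs, hc⟩ := exists_generic (L := L)
  have h3 := sF_cube_add hz
  rw [h0] at h3
  have hsz : sF L z ≠ 0 := by
    intro h
    simp [h] at h3
  obtain ⟨r1, s1, c1⟩ := add_of_cF_eq_zero hz h0 hv hc
  obtain ⟨r2, s2, c2⟩ := add_of_cF_eq_zero hz h0 r1 (by rw [c1]; simp [hsz, hs, hc])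
  obtain ⟨r3, s3, c3⟩ := add_of_cF_eq_zero hz h0 r2 (by rw [c2, s1, c1]; simp [hsz, hs, hc])
  have := sub_mem_of_eq r3 hv
    (by rw [s3, c2, s1, c1]; field_simp) (by rw [c3, s2, c2, s1, c1]; field_simp)
  convert this using 1
  ring

theorem three_mul_mem_of_sF_eq_zero {z : ℂ} (hz : Reg L z) (h0 : sF L z = 0) :
    3 * z ∈ L.lattice := by
  have h3 := sF_cube_add hz
  rw [h0] at h3
  have hcz : cF L z ≠ 0 := by
    intro h
    simp [h] at h3
  have key (v : ℂ) (hv : Reg L v) (hs : sF L v = 0) (hc : cF L v ≠ 0) :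
      Reg L (z + v) ∧ sF L (z + v) = 0 ∧ cF L (z + v) = cF L z * cF L v := by
    have hr := reg_add_of_ne_zero hz hv (by simpa [h0] using hc)
    obtain ⟨h1, h2⟩ := addition_law hz hv hr
    simp only [h0, hs] at h1 h2
    refine ⟨hr, ?_, ?_⟩
    · exact mul_right_cancel₀ hc (by linear_combination h1)
    · exact mul_right_cancel₀ hc (by linear_combination h2)
  obtain ⟨r1, s1, c1⟩ := key z hz h0 hcz
  obtain ⟨r2, s2, c2⟩ := key _ r1 s1 (by rw [c1]; simp [hcz])
  have := cF_eq_one_imp r2 (by rw [c2, c1]; linear_combination h3)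
  convert this using 1
  ring

theorem three_mul_mem_of_not_reg {z : ℂ} (hz : ¬ Reg L z) : 3 * z ∈ L.lattice := by
  have h1 : 9 + ℘'[L] z = 0 := not_not.1 hz
  have h2 : Reg L (-z) := by
    rw [Reg, L.derivWeierstrassP_neg]
    intro h
    have : (18 : ℂ) = 0 := by linear_combination h + h1
    norm_num at this
  have h3 : cF L (-z) = 0 := by
    by_contra h
    have := (cF_ne_zero_iff h2).1 h
    rw [neg_neg] at this
    exact hz this
  have := neg_mem (three_mul_mem_of_cF_eq_zero h2 h3)
  convert this using 1
  ring

/-- Away from the `3`-torsion points, `sF` and `cF` have neither zeros nor poles. -/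
theorem generic_of_three_mul_notMem {z : ℂ} (h : 3 * z ∉ L.lattice) :
    Reg L z ∧ sF L z ≠ 0 ∧ cF L z ≠ 0 := by
  have hr : Reg L z := by
    by_contra hr
    exact h (three_mul_mem_of_not_reg hr)
  exact ⟨hr, fun h0 => h (three_mul_mem_of_sF_eq_zero hr h0),
    fun h0 => h (three_mul_mem_of_cF_eq_zero hr h0)⟩

end Liouville

section EisensteinPrime

/-- `π` is a primary prime of `ℤ[ρ]` of norm a rational prime `p ≡ 1 (mod 3)`. -/
structure EisPrime (π : ℂ) (p : ℕ) : Prop where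
  mem : π ∈ O3
  primary : ∃ d ∈ O3, π = 1 + 3 * d
  norm : π * (starRingEnd ℂ) π = p
  prime : p.Prime
  mod_three : p % 3 = 1

theorem int_mem_O3 (n : ℤ) : (n : ℂ) ∈ O3 := intCast_mem O3 n

theorem nat_mem_O3 (n : ℕ) : (n : ℂ) ∈ O3 := natCast_mem O3 n

theorem mul_conj_eq (a b : ℤ) : ((a : ℂ) + b * ρ3) * (starRingEnd ℂ) ((a : ℂ) + b * ρ3) =
    ((a ^ 2 - a * b + b ^ 2 : ℤ) : ℂ) := by
  rw [map_add, map_mul, conj_ρ3, map_intCast, map_intCast]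
  push_cast
  linear_combination (a * b : ℂ) * ρ3_quad + (b ^ 2 : ℂ) * ρ3_cube

theorem exists_norm {a : ℂ} (ha : a ∈ O3) : ∃ n : ℤ, a * (starRingEnd ℂ) a = n := by
  obtain ⟨x, y, rfl⟩ := mem_O3_iff.1 ha
  exact ⟨_, mul_conj_eq x y⟩

theorem int_pair_ext {a b a' b' : ℤ} (h : (a : ℂ) + b * ρ3 = a' + b' * ρ3) : a = a' ∧ b = b' := by
  have := int_add_mul_ρ3_eq_zero (a := (a : ℝ) - a') (b := (b : ℝ) - b')
    (by push_cast; linear_combination h)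
  exact ⟨by exact_mod_cast sub_eq_zero.1 this.1, by exact_mod_cast sub_eq_zero.1 this.2⟩

namespace EisPrime

variable {π : ℂ} {p : ℕ} (h : EisPrime π p)
include h

theorem ne_zero : π ≠ 0 := by
  rintro rfl
  have := h.norm
  rw [zero_mul] at this
  exact h.prime.ne_zero (by exact_mod_cast this.symm)

theorem cast_eq : (p : ℂ) = (starRingEnd ℂ) π * π := by rw [mul_comm, h.norm]

theorem dvd_of_eq_mul {n : ℤ} {a : ℂ} (ha : a ∈ O3) (hn : (n : ℂ) = π * a) : (p : ℤ) ∣ n := by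
  obtain ⟨N, hN⟩ := exists_norm ha
  have h1 : (n : ℂ) ^ 2 = p * N := by
    have : (starRingEnd ℂ) (n : ℂ) = (starRingEnd ℂ) π * (starRingEnd ℂ) a := by rw [hn, map_mul]
    rw [map_intCast] at this
    rw [← h.norm, ← hN, sq]
    nth_rewrite 1 [hn]
    rw [this]; ring
  have h2 : n ^ 2 = p * N := by exact_mod_cast h1
  exact Int.Prime.dvd_pow' h.prime (Dvd.intro N h2.symm)

theorem exists_int_sub_ρ3 : ∃ m : ℤ, ∃ b ∈ O3, ρ3 = m + π * b := by
  obtain ⟨x, y, hxy⟩ := mem_O3_iff.1 h.mem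
  have hn : x ^ 2 - x * y + y ^ 2 = (p : ℤ) := by
    have := h.norm
    rw [hxy, mul_conj_eq] at this
    exact_mod_cast this
  have hy : ¬ (p : ℤ) ∣ y := by
    rintro ⟨t, rfl⟩
    have hx : (p : ℤ) ∣ x := by
      refine Int.Prime.dvd_pow' (k := 2) h.prime ⟨1 + x * t - p * t ^ 2, ?_⟩
      linear_combination hn
    obtain ⟨r, rfl⟩ := hx
    have h0 : (p : ℤ) ≠ 0 := by exact_mod_cast h.prime.ne_zero
    have : (p : ℤ) * (r ^ 2 - r * t + t ^ 2) = 1 := by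
      apply mul_left_cancel₀ h0; linear_combination hn
    have := Int.eq_one_or_neg_one_of_mul_eq_one this
    have h1 := h.prime.one_lt
    omega
  have hcop : IsCoprime y (p : ℤ) := by
    rw [isCoprime_comm]
    exact (Int.prime_iff_natAbs_prime.2 (by simpa using h.prime)).coprime_iff_not_dvd.2 hy
  obtain ⟨y', t, ht⟩ := hcop
  have ht' : (y' : ℂ) * y + t * p = 1 := by exact_mod_cast ht
  refine ⟨-x * y', y' + ρ3 * (starRingEnd ℂ) π * t,
    add_mem (int_mem_O3 _) (mul_mem (mul_mem ρ3_mem (conj_mem_O3 h.mem)) (int_mem_O3 _)), ?_⟩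
  push_cast
  linear_combination -ρ3 * ht' - y' * hxy - ρ3 * t * h.norm

theorem exists_int {a : ℂ} (ha : a ∈ O3) : ∃ n : ℤ, ∃ b ∈ O3, a = n + π * b := by
  obtain ⟨x, y, rfl⟩ := mem_O3_iff.1 ha
  obtain ⟨m, b, hb, hm⟩ := h.exists_int_sub_ρ3
  exact ⟨x + y * m, y * b, mul_mem (int_mem_O3 _) hb, by push_cast; linear_combination (y : ℂ) * hm⟩

theorem not_three_dvd : ¬ (p : ℤ) ∣ 3 := by
  intro hd
  have h3 := (Nat.prime_dvd_prime_iff_eq h.prime Nat.prime_three).1 (by exact_mod_cast hd)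
  have := h.mod_three
  rw [h3] at this
  norm_num at this

theorem odd_mod : p % 2 = 1 := by
  rcases h.prime.eq_two_or_odd with h2 | h2
  · have := h.mod_three
    rw [h2] at this
    norm_num at this
  · exact h2

end EisPrime

end EisensteinPrime

section Product

open Filter Topology

variable {L : PeriodPair}

/-- `ω` generates the lattice of `L` as a module over the Eisenstein integers. -/
structure IsGen (L : PeriodPair) (ω : ℂ) : Prop where
  ne_zero : ω ≠ 0
  mem_iff : ∀ z, z ∈ L.lattice ↔ ∃ a ∈ O3, z = ω * a

theorem IsGen.int_mul_mem {ω : ℂ} (hω : IsGen L ω) (n : ℤ) : n * ω ∈ L.lattice :=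
  (hω.mem_iff _).2 ⟨n, int_mem_O3 n, mul_comm _ _⟩

section Points

variable {ω π : ℂ} {p : ℕ} (hω : IsGen L ω) (h : EisPrime π p)
include hω h

theorem dvd_of_mul_div_mem {n : ℤ} (hn : n * ω / π ∈ L.lattice) : (p : ℤ) ∣ n := by
  obtain ⟨a, ha, hna⟩ := (hω.mem_iff _).1 hn
  refine h.dvd_of_eq_mul ha ?_
  have h0 := h.ne_zero
  have h1 := hω.ne_zero
  rw [div_eq_iff h0] at hna
  exact mul_right_cancel₀ h1 (by linear_combination hna)

theorem dvd_of_three_mul_div_mem {n : ℤ} (hn : 3 * (n * ω / π) ∈ L.lattice) : (p : ℤ) ∣ n := by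
  have := dvd_of_mul_div_mem hω h (n := 3 * n) (by convert hn using 1; push_cast; ring)
  exact ((Int.prime_iff_natAbs_prime.2 (by simpa using h.prime)).dvd_or_dvd this).resolve_left
    h.not_three_dvd

theorem exists_three_torsion {z : ℂ} (hz : 3 * (π * z) ∈ L.lattice) :
    ∃ n ∈ Finset.range p, 3 * (z + n * ω / π) ∈ L.lattice := by
  have h0 := h.ne_zero
  have h1 := hω.ne_zero
  obtain ⟨a, ha, hza⟩ := (hω.mem_iff _).1 hz
  obtain ⟨m, b, hb, hab⟩ := h.exists_int ha
  have hcop : IsCoprime (3 : ℤ) (p : ℤ) := by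
    rw [isCoprime_comm]
    exact (Int.prime_iff_natAbs_prime.2 (by simpa using h.prime)).coprime_iff_not_dvd.2
      h.not_three_dvd
  obtain ⟨x, y, hxy⟩ := hcop
  have hp : (0 : ℤ) < p := by exact_mod_cast h.prime.pos
  have hxy' : (x : ℂ) * 3 + y * p = 1 := by exact_mod_cast hxy
  obtain ⟨n, hn⟩ := Int.eq_ofNat_of_zero_le (Int.emod_nonneg (-m * x) hp.ne')
  have hdiv := Int.mul_ediv_add_emod (-m * x) p
  set q := (-m * x) / (p : ℤ)
  rw [hn] at hdiv
  refine ⟨n, Finset.mem_range.2 ?_, ?_⟩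
  · have := Int.emod_lt_of_pos (-m * x) hp
    rw [hn] at this
    exact_mod_cast this
  · have hdiv' : (p : ℂ) * q + n = -m * x := by exact_mod_cast hdiv
    refine (hω.mem_iff _).2 ⟨b + (starRingEnd ℂ) π * (m * y - 3 * q), add_mem hb
      (mul_mem (conj_mem_O3 h.mem) (sub_mem (mul_mem (int_mem_O3 _) (int_mem_O3 _))
        (mul_mem (by exact_mod_cast int_mem_O3 3) (int_mem_O3 _)))), ?_⟩
    field_simp
    have hc := h.cast_eq
    rw [hc] at hdiv' hxy'
    linear_combination hza + ω * hab + 3 * ω * hdiv' - ω * m * hxy'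

end Points

theorem sF_order_comp (a b z : ℂ) (ha : a ≠ 0) :
    meromorphicOrderAt (fun u => sF L (a * u + b)) z = meromorphicOrderAt (sF L) (a * z + b) := by
  refine meromorphicOrderAt_comp_of_deriv_ne_zero (f := sF L) (g := fun u => a * u + b)
    (by fun_prop) ?_
  simpa using ha

theorem sF_order_congr {w w' : ℂ} (hw : w - w' ∈ L.lattice) :
    meromorphicOrderAt (sF L) w = meromorphicOrderAt (sF L) w' := by
  have := sF_order_comp (L := L) 1 (w - w') w' one_ne_zero
  simp only [one_mul, add_sub_cancel, sF_add hw] at this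
  exact this.symm

variable [Hex27 L] {ω π : ℂ} {p : ℕ} (hω : IsGen L ω) (h : EisPrime π p)

include h in
/-- A primary prime acts trivially on `3`-torsion. -/
theorem primary_mul_sub_mem {w : ℂ} (hw : 3 * w ∈ L.lattice) : π * w - w ∈ L.lattice := by
  obtain ⟨d, hd, hd'⟩ := h.primary
  have := mul_mem_lattice hd hw
  convert this using 1
  rw [hd']; ring

theorem sF_order_of_notMem {w : ℂ} (hw : 3 * w ∉ L.lattice) : meromorphicOrderAt (sF L) w = 0 := by
  obtain ⟨hr, hs, -⟩ := generic_of_three_mul_notMem hw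
  have ha := sF_analyticAt hr
  rw [ha.meromorphicOrderAt_eq, ha.analyticOrderAt_eq_zero.2 hs]
  rfl

theorem sF_order_ne_top (w : ℂ) : meromorphicOrderAt (sF L) w ≠ ⊤ := by
  intro ht
  obtain ⟨v, hv, hs, -⟩ := exists_generic (L := L)
  have h1 := (meromorphicOrderAt_eq_top_iff.1 ht).frequently
  exact hs (sF_meromorphic.apply_eq_zero h1 (sF_analyticAt hv).continuousAt)

include hω h in
theorem prod_order (z : ℂ) : meromorphicOrderAt
    (fun u => (∏ n ∈ Finset.range p, sF L (u + n * ω / π)) / sF L (π * u)) z = 0 := by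
  have h0 := h.ne_zero
  have hmer (a b : ℂ) : MeromorphicAt (fun u => sF L (a * u + b)) z :=
    meromorphic_comp_affine sF_meromorphic a b z
  have e1 : (fun u => (∏ n ∈ Finset.range p, sF L (u + n * ω / π)) / sF L (π * u)) =
      (∏ n ∈ Finset.range p, fun u => sF L (1 * u + n * ω / π)) / fun u => sF L (π * u + 0) := by
    ext u; simp [Finset.prod_apply]
  rw [e1, meromorphicOrderAt_div (MeromorphicAt.prod fun n _ => hmer _ _) (hmer _ _),
    meromorphicOrderAt_prod fun n _ => hmer _ _]
  have e2 (b : ℂ) : meromorphicOrderAt (fun u => sF L (1 * u + b)) z =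
      meromorphicOrderAt (sF L) (z + b) := by
    rw [sF_order_comp 1 b z one_ne_zero, one_mul]
  have e3 : meromorphicOrderAt (fun u => sF L (π * u + 0)) z = meromorphicOrderAt (sF L) (π * z) := by
    rw [sF_order_comp π 0 z h0, add_zero]
  rw [e3, Finset.sum_congr rfl fun (n : ℕ) _ => e2 (n * ω / π)]
  have hw (n : ℕ) : π * (z + n * ω / π) - π * z ∈ L.lattice := by
    convert hω.int_mul_mem n using 1
    field_simp
    push_cast; ring
  by_cases hz : 3 * (π * z) ∈ L.lattice
  · obtain ⟨n, hn, hn3⟩ := exists_three_torsion hω h hz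
    rw [Finset.sum_eq_single_of_mem n hn]
    · have h1 := sub_mem (primary_mul_sub_mem h hn3) (hw n)
      rw [sF_order_congr (w := z + n * ω / π) (w' := π * z) (by convert neg_mem h1 using 1; ring)]
      exact LinearOrderedAddCommGroupWithTop.sub_self_eq_zero_of_ne_top (sF_order_ne_top _)
    · intro m hm hmn
      refine sF_order_of_notMem fun hm3 => hmn ?_
      have h2 := dvd_of_three_mul_div_mem hω h (n := m - n)
        (by convert sub_mem hm3 hn3 using 1; push_cast; ring)
      have h3 := Int.eq_zero_of_abs_lt_dvd h2 (by
        rw [abs_lt]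
        have := Finset.mem_range.1 hm
        have := Finset.mem_range.1 hn
        omega)
      omega
  · rw [sF_order_of_notMem hz, Finset.sum_eq_zero]
    · simp
    · intro n _
      refine sF_order_of_notMem fun hn3 => hz ?_
      convert sub_mem (mul_mem_lattice h.mem hn3)
        (mul_mem_lattice (by exact_mod_cast int_mem_O3 3) (hw n) : (3 : ℂ) * _ ∈ L.lattice) using 1
      ring

include hω h in
theorem exists_prod_eq_mul : ∃ k : ℂ, ∀ z, ∀ᶠ u in 𝓝[≠] z,
    ∏ n ∈ Finset.range p, sF L (u + n * ω / π) = k * sF L (π * u) := by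
  have h0 := h.ne_zero
  have hper (l : ℂ) (hl : l ∈ L.lattice) (z : ℂ) :
      (∏ n ∈ Finset.range p, sF L (z + l + n * ω / π)) / sF L (π * (z + l)) =
      (∏ n ∈ Finset.range p, sF L (z + n * ω / π)) / sF L (π * z) := by
    rw [mul_add, sF_add (mul_mem_lattice h.mem hl)]
    simp only [add_right_comm z l, sF_add hl]
  have hmer (a b : ℂ) : Meromorphic (fun u => sF L (a * u + b)) :=
    meromorphic_comp_affine sF_meromorphic a b
  have hm : Meromorphic (fun u => (∏ n ∈ Finset.range p, sF L (u + n * ω / π)) / sF L (π * u)) := by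
    intro z
    refine MeromorphicAt.div (MeromorphicAt.fun_prod fun n _ => ?_) ?_
    · simpa using hmer 1 (n * ω / π) z
    · simpa using hmer π 0 z
  obtain ⟨k, hk⟩ := liouville_periodic (L := L) hm hper fun z => (prod_order hω h z).ge
  refine ⟨k, fun z => ?_⟩
  have hne : ∀ᶠ u in 𝓝[≠] z, sF L (π * u) ≠ 0 := by
    have h1 := meromorphicOrderAt_ne_top_iff_eventually_ne_zero
      (f := fun u => sF L (π * u + 0)) (x := z) (hmer π 0 z)
    simp only [add_zero] at h1
    refine h1.1 ?_
    have := sF_order_comp (L := L) π 0 z h0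
    simp only [add_zero] at this
    rw [this]
    exact sF_order_ne_top _
  filter_upwards [hk z, hne] with u h1 h2
  rwa [div_eq_iff h2] at h1

end Product

section ProductFormula

open Filter Topology

theorem prod_range_eq {p : ℕ} (hp : 0 < p) (f : ℕ → ℂ) :
    ∏ n ∈ Finset.range p, f n = f 0 * ∏ n ∈ Finset.Icc 1 (p - 1), f n := by
  obtain ⟨q, rfl⟩ : ∃ q, p = q + 1 := ⟨p - 1, by omega⟩
  rw [Finset.prod_range_succ', mul_comm, Finset.range_eq_Ico,
    Finset.prod_Ico_add' f 0 q 1, zero_add]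
  rfl

variable {L : PeriodPair} [Hex27 L] {ω π : ℂ} {p : ℕ} (hω : IsGen L ω) (h : EisPrime π p)
include hω h

theorem generic_div {n : ℤ} (hn : ¬ (p : ℤ) ∣ n) :
    Reg L (n * ω / π) ∧ sF L (n * ω / π) ≠ 0 ∧ cF L (n * ω / π) ≠ 0 :=
  generic_of_three_mul_notMem fun h3 => hn (dvd_of_three_mul_div_mem hω h h3)

theorem generic_div_of_mem_Icc {n : ℕ} (hn : n ∈ Finset.Icc 1 (p - 1)) :
    Reg L (n * ω / π) ∧ sF L (n * ω / π) ≠ 0 ∧ cF L (n * ω / π) ≠ 0 := by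
  refine generic_div hω h (n := n) fun hd => ?_
  have := Nat.le_of_dvd (Finset.mem_Icc.1 hn).1 (by exact_mod_cast hd)
  have := (Finset.mem_Icc.1 hn).2
  have := h.prime.pos
  omega

theorem prod_cF_eq_one : ∏ n ∈ Finset.Icc 1 (p - 1), cF L (n * ω / π) = 1 := by
  have h0 := h.ne_zero
  have h2 := h.odd_mod
  refine Finset.prod_involution (fun n _ => p - n) ?_ ?_ ?_ ?_
  · intro n hn
    obtain ⟨hr, -, hc⟩ := generic_div_of_mem_Icc hω h hn
    have hn' := Finset.mem_Icc.1 hn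
    have : ((p - n : ℕ) : ℂ) * ω / π - -(n * ω / π) ∈ L.lattice := by
      refine (hω.mem_iff _).2 ⟨(starRingEnd ℂ) π, conj_mem_O3 h.mem, ?_⟩
      rw [Nat.cast_sub (by omega), h.cast_eq]
      field_simp
      ring
    rw [cF_congr this, cF_neg hr hc]
    field_simp
  · intro n hn _
    have hn' := Finset.mem_Icc.1 hn
    omega
  · intro n hn
    have hn' := Finset.mem_Icc.1 hn
    rw [Finset.mem_Icc]
    omega
  · intro n hn
    have hn' := Finset.mem_Icc.1 hn
    omega

theorem prod_sF_eq : ∏ n ∈ Finset.Icc 1 (p - 1), sF L (n * ω / π) = π := by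
  have h0 := h.ne_zero
  obtain ⟨k, hk⟩ := exists_prod_eq_mul hω h
  have hreg0 : Reg L (π * 0) := by rw [mul_zero]; exact reg_zero
  obtain ⟨κ, hκ, hκs, hκc⟩ := exists_sF_cF_eq (L := L) (a := 1) (b := 0) (by norm_num)
  have hk1 : k = 1 := by
    have hπκ := primary_mul_sub_mem h (three_mul_mem_of_cF_eq_zero hκ hκc)
    have hR : Reg L (π * κ) := (reg_congr hπκ).2 hκ
    have hc1 : ContinuousAt (fun u => sF L (π * u)) κ :=
      ContinuousAt.comp (f := fun u => π * u) (sF_analyticAt hR).continuousAt (by fun_prop)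
    have hreg (n : ℕ) (hn : n ∈ Finset.Icc 1 (p - 1)) : Reg L (κ + n * ω / π) ∧
        sF L (κ + n * ω / π) = 1 / cF L (n * ω / π) := by
      obtain ⟨hr, -, hc⟩ := generic_div_of_mem_Icc hω h hn
      obtain ⟨r, s, -⟩ := add_of_cF_eq_zero hκ hκc hr hc
      exact ⟨r, by rw [s, hκs]⟩
    have hc2 : ContinuousAt (fun u => ∏ n ∈ Finset.range p, sF L (u + n * ω / π)) κ := by
      refine tendsto_finsetProd _ fun n hn => ?_
      have : Reg L (κ + n * ω / π) := by
        rcases Nat.eq_zero_or_pos n with rfl | hn0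
        · simpa using hκ
        · refine (hreg n (Finset.mem_Icc.2 ⟨hn0, ?_⟩)).1
          have := Finset.mem_range.1 hn
          omega
      exact ContinuousAt.comp (f := fun u => u + n * ω / π) (sF_analyticAt this).continuousAt
        (by fun_prop)
    have he := eq_zero_of_frequently_eq_zero (z := κ)
      (F := fun u => ∏ n ∈ Finset.range p, sF L (u + n * ω / π) - k * sF L (π * u))
      (hc2.sub (continuousAt_const.mul hc1)) ((hk κ).mono fun u hu => sub_eq_zero.2 hu).frequently
    rw [sub_eq_zero, sF_congr hπκ, hκs, prod_range_eq h.prime.pos,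
      Finset.prod_congr rfl fun n hn => (hreg n hn).2] at he
    rw [Finset.prod_div_distrib, prod_cF_eq_one hω h] at he
    simpa [hκs] using he.symm
  have hd0 : HasDerivAt (sF L) (-3) 0 := by simpa [cF_zero] using hasDerivAt_sF (L := L) reg_zero
  have hd1 : HasDerivAt (fun u => sF L (π * u)) (-3 * π) 0 := by
    have := HasDerivAt.comp (0 : ℂ) (h₂ := sF L) (h := fun u => π * u) (h' := π)
      (by simpa [cF_zero] using hasDerivAt_sF (L := L) hreg0)
      (by simpa using (hasDerivAt_id (0 : ℂ)).const_mul π)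
    exact this
  set Q : ℂ → ℂ := fun u => ∏ n ∈ Finset.Icc 1 (p - 1), sF L (u + n * ω / π) with hQ
  have hcQ : ContinuousAt Q 0 := by
    refine tendsto_finsetProd _ fun n hn => ?_
    have : Reg L (0 + n * ω / π) := by simpa using (generic_div_of_mem_Icc hω h hn).1
    exact ContinuousAt.comp (f := fun u => u + n * ω / π) (sF_analyticAt this).continuousAt
      (by fun_prop)
  have h1 : Tendsto (fun u => (u⁻¹ * sF L u) * Q u) (𝓝[≠] 0) (𝓝 (-3 * Q 0)) := by
    refine Tendsto.mul ?_ (hcQ.tendsto.mono_left nhdsWithin_le_nhds)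
    simpa [sF_zero] using hasDerivAt_iff_tendsto_slope_zero.1 hd0
  have h2 : Tendsto (fun u => u⁻¹ * sF L (π * u)) (𝓝[≠] 0) (𝓝 (-3 * π)) := by
    simpa [sF_zero] using hasDerivAt_iff_tendsto_slope_zero.1 hd1
  have h3 : -3 * Q 0 = -3 * π := by
    refine tendsto_nhds_unique (h1.congr' ((hk 0).mono fun u hu => ?_)) h2
    rw [prod_range_eq h.prime.pos, hk1, one_mul] at hu
    rw [← hu, hQ]
    simp only [Nat.cast_zero, zero_mul, zero_div, add_zero]
    ring
  have h4 : Q 0 = π := mul_left_cancel₀ (by norm_num : (-3 : ℂ) ≠ 0) h3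
  simpa [hQ] using h4

end ProductFormula

section Normalization

open Filter Topology

variable {w : ℝ} {hw : 0 < w}

theorem isGen_hexPair : IsGen (hexPair w hw) w :=
  ⟨by exact_mod_cast hw.ne', fun _ => mem_hex_iff⟩

theorem third_notMem_O3 {x y : ℤ} (h : ¬ (3 ∣ x ∧ 3 ∣ y)) : ((x : ℂ) + y * ρ3) / 3 ∉ O3 := by
  intro hm
  obtain ⟨a, b, hab⟩ := mem_O3_iff.1 hm
  have h1 : (x : ℂ) + y * ρ3 = (3 * a : ℤ) + (3 * b : ℤ) * ρ3 := by
    push_cast; linear_combination 3 * hab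
  obtain ⟨h2, h3⟩ := int_pair_ext h1
  exact h ⟨⟨a, h2⟩, ⟨b, h3⟩⟩

/-- The point `i·w/√3`, a zero of `℘`. -/
theorem exists_P_zero (w : ℝ) (hw : 0 < w) : ∃ z ∉ (hexPair w hw).lattice,
    ℘[hexPair w hw] z = 0 ∧ (starRingEnd ℂ) z = -z := by
  have h0 : (w : ℂ) ≠ 0 := by exact_mod_cast hw.ne'
  refine ⟨w * (1 + 2 * ρ3) / 3, ?_, ?_, ?_⟩
  · intro hm
    obtain ⟨a, ha, h⟩ := mem_hex_iff.1 hm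
    refine third_notMem_O3 (x := 1) (y := 2) (by omega) ?_
    convert ha using 1
    apply mul_left_cancel₀ h0
    rw [← h]; push_cast; ring
  · have h1 := hex_P_rho (w := w) (hw := hw) (w * (1 + 2 * ρ3) / 3)
    have h2 : ρ3 * (w * (1 + 2 * ρ3) / 3) = w * (1 + 2 * ρ3) / 3 + w * ρ3 ^ 2 := by
      linear_combination (-w / 3 : ℂ) * ρ3_quad
    rw [h2, (hexPair w hw).weierstrassP_add_coe _
      ⟨_, mem_hex_iff.2 ⟨ρ3 ^ 2, pow_mem ρ3_mem 2, rfl⟩⟩] at h1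
    have h3 : (1 - ρ3) * ℘[hexPair w hw] (w * (1 + 2 * ρ3) / 3) = 0 := by linear_combination h1
    exact (mul_eq_zero.1 h3).resolve_left (sub_ne_zero.2 ρ3_ne_one.symm)
  · simp only [map_div₀, map_mul, map_add, map_one, Complex.conj_ofReal, conj_ρ3, map_ofNat]
    linear_combination (2 * w / 3 : ℂ) * ρ3_quad

theorem hex_g₃_ne_zero : (hexPair w hw).g₃ ≠ 0 := by
  intro hg
  obtain ⟨z, hz, hz0, -⟩ := exists_P_zero w hw
  set P := ℘[hexPair w hw] with hP
  have ha : AnalyticAt ℂ P z := analyticAt_P hz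
  have h1 := ha.analyticOrderAt_deriv_add_one
  have h2 : deriv P ^ 2 =ᶠ[𝓝 z] 4 • P ^ 3 := by
    filter_upwards [mem_compl_lattice_nhds hz] with u hu
    simp only [Pi.pow_apply, Pi.smul_apply]
    rw [hP, (hexPair w hw).deriv_weierstrassP, hex_P'_sq hu, hg]
    simp
  simp only [hz0, sub_zero] at h1
  have h3 := analyticOrderAt_congr h2
  rw [analyticOrderAt_pow ha.deriv, show (4 • P ^ 3 : ℂ → ℂ) = (fun _ => 4) * P ^ 3 by ext; simp,
    analyticOrderAt_mul analyticAt_const (ha.pow 3), analyticOrderAt_pow ha] at h3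
  have h4 : analyticOrderAt (fun _ : ℂ => (4 : ℂ)) z = 0 :=
    analyticAt_const.analyticOrderAt_eq_zero.2 (by norm_num)
  have hne : analyticOrderAt P z ≠ ⊤ := by
    intro ht
    have hf : ∀ᶠ u in 𝓝[≠] z, P u = 0 := (analyticOrderAt_eq_top.1 ht).filter_mono nhdsWithin_le_nhds
    obtain ⟨v, hv, hv1⟩ := exists_P_eq (L := hexPair w hw) 1
    have := (hexPair w hw).meromorphic_weierstrassP.apply_eq_zero (z₀ := z) hf.frequently
      (analyticAt_P hv).continuousAt
    rw [hv1] at this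
    exact one_ne_zero this
  rw [h4, ← h1] at h3
  have hne' : analyticOrderAt (deriv P) z ≠ ⊤ := by
    intro ht
    rw [ht] at h1
    exact hne h1.symm
  lift analyticOrderAt (deriv P) z to ℕ using hne' with n hn
  have h5 : 2 * n = 3 * (n + 1) := by
    have : ((2 * n : ℕ) : ℕ∞) = ((3 * (n + 1) : ℕ) : ℕ∞) := by
      push_cast
      rw [mul_add]
      simpa using h3
    exact_mod_cast this
  omega

theorem hex_g₃_re_nonneg : (hexPair w hw).g₃ = ((hexPair w hw).g₃.re : ℂ) ∧
    0 ≤ (hexPair w hw).g₃.re := by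
  refine ⟨(Complex.conj_eq_iff_re.1 hex_g₃_conj).symm, ?_⟩
  obtain ⟨z, hz, hz0, hzc⟩ := exists_P_zero w hw
  have h1 := hex_P'_sq hz
  have h2 := hex_P'_conj (w := w) (hw := hw) z
  rw [hzc, (hexPair w hw).derivWeierstrassP_neg] at h2
  have h3 : (℘'[hexPair w hw] z).re = 0 := by
    have := congrArg Complex.re h2
    simp at this
    linarith
  have h4 := congrArg Complex.re h1
  rw [hz0] at h4
  simp [sq, h3] at h4
  nlinarith [sq_nonneg (℘'[hexPair w hw] z).im]

/-- There is a hexagonal lattice with `g₃ = 27`. -/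
theorem exists_hex27 : ∃ (w : ℝ) (hw : 0 < w), Hex27 (hexPair w hw) := by
  obtain ⟨h1, h2⟩ := hex_g₃_re_nonneg (w := 1) (hw := one_pos)
  set g := (hexPair 1 one_pos).g₃.re with hg
  have h3 : 0 < g := lt_of_le_of_ne h2 fun h => hex_g₃_ne_zero (w := 1) (hw := one_pos)
    (by rw [h1, ← h]; simp)
  have hw : 0 < (g / 27) ^ ((1 : ℝ) / 6) := by positivity
  refine ⟨(g / 27) ^ ((1 : ℝ) / 6), hw, ⟨_, hw, rfl⟩, ?_⟩
  have h4 := hex_g₃_scale (w := 1) (hw := one_pos) (hw' := hw)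
  have h5 : (((g / 27) ^ ((1 : ℝ) / 6) : ℝ) : ℂ) ^ 6 = g / 27 := by
    rw [← Complex.ofReal_pow]
    norm_cast
    rw [← Real.rpow_natCast, ← Real.rpow_mul (by positivity)]
    norm_num
  rw [h5, h1] at h4
  have h6 : (g : ℂ) ≠ 0 := by exact_mod_cast h3.ne'
  push_cast at h4
  apply mul_left_cancel₀ h6
  linear_combination -27 * h4

end Normalization

section Period

open Filter Topology MeasureTheory

section Torsion

variable {L : PeriodPair} [Hex27 L]

/-- A regular `3`-torsion point with `cF ≠ 0` is a zero of `sF`. -/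
theorem sF_eq_zero_of_three_mul_mem {z : ℂ} (h3 : 3 * z ∈ L.lattice) (hz : Reg L z)
    (hc : cF L z ≠ 0) : sF L z = 0 := by
  have hcube := sF_cube_add hz
  have hm : z + z - -z ∈ L.lattice := by convert h3 using 1; ring
  have hr : Reg L (z + z) := (reg_congr hm).2 ((cF_ne_zero_iff hz).1 hc)
  have h1 := (addition_law hz hz hr).2
  rw [cF_congr hm, cF_neg hz hc] at h1
  field_simp at h1
  have h2 : sF L z ^ 3 = 0 := by linear_combination (1 / 3 : ℂ) * (h1 + hcube)
  exact pow_eq_zero_iff (by norm_num) |>.1 h2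

theorem not_reg_or_cF_eq_zero {ω : ℂ} (hω : IsGen L ω) :
    ¬ Reg L (-(ω / 3)) ∨ cF L (-(ω / 3)) = 0 := by
  by_contra! hcon
  have h0 := hω.ne_zero
  have h3 : 3 * (-(ω / 3)) ∈ L.lattice := (hω.mem_iff _).2 ⟨-1, neg_mem (one_mem _), by ring⟩
  have h1 := sF_eq_zero_of_three_mul_mem h3 hcon.1 hcon.2
  have hP : ℘[L] (-(ω / 3)) = 0 := by
    rw [sF, div_eq_zero_iff] at h1
    simpa using h1.resolve_right hcon.1
  have hnot (x y : ℤ) (h : ¬ (3 ∣ x ∧ 3 ∣ y)) : ω * (((x : ℂ) + y * ρ3) / 3) ∉ L.lattice := by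
    intro hm
    obtain ⟨a, ha, hh⟩ := (hω.mem_iff _).1 hm
    exact third_notMem_O3 h (mul_left_cancel₀ h0 hh ▸ ha)
  have hz : -(ω / 3) ∉ L.lattice := by
    convert hnot (-1) 0 (by omega) using 2; push_cast; ring
  have hPρ : ℘[L] (ρ3 * (-(ω / 3))) = 0 := by rw [P_rho, hP, mul_zero]
  have hr : Reg L (ρ3 * (-(ω / 3))) := reg_rho.2 hcon.1
  have := sub_mem_of_eq hr hcon.1 (by rw [sF_rho, h1, mul_zero]) (cF_rho _)
  refine hnot 1 (-1) (by omega) ?_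
  convert this using 1; push_cast; ring

end Torsion

variable {w : ℝ} {hw : 0 < w}

theorem hex_sF_conj (z : ℂ) :
    sF (hexPair w hw) ((starRingEnd ℂ) z) = (starRingEnd ℂ) (sF (hexPair w hw) z) := by
  rw [sF, sF, hex_P_conj, hex_P'_conj]
  simp only [map_div₀, map_mul, map_add, map_ofNat]

theorem hex_cF_conj (z : ℂ) :
    cF (hexPair w hw) ((starRingEnd ℂ) z) = (starRingEnd ℂ) (cF (hexPair w hw) z) := by
  have hmem : (starRingEnd ℂ) z ∈ (hexPair w hw).lattice ↔ z ∈ (hexPair w hw).lattice :=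
    ⟨fun h => by simpa using conj_mem_hex h, conj_mem_hex⟩
  by_cases hz : z ∈ (hexPair w hw).lattice
  · rw [cF_of_mem hz, cF_of_mem (hmem.2 hz), map_one]
  · rw [cF_of_notMem hz, cF_of_notMem (fun h => hz (hmem.1 h)), hex_P'_conj]
    simp only [map_div₀, map_sub, map_add, map_ofNat]

theorem hex_sF_real (t : ℝ) : sF (hexPair w hw) t = ((sF (hexPair w hw) t).re : ℂ) := by
  have := hex_sF_conj (w := w) (hw := hw) t
  rw [Complex.conj_ofReal] at this
  exact (Complex.conj_eq_iff_re.1 this.symm).symm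

theorem hex_cF_real (t : ℝ) : cF (hexPair w hw) t = ((cF (hexPair w hw) t).re : ℂ) := by
  have := hex_cF_conj (w := w) (hw := hw) t
  rw [Complex.conj_ofReal] at this
  exact (Complex.conj_eq_iff_re.1 this.symm).symm

variable (w hw) in
/-- The real function `t ↦ sF (-t)`. -/
def realS (t : ℝ) : ℝ := (sF (hexPair w hw) ((-t : ℝ) : ℂ)).re

variable (w hw) in
/-- The real function `t ↦ cF (-t)`. -/
def realC (t : ℝ) : ℝ := (cF (hexPair w hw) ((-t : ℝ) : ℂ)).re

theorem realS_cast (t : ℝ) : (realS w hw t : ℂ) = sF (hexPair w hw) ((-t : ℝ) : ℂ) :=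
  (hex_sF_real _).symm

theorem realC_cast (t : ℝ) : (realC w hw t : ℂ) = cF (hexPair w hw) ((-t : ℝ) : ℂ) :=
  (hex_cF_real _).symm

theorem continuousAt_realC {t : ℝ} (ht : Reg (hexPair w hw) ((-t : ℝ) : ℂ)) :
    ContinuousAt (realC w hw) t := by
  unfold realC
  refine Complex.continuous_re.continuousAt.comp ?_
  exact ContinuousAt.comp (f := fun t : ℝ => ((-t : ℝ) : ℂ)) (cF_analyticAt ht).continuousAt
    (by fun_prop)

variable [Hex27 (hexPair w hw)]

theorem hex_generic_real {t : ℝ} (ht : t ∈ Set.Ioo 0 (w / 3)) :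
    Reg (hexPair w hw) ((-t : ℝ) : ℂ) ∧ cF (hexPair w hw) ((-t : ℝ) : ℂ) ≠ 0 := by
  have hn : 3 * ((-t : ℝ) : ℂ) ∉ (hexPair w hw).lattice := by
    intro hm
    obtain ⟨a, ha, h⟩ := mem_hex_iff.1 hm
    obtain ⟨x, y, rfl⟩ := mem_O3_iff.1 ha
    have h1 := int_add_mul_ρ3_eq_zero (a := w * x + 3 * t) (b := w * y)
      (by push_cast at h ⊢; linear_combination -h)
    have h2 := ht.1
    have h3 := ht.2
    have hx : ((-1 : ℤ) : ℝ) < x := by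
      push_cast
      by_contra! hx
      nlinarith
    have hx' : (x : ℝ) < (0 : ℤ) := by
      push_cast
      by_contra! hx
      nlinarith
    have h4 : -1 < x := by exact_mod_cast hx
    have h5 : x < 0 := by exact_mod_cast hx'
    omega
  have := generic_of_three_mul_notMem hn
  exact ⟨this.1, this.2.2⟩

theorem realS_cube_add {t : ℝ} (ht : Reg (hexPair w hw) ((-t : ℝ) : ℂ)) :
    realS w hw t ^ 3 + realC w hw t ^ 3 = 1 := by
  have := sF_cube_add ht
  rw [← realS_cast, ← realC_cast] at this
  exact_mod_cast this

theorem hasDerivAt_realS {t : ℝ} (ht : Reg (hexPair w hw) ((-t : ℝ) : ℂ)) :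
    HasDerivAt (realS w hw) (3 * realC w hw t ^ 2) t := by
  have h1 : HasDerivAt (fun z : ℂ => sF (hexPair w hw) (-z))
      (3 * cF (hexPair w hw) (-(t : ℂ)) ^ 2) t := by
    rw [Complex.ofReal_neg] at ht
    have := (hasDerivAt_sF ht).comp (t : ℂ) (hasDerivAt_neg (t : ℂ))
    simpa [Function.comp_def] using this
  have h2 := h1.real_of_complex
  have h3 : (3 * cF (hexPair w hw) (-(t : ℂ)) ^ 2).re = 3 * realC w hw t ^ 2 := by
    rw [← Complex.ofReal_neg, ← realC_cast]
    norm_cast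
  rw [h3] at h2
  convert h2 using 2 with x
  simp [realS]

theorem realC_pos {t : ℝ} (ht : t ∈ Set.Ico 0 (w / 3)) : 0 < realC w hw t := by
  have h0 : realC w hw 0 = 1 := by simp [realC, cF_zero]
  have hreg (u : ℝ) (hu : u ∈ Set.Icc 0 t) :
      Reg (hexPair w hw) ((-u : ℝ) : ℂ) ∧ cF (hexPair w hw) ((-u : ℝ) : ℂ) ≠ 0 := by
    rcases eq_or_lt_of_le hu.1 with rfl | hpos
    · simp [reg_zero, cF_zero]
    · exact hex_generic_real ⟨hpos, hu.2.trans_lt ht.2⟩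
  by_contra! hn
  obtain ⟨u, hu, hu0⟩ := intermediate_value_Icc' ht.1
    (fun u hu => (continuousAt_realC (hreg u hu).1).continuousWithinAt)
    (show (0 : ℝ) ∈ Set.Icc (realC w hw t) (realC w hw 0) from ⟨hn, by rw [h0]; exact zero_le_one⟩)
  apply (hreg u hu).2
  rw [← realC_cast, hu0, Complex.ofReal_zero]

theorem realS_strictMonoOn : StrictMonoOn (realS w hw) (Set.Ico 0 (w / 3)) := by
  have hreg (u : ℝ) (hu : u ∈ Set.Ico 0 (w / 3)) : Reg (hexPair w hw) ((-u : ℝ) : ℂ) := by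
    rcases eq_or_lt_of_le hu.1 with rfl | hpos
    · simp [reg_zero]
    · exact (hex_generic_real ⟨hpos, hu.2⟩).1
  refine strictMonoOn_of_deriv_pos (convex_Ico _ _)
    (fun u hu => (hasDerivAt_realS (hreg u hu)).continuousAt.continuousWithinAt) fun u hu => ?_
  rw [interior_Ico] at hu
  rw [(hasDerivAt_realS (hreg u (Set.Ioo_subset_Ico_self hu))).deriv]
  have := realC_pos (w := w) (hw := hw) (Set.Ioo_subset_Ico_self hu)
  positivity

theorem realC_le_one {t : ℝ} (ht : t ∈ Set.Ioo 0 (w / 3)) : realC w hw t ≤ 1 := by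
  have hs := realS_strictMonoOn (w := w) (hw := hw) ⟨le_refl 0, by linarith⟩
    (Set.Ioo_subset_Ico_self ht) ht.1
  have h0 : realS w hw 0 = 0 := by simp [realS, sF_zero]
  rw [h0] at hs
  have h1 := realS_cube_add (hex_generic_real ht).1
  by_contra! hn
  have h2 : 0 < realS w hw t ^ 3 := by positivity
  have h3 : 1 < realC w hw t ^ 3 := one_lt_pow₀ hn (by norm_num)
  linarith

theorem reg_third : Reg (hexPair w hw) ((-(w / 3) : ℝ) : ℂ) := by
  intro hr
  have hz : ((-(w / 3) : ℝ) : ℂ) ∉ (hexPair w hw).lattice := fun hm => reg_of_mem hm hr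
  have hc : Tendsto (fun t : ℝ => ℘'[hexPair w hw] ((-t : ℝ) : ℂ)) (𝓝[<] (w / 3))
      (𝓝 (℘'[hexPair w hw] ((-(w / 3) : ℝ) : ℂ))) := by
    refine Tendsto.mono_left ?_ nhdsWithin_le_nhds
    exact ContinuousAt.tendsto (ContinuousAt.comp (f := fun t : ℝ => ((-t : ℝ) : ℂ))
      (analyticAt_P' hz).continuousAt (by fun_prop))
  have h9 : ℘'[hexPair w hw] ((-(w / 3) : ℝ) : ℂ) = -9 := by linear_combination hr
  rw [h9] at hc
  have h1 : Tendsto (fun t : ℝ => (9 + ℘'[hexPair w hw] ((-t : ℝ) : ℂ)) *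
      cF (hexPair w hw) ((-t : ℝ) : ℂ)) (𝓝[<] (w / 3)) (𝓝 0) := by
    refine Tendsto.zero_mul_isBoundedUnder_le (by simpa using hc.const_add 9) ?_
    refine isBoundedUnder_of_eventually_le (a := 1) ?_
    filter_upwards [Ioo_mem_nhdsLT (show (0 : ℝ) < w / 3 by linarith)] with t ht
    simp only [Function.comp, ← realC_cast, Complex.norm_real, Real.norm_eq_abs]
    rw [abs_of_pos (realC_pos (Set.Ioo_subset_Ico_self ht))]
    exact realC_le_one ht
  have h2 : Tendsto (fun t : ℝ => ℘'[hexPair w hw] ((-t : ℝ) : ℂ) - 9) (𝓝[<] (w / 3)) (𝓝 0) := by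
    refine h1.congr' ?_
    filter_upwards [Ioo_mem_nhdsLT (show (0 : ℝ) < w / 3 by linarith)] with t ht
    have hr := (hex_generic_real (hw := hw) ht).1
    have hl : ((-t : ℝ) : ℂ) ∉ (hexPair w hw).lattice := by
      intro hm
      have h3 := realC_cast (w := w) (hw := hw) t
      have h4 := realS_cast (w := w) (hw := hw) t
      rw [sF_of_mem hm] at h4
      have h5 := realS_strictMonoOn (w := w) (hw := hw) ⟨le_refl 0, by linarith⟩
        (Set.Ioo_subset_Ico_self ht) ht.1
      have h0 : realS w hw 0 = 0 := by simp [realS, sF_zero]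
      rw [h0, show realS w hw t = 0 by exact_mod_cast h4] at h5
      exact lt_irrefl _ h5
    rw [cF_of_notMem hl]
    exact mul_div_cancel₀ _ hr
  have h3 := tendsto_nhds_unique h2 (hc.sub_const 9)
  norm_num at h3

theorem realC_third : realC w hw (w / 3) = 0 := by
  have h := (not_reg_or_cF_eq_zero (L := hexPair w hw) isGen_hexPair).resolve_left
    (not_not.2 (by simpa using reg_third (w := w) (hw := hw)))
  have h2 := realC_cast (w := w) (hw := hw) (w / 3)
  push_cast at h2
  rw [h] at h2
  exact_mod_cast h2

theorem realS_third : realS w hw (w / 3) = 1 := by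
  have h := realS_cube_add (reg_third (w := w) (hw := hw))
  rw [realC_third] at h
  have h1 : (realS w hw (w / 3) - 1) * ((realS w hw (w / 3) + 1 / 2) ^ 2 + 3 / 4) = 0 := by
    linear_combination h
  rcases mul_eq_zero.1 h1 with h2 | h2
  · linarith
  · nlinarith [sq_nonneg (realS w hw (w / 3) + 1 / 2)]

theorem realS_image : realS w hw '' Set.Ioo 0 (w / 3) = Set.Ioo 0 1 := by
  have h3 : (0 : ℝ) ≤ w / 3 := by linarith
  have hreg (u : ℝ) (hu : u ∈ Set.Icc 0 (w / 3)) : Reg (hexPair w hw) ((-u : ℝ) : ℂ) := by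
    rcases eq_or_lt_of_le hu.1 with rfl | hpos
    · simp [reg_zero]
    rcases eq_or_lt_of_le hu.2 with rfl | hlt
    · exact reg_third
    · exact (hex_generic_real ⟨hpos, hlt⟩).1
  have hcont : ContinuousOn (realS w hw) (Set.Icc 0 (w / 3)) :=
    fun u hu => (hasDerivAt_realS (hreg u hu)).continuousAt.continuousWithinAt
  have h0 : realS w hw 0 = 0 := by simp [realS, sF_zero]
  apply Set.Subset.antisymm
  · rintro _ ⟨t, ht, rfl⟩
    have h1 := realS_strictMonoOn (w := w) (hw := hw) ⟨le_refl 0, by linarith⟩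
      (Set.Ioo_subset_Ico_self ht) ht.1
    rw [h0] at h1
    refine ⟨h1, ?_⟩
    have h2 := realS_cube_add (hex_generic_real (hw := hw) ht).1
    have h4 := realC_pos (w := w) (hw := hw) (Set.Ioo_subset_Ico_self ht)
    have h5 : 0 < realC w hw t ^ 3 := by positivity
    by_contra! hn
    have : 1 ≤ realS w hw t ^ 3 := one_le_pow₀ hn
    linarith
  · have := intermediate_value_Ioo h3 hcont
    rwa [h0, realS_third] at this

include hw in
/-- The real period of the hexagonal lattice with `g₃ = 27`. -/
theorem varpi1_eq : varpi1 = w := by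
  have h3 : (0 : ℝ) ≤ w / 3 := by linarith
  rw [varpi1, intervalIntegral.integral_of_le zero_le_one, integral_Ioc_eq_integral_Ioo,
    ← realS_image (w := w) (hw := hw), integral_image_eq_integral_abs_deriv_smul measurableSet_Ioo
      (f' := fun t => 3 * realC w hw t ^ 2)
      (fun t ht => (hasDerivAt_realS (hex_generic_real ht).1).hasDerivWithinAt)
      (realS_strictMonoOn.mono Set.Ioo_subset_Ico_self).injOn]
  rw [setIntegral_congr_fun (g := fun _ => (3 : ℝ)) measurableSet_Ioo]
  · simp [h3]
  · intro t ht
    have h1 := realS_cube_add (hex_generic_real (hw := hw) ht).1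
    have h2 := realC_pos (w := w) (hw := hw) (Set.Ioo_subset_Ico_self ht)
    have h4 : 1 - realS w hw t ^ 3 = realC w hw t ^ (3 : ℝ) := by
      rw [show (3 : ℝ) = (3 : ℕ) by norm_num, Real.rpow_natCast]
      linarith
    simp only [smul_eq_mul]
    rw [h4, ← Real.rpow_mul h2.le, abs_of_pos (by positivity),
      show (3 : ℝ) * (-2 / 3) = -(2 : ℕ) by norm_num, Real.rpow_neg h2.le, Real.rpow_natCast]
    field_simp

end Period

section Comparison

variable {w : ℝ} {hw : 0 < w}

theorem latticeEquivProd_symm_hex (hv : varpi1 = w) (m : ℤ × ℤ) :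
    (((hexPair w hw).latticeEquivProd.symm m : (hexPair w hw).lattice) : ℂ) = ω3 m := by
  rw [PeriodPair.latticeEquiv_symm_apply, ω3, hv]
  simp only [hexPair]
  ring

theorem wp3_eq (hv : varpi1 = w) (z : ℂ) : wp3 z = ℘[hexPair w hw] z := by
  have h1 := (hexPair w hw).hasSum_weierstrassP z
  rw [← (hexPair w hw).latticeEquivProd.symm.toEquiv.hasSum_iff] at h1
  rw [wp3, ← h1.tsum_eq, h1.summable.tsum_eq_add_tsum_ite 0]
  congr 1
  · simp
  · refine tsum_congr fun m => ?_
    simp [latticeEquivProd_symm_hex hv]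

theorem wp3'_eq (hv : varpi1 = w) (z : ℂ) : wp3' z = ℘'[hexPair w hw] z := by
  rw [wp3', PeriodPair.derivWeierstrassP,
    ← (hexPair w hw).latticeEquivProd.symm.toEquiv.tsum_eq, ← tsum_neg]
  refine tsum_congr fun m => ?_
  simp [latticeEquivProd_symm_hex hv, div_eq_mul_inv]

/-- The functions `phi3` and `psi3` in terms of the functions attached to a period lattice. -/
theorem exists_hex27_phi3_psi3 : ∃ L : PeriodPair, Hex27 L ∧ IsGen L varpi1 ∧
    (∀ u, phi3 u = sF L (varpi1 * u)) ∧
    ∀ u, (varpi1 : ℂ) * u ∉ L.lattice → psi3 u = -cF L (varpi1 * u) := by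
  obtain ⟨w, hw, hL⟩ := exists_hex27
  have hv : varpi1 = w := varpi1_eq (hw := hw)
  refine ⟨hexPair w hw, hL, hv ▸ isGen_hexPair, fun u => ?_, fun u hu => ?_⟩
  · rw [phi3, sF, wp3_eq (hw := hw) hv, wp3'_eq (hw := hw) hv]
  · rw [psi3, cF_of_notMem hu, wp3'_eq (hw := hw) hv, ← neg_div, neg_sub]

end Comparison

section Valuations

variable {Γ₀ : Type*} [LinearOrderedCommGroupWithZero Γ₀] (v : Valuation ℂ Γ₀)

section Basic

theorem valuation_eq_one_of_pow {x : ℂ} {n : ℕ} (hn : n ≠ 0) (h : v (x ^ n) = 1) : v x = 1 := by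
  rw [map_pow] at h
  exact ((pow_eq_one_iff).1 h).resolve_right hn

theorem valuation_ρ3 : v ρ3 = 1 :=
  valuation_eq_one_of_pow v (n := 3) (by norm_num) (by rw [ρ3_cube, map_one])

theorem valuation_intCast_le_one (n : ℤ) : v n ≤ 1 :=
  v.mem_integer_iff _ |>.1 (intCast_mem v.integer n)

theorem valuation_O3_le_one {a : ℂ} (ha : a ∈ O3) : v a ≤ 1 := by
  have h : O3 ≤ v.integer :=
    Subring.closure_le.2 (Set.singleton_subset_iff.2 (valuation_ρ3 v).le)
  exact h ha

variable {L : PeriodPair} [Hex27 L] {z : ℂ}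

theorem valuation_cF_eq_one_of_lt (hz : Reg L z) (h : v (sF L z) < 1) : v (cF L z) = 1 := by
  refine valuation_eq_one_of_pow v (n := 3) (by norm_num) ?_
  have h1 : cF L z ^ 3 = 1 - sF L z ^ 3 := by linear_combination sF_cube_add hz
  rw [h1]
  refine v.map_one_sub_of_lt ?_
  rw [map_pow]
  exact pow_lt_one₀ zero_le h (by norm_num)

theorem valuation_sF_nsmul (hz : Reg L z) (h : v (sF L z) < 1) (n : ℕ) :
    Reg L (n * z) ∧ v (sF L (n * z)) ≤ v (sF L z) := by
  have hc := valuation_cF_eq_one_of_lt v hz h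
  induction n with
  | zero => simp [reg_zero, sF_zero]
  | succ n ih =>
    obtain ⟨hn, hle⟩ := ih
    have hcn := valuation_cF_eq_one_of_lt v hn (hle.trans_lt h)
    have hD : v (cF L z + sF L (n * z) * cF L (n * z) * sF L z ^ 2) = 1 := by
      rw [← hc]
      refine v.map_add_eq_of_lt_left ?_
      rw [map_mul, map_mul, map_pow, hcn, hc, mul_one]
      exact mul_lt_one_of_lt_of_le (hle.trans_lt h) (pow_le_one' h.le 2)
    have hr : Reg L (n * z + z) := reg_add_of_ne_zero hn hz fun h0 => by simp [h0] at hD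
    have hl := congrArg v (addition_law hn hz hr).1
    rw [map_mul, hD, mul_one] at hl
    rw [Nat.cast_succ, add_one_mul]
    refine ⟨hr, hl.trans_le ((v.map_add _ _).trans (max_le hle ?_))⟩
    simp [hc, hcn]

end Basic

variable {L : PeriodPair} [Hex27 L] {ω π : ℂ} {p : ℕ} (hω : IsGen L ω) (h : EisPrime π p)
include hω h

theorem valuation_sF_div_le_one {n : ℤ} (hn : ¬ (p : ℤ) ∣ n) : v (sF L (n * ω / π)) ≤ 1 := by
  by_contra! hgt
  obtain ⟨hr, -, hc⟩ := generic_div hω h hn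
  have hcgt : 1 < v (cF L (n * ω / π)) := by
    have h1 : cF L (n * ω / π) ^ 3 = 1 - sF L (n * ω / π) ^ 3 := by
      linear_combination sF_cube_add hr
    have h2 : 1 < v (sF L (n * ω / π) ^ 3) := by
      rw [map_pow]
      exact one_lt_pow₀ hgt (by norm_num)
    rw [← one_lt_pow_iff (n := 3) (by norm_num), ← map_pow, h1,
      v.map_sub_eq_of_lt_right (by rwa [map_one])]
    exact h2
  obtain ⟨κ, hκ, hκs, hκc⟩ := exists_sF_cF_eq (L := L) (a := 1) (b := 0) (by norm_num)
  obtain ⟨r, hs, -⟩ := add_of_cF_eq_zero hκ hκc hr hc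
  have hlt : v (sF L (κ + n * ω / π)) < 1 := by
    rw [hs, hκs, one_div, map_inv₀]
    exact inv_lt_one_of_one_lt₀ hcgt
  have hle := (valuation_sF_nsmul v r hlt p).2
  have hmem : p * (κ + n * ω / π) - κ ∈ L.lattice := by
    have h1 : (p : ℂ) * (n * ω / π) ∈ L.lattice := by
      refine (hω.mem_iff _).2 ⟨n * (starRingEnd ℂ) π,
        mul_mem (int_mem_O3 n) (conj_mem_O3 h.mem), ?_⟩
      have h0 := h.ne_zero
      rw [h.cast_eq]
      field_simp
    have h3 := mul_mem_lattice (nat_mem_O3 (p / 3)) (three_mul_mem_of_cF_eq_zero hκ hκc)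
    have hp : (p : ℂ) = 3 * (p / 3 : ℕ) + 1 := by
      have := h.mod_three
      exact_mod_cast (show p = 3 * (p / 3) + 1 by omega)
    have := add_mem h3 h1
    convert this using 1
    linear_combination κ * hp
  rw [sF_congr hmem, hκs, map_one] at hle
  exact absurd (hle.trans_lt hlt) (lt_irrefl _)

theorem valuation_sF_div_eq {n k : ℤ} (hn : ¬ (p : ℤ) ∣ n) (hk : ¬ (p : ℤ) ∣ k) :
    v (sF L (n * ω / π)) = v (sF L (k * ω / π)) := by
  have key {n k : ℤ} (hn : ¬ (p : ℤ) ∣ n) (hlt : v (sF L (n * ω / π)) < 1) :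
      v (sF L (k * ω / π)) ≤ v (sF L (n * ω / π)) := by
    have hcop : IsCoprime n (p : ℤ) := by
      rw [isCoprime_comm]
      exact (Int.prime_iff_natAbs_prime.2 (by simpa using h.prime)).coprime_iff_not_dvd.2 hn
    obtain ⟨a, b, hab⟩ := hcop
    have hp0 : (p : ℤ) ≠ 0 := by exact_mod_cast h.prime.ne_zero
    obtain ⟨m, hm⟩ := Int.eq_ofNat_of_zero_le (Int.emod_nonneg (k * a) hp0)
    have hmem : (m : ℂ) * (n * ω / π) - k * ω / π ∈ L.lattice := by
      refine (hω.mem_iff _).2 ⟨(-(k * a / p) * n - k * b : ℤ) * (starRingEnd ℂ) π,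
        mul_mem (int_mem_O3 _) (conj_mem_O3 h.mem), ?_⟩
      have h0 := h.ne_zero
      have h1 : (m : ℤ) * n - k = (-(k * a / p) * n - k * b) * p := by
        rw [← hm]
        linear_combination n * Int.emod_add_mul_ediv (k * a) p + k * hab
      have h2 : (m : ℂ) * n - k = (-(k * a / p) * n - k * b : ℤ) * p := by exact_mod_cast h1
      rw [h.cast_eq] at h2
      field_simp
      linear_combination ω * h2
    have := (valuation_sF_nsmul v (generic_div hω h hn).1 hlt m).2
    rwa [sF_congr hmem] at this
  rcases (valuation_sF_div_le_one v hω h hn).lt_or_eq with h1 | h1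
  · exact le_antisymm (key hk ((key hn h1).trans_lt h1)) (key hn h1)
  · rcases (valuation_sF_div_le_one v hω h hk).lt_or_eq with h2 | h2
    · exact absurd (h1.symm.trans_le (key (k := n) hk h2)) (not_le.2 h2)
    · rw [h1, h2]

theorem valuation_sF_div_pow {n : ℤ} (hn : ¬ (p : ℤ) ∣ n) :
    v (sF L (n * ω / π)) ^ (p - 1) = v π := by
  conv_rhs => rw [← prod_sF_eq hω h, map_prod]
  rw [Finset.prod_eq_pow_card (b := v (sF L (n * ω / π))), Nat.card_Icc, Nat.add_sub_cancel]
  · intro k hk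
    exact_mod_cast valuation_sF_div_eq v hω h (n := k) (fun hd => by
      have := Nat.le_of_dvd (Finset.mem_Icc.1 hk).1 (by exact_mod_cast hd)
      have := (Finset.mem_Icc.1 hk).2
      have := h.prime.pos
      omega) hn

theorem valuation_cF_div {n : ℤ} (hn : ¬ (p : ℤ) ∣ n) : v (cF L (n * ω / π)) = 1 := by
  have key {n : ℤ} (hn : ¬ (p : ℤ) ∣ n) : v (cF L (n * ω / π)) ≤ 1 := by
    have h1 : cF L (n * ω / π) ^ 3 = 1 - sF L (n * ω / π) ^ 3 := by
      linear_combination sF_cube_add (generic_div hω h hn).1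
    rw [← pow_le_one_iff (n := 3) (by norm_num), ← map_pow, h1]
    refine (v.map_sub _ _).trans (max_le (map_one v).le ?_)
    rw [map_pow]
    exact pow_le_one' (valuation_sF_div_le_one v hω h hn) 3
  obtain ⟨hr, -, hc⟩ := generic_div hω h hn
  have h2 := key (n := -n) (by rwa [dvd_neg])
  rw [show ((-n : ℤ) : ℂ) * ω / π = -(n * ω / π) by push_cast; ring, cF_neg hr hc, one_div,
    map_inv₀] at h2
  exact le_antisymm (key hn) ((inv_le_one₀ (zero_lt_iff.2 (by simpa using hc))).1 h2)

end Valuations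

section Residues

theorem sqrtm3_eq : sqrtm3 = 2 * ρ3 + 1 := by
  rw [sqrtm3, ρ3_eq]; push_cast; ring

theorem sqrtm3_eq_mul : sqrtm3 = ρ3 * (1 - ρ3) := by
  rw [sqrtm3_eq]; linear_combination ρ3_quad

theorem sqrtm3_sq : sqrtm3 ^ 2 = -3 := by
  rw [sqrtm3_eq]; linear_combination 4 * ρ3_quad

theorem sqrtm3_mem : sqrtm3 ∈ O3 := by
  rw [sqrtm3_eq_mul]
  exact mul_mem ρ3_mem (sub_mem (one_mem _) ρ3_mem)

/-- A non-unit of the Eisenstein integers is in the maximal ideal of some valuation ring. -/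
theorem exists_valuation_lt_one {a : ℂ} (ha : a ∈ O3) (hu : ∀ b ∈ O3, a * b ≠ 1) :
    ∃ A : ValuationSubring ℂ, A.valuation a < 1 := by
  have hI : Ideal.span {(⟨a, ha⟩ : O3)} ≠ ⊤ := by
    rw [Ne, Ideal.span_singleton_eq_top]
    intro hun
    obtain ⟨b, hb⟩ := isUnit_iff_exists_inv.1 hun
    exact hu b b.2 (congrArg Subtype.val hb)
  obtain ⟨B, -, hB⟩ := Ideal.image_subset_nonunits_valuationSubring _ hI
  refine ⟨B, ?_⟩
  have := hB ⟨⟨a, ha⟩, Ideal.mem_span_singleton_self _, rfl⟩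
  exact (ValuationSubring.mem_nonunits_iff B).1 this

theorem exists_valuation_sqrtm3 : ∃ A : ValuationSubring ℂ, A.valuation sqrtm3 < 1 := by
  refine exists_valuation_lt_one sqrtm3_mem fun b hb h => ?_
  obtain ⟨x, y, hxy⟩ := mem_O3_iff.1 (pow_mem hb 2)
  have h1 : ((3 * x + 1 : ℤ) : ℂ) + (3 * y : ℤ) * ρ3 = (0 : ℤ) + (0 : ℤ) * ρ3 := by
    push_cast
    linear_combination (-3) * hxy + b ^ 2 * sqrtm3_sq - (sqrtm3 * b + 1) * h
  have := (int_pair_ext h1).1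
  omega

theorem EisPrime.exists_valuation {π : ℂ} {p : ℕ} (h : EisPrime π p) :
    ∃ A : ValuationSubring ℂ, A.valuation π < 1 := by
  refine exists_valuation_lt_one h.mem fun b hb hn => ?_
  have := h.dvd_of_eq_mul (n := 1) hb (by rw [hn, Int.cast_one])
  have := Int.le_of_dvd one_pos this
  have := h.prime.one_lt
  omega

variable {Γ₀ : Type*} [LinearOrderedCommGroupWithZero Γ₀] (v : Valuation ℂ Γ₀)

theorem dvd_of_valuation_lt_one {q : ℕ} (hq : q.Prime) (hv : v (q : ℂ) < 1) {n : ℤ}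
    (hn : v (n : ℂ) < 1) : (q : ℤ) ∣ n := by
  by_contra hd
  obtain ⟨a, b, hab⟩ :=
    (Int.prime_iff_natAbs_prime.2 (by simpa using hq)).coprime_iff_not_dvd.2 hd
  have h1 : (a : ℂ) * (q : ℂ) + b * n = 1 := by exact_mod_cast hab
  have h2 := congrArg v h1
  rw [map_one] at h2
  refine (v.map_add_lt (g := 1) ?_ ?_).ne h2 <;> rw [map_mul]
  · exact (mul_comm _ _).trans_lt (mul_lt_one_of_lt_of_le hv (valuation_intCast_le_one v a))
  · exact (mul_comm _ _).trans_lt (mul_lt_one_of_lt_of_le hn (valuation_intCast_le_one v b))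

theorem valuation_three_lt_one (hv : v sqrtm3 < 1) : v 3 < 1 := by
  have h := congrArg v sqrtm3_sq
  rw [map_pow, v.map_neg] at h
  rw [← h]
  exact pow_lt_one₀ zero_le hv (by norm_num)

theorem sqrtm3_dvd_of_valuation_lt_one (hv : v sqrtm3 < 1) {a : ℂ} (ha : a ∈ O3)
    (h : v a < 1) : ∃ b ∈ O3, a = sqrtm3 * b := by
  obtain ⟨x, y, rfl⟩ := mem_O3_iff.1 ha
  have hρ : v (y * (1 - ρ3)) < 1 := by
    have := valuation_ρ3 v
    rw [sqrtm3_eq_mul, map_mul, this, one_mul] at hv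
    rw [map_mul]
    exact (mul_comm _ _).trans_lt (mul_lt_one_of_lt_of_le hv (valuation_intCast_le_one v y))
  have h1 : v ((x + y : ℤ) : ℂ) < 1 := by
    rw [show ((x + y : ℤ) : ℂ) = (x + y * ρ3) + y * (1 - ρ3) by push_cast; ring]
    exact v.map_add_lt h hρ
  obtain ⟨t, ht⟩ := dvd_of_valuation_lt_one v Nat.prime_three
    (by exact_mod_cast valuation_three_lt_one v hv) h1
  have ht' : (x : ℂ) + y = 3 * t := by exact_mod_cast ht
  refine ⟨-sqrtm3 * t - y * ρ3 ^ 2, sub_mem (mul_mem (neg_mem sqrtm3_mem) (int_mem_O3 t))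
    (mul_mem (int_mem_O3 y) (pow_mem ρ3_mem 2)), ?_⟩
  linear_combination ht' + (t : ℂ) * sqrtm3_sq + y * ρ3 ^ 2 * sqrtm3_eq_mul +
    y * (1 - ρ3) * ρ3_cube

theorem EisPrime.dvd_of_valuation_lt_one {π : ℂ} {p : ℕ} (h : EisPrime π p) (hv : v π < 1) {a : ℂ}
    (ha : a ∈ O3) (hlt : v a < 1) : ∃ b ∈ O3, a = π * b := by
  obtain ⟨n, b, hb, rfl⟩ := h.exists_int ha
  have hmul {x : ℂ} (hx : x ∈ O3) : v (π * x) < 1 := by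
    rw [map_mul]
    exact mul_lt_one_of_lt_of_le hv (valuation_O3_le_one v hx)
  have h1 : v (n : ℂ) < 1 := by
    rw [show (n : ℂ) = (n + π * b) - π * b by ring]
    exact v.map_sub_lt hlt (hmul hb)
  have hp : v (p : ℂ) < 1 := by
    rw [← h.norm]
    exact hmul (conj_mem_O3 h.mem)
  obtain ⟨t, rfl⟩ := _root_.dvd_of_valuation_lt_one v h.prime hp h1
  refine ⟨(starRingEnd ℂ) π * t + b, add_mem (mul_mem (conj_mem_O3 h.mem) (int_mem_O3 t)) hb, ?_⟩
  push_cast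
  linear_combination -(t : ℂ) * h.norm

theorem EisPrime.valuation_eq_one {π : ℂ} {p : ℕ} (h : EisPrime π p) (hv : v sqrtm3 < 1) :
    v π = 1 := by
  obtain ⟨d, hd, hπ⟩ := h.primary
  rw [hπ]
  refine v.map_one_add_of_lt ?_
  rw [map_mul]
  exact mul_lt_one_of_lt_of_le (valuation_three_lt_one v hv) (valuation_O3_le_one v hd)

theorem valuation_one_add_lt_one (hv : v sqrtm3 < 1) {x : ℂ} (hx : v x ≤ 1)
    (h : v (1 + x ^ 3) < 1) : v (1 + x) < 1 := by
  have h1 : v ((1 + x) ^ 3) < 1 := by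
    rw [show (1 + x) ^ 3 = (1 + x ^ 3) + 3 * (x + x ^ 2) by ring]
    refine v.map_add_lt h ?_
    rw [map_mul]
    refine mul_lt_one_of_lt_of_le (valuation_three_lt_one v hv) ?_
    refine v.map_add_le hx ?_
    rw [map_pow]
    exact pow_le_one' hx 2
  rwa [map_pow, pow_lt_one_iff (by norm_num)] at h1

variable {L : PeriodPair} [Hex27 L] {ω π : ℂ} {p : ℕ}

/-- Multiplication by `1 - ρ` for the function `sF`. -/
theorem sF_one_sub_ρ3_mul {z : ℂ} (hz : Reg L z) (hc : cF L z ≠ 0) (h : Reg L (z + -(ρ3 * z))) :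
    sF L (z + -(ρ3 * z)) * (1 + ρ3 ^ 2 * sF L z ^ 3) = (1 - ρ3) * sF L z * cF L z := by
  have hcρ : cF L (ρ3 * z) ≠ 0 := by rwa [cF_rho]
  have hρ := reg_rho.2 hz
  have hl := (addition_law hz ((cF_ne_zero_iff hρ).1 hcρ) h).1
  rw [sF_neg hρ hcρ, cF_neg hρ hcρ, cF_rho, sF_rho] at hl
  generalize sF L (z + -(ρ3 * z)) = X at hl ⊢
  field_simp at hl
  linear_combination hl

variable (hω : IsGen L ω) (h : EisPrime π p)
include hω h

theorem valuation_sF_div_eq_one (hv : v sqrtm3 < 1) {n : ℤ} (hn : ¬ (p : ℤ) ∣ n) :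
    v (sF L (n * ω / π)) = 1 := by
  have := valuation_sF_div_pow v hω h hn
  rw [h.valuation_eq_one v hv] at this
  have h2 := h.prime.two_le
  exact (pow_eq_one_iff.1 this).resolve_right (by omega)

theorem valuation_one_add_div_lt_one (hv : v sqrtm3 < 1) {n : ℤ} (hn : ¬ (p : ℤ) ∣ n) :
    v (1 + sF L (n * ω / π)) < 1 ∧ v (1 + cF L (n * ω / π)) < 1 := by
  set z := n * ω / π with hzdef
  obtain ⟨hz, -, hc⟩ := generic_div hω h hn
  have hs1 := valuation_sF_div_eq_one v hω h hv hn
  have hc1 := valuation_cF_div v hω h hn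
  rw [← hzdef] at hz hc hs1 hc1
  obtain ⟨k, b, hb, hk⟩ := h.exists_int
    (mul_mem (int_mem_O3 n) (sub_mem (one_mem _) ρ3_mem))
  have h0 := h.ne_zero
  have hmem : z + -(ρ3 * z) - k * ω / π ∈ L.lattice := by
    refine (hω.mem_iff _).2 ⟨b, hb, ?_⟩
    rw [hzdef]
    field_simp
    linear_combination ω * hk
  have hkp : ¬ (p : ℤ) ∣ k := by
    rintro ⟨t, rfl⟩
    refine hn (dvd_of_three_mul_div_mem hω h ?_)
    have h1 : z + -(ρ3 * z) ∈ L.lattice := by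
      have h2 : ((p * t : ℤ) : ℂ) * ω / π ∈ L.lattice := by
        refine (hω.mem_iff _).2 ⟨(starRingEnd ℂ) π * t, mul_mem (conj_mem_O3 h.mem) (int_mem_O3 t), ?_⟩
        push_cast
        rw [h.cast_eq]
        field_simp
      simpa using add_mem hmem h2
    have h3 := mul_mem_lattice (sub_mem (one_mem _) (pow_mem ρ3_mem 2)) h1
    convert h3 using 1
    rw [← hzdef]
    linear_combination z * ρ3_quad - z * ρ3_cube
  have hR := (reg_congr hmem).2 (generic_div hω h hkp).1
  have hlaw := congrArg v (sF_one_sub_ρ3_mul hz hc hR)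
  have hρ1 : v (1 - ρ3) < 1 := by
    rwa [sqrtm3_eq_mul, map_mul, valuation_ρ3 v, one_mul] at hv
  rw [map_mul, map_mul, map_mul, sF_congr hmem, valuation_sF_div_eq_one v hω h hv hkp, one_mul,
    hs1, hc1, mul_one, mul_one] at hlaw
  have hA : v (1 + sF L z ^ 3) < 1 := by
    rw [show 1 + sF L z ^ 3 = (1 + ρ3 ^ 2 * sF L z ^ 3) + (1 - ρ3) * ((1 + ρ3) * sF L z ^ 3) by ring]
    refine v.map_add_lt (hlaw.trans_lt hρ1) ?_
    rw [map_mul, map_mul, map_pow, hs1, one_pow, mul_one]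
    exact mul_lt_one_of_lt_of_le hρ1 (valuation_O3_le_one v (add_mem (one_mem _) ρ3_mem))
  refine ⟨valuation_one_add_lt_one v hv hs1.le hA, valuation_one_add_lt_one v hv hc1.le ?_⟩
  rw [show 1 + cF L z ^ 3 = 3 - (1 + sF L z ^ 3) by linear_combination sF_cube_add hz]
  exact v.map_sub_lt (valuation_three_lt_one v hv) hA

end Residues

section Descent

theorem isIntegral_of_forall_valuation_le_one {x : ℂ}
    (h : ∀ A : ValuationSubring ℂ, A.valuation x ≤ 1) : IsIntegral ℤ x := by
  by_contra hx
  obtain ⟨V, -, hV⟩ := Subring.exists_le_valuationSubring_of_isIntegrallyClosedIn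
    (R := (integralClosure ℤ ℂ).toSubring) (x := x) hx
  exact hV ((V.valuation_le_one_iff x).1 (h V))

/-- The graph of an isomorphism between subfields of `ℂ` which fixes `ρ` and whose domain contains
the algebraic integers. -/
structure FieldGraph (Γ : Subring (ℂ × ℂ)) : Prop where
  eq_zero : ∀ {y}, ((0 : ℂ), y) ∈ Γ → y = 0
  eq_zero' : ∀ {x}, (x, (0 : ℂ)) ∈ Γ → x = 0
  inv_mem : ∀ {x y}, (x, y) ∈ Γ → (x⁻¹, y⁻¹) ∈ Γ
  rho_mem : (ρ3, ρ3) ∈ Γ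
  exists_mem : ∀ {x}, IsIntegral ℤ x → ∃ y, (x, y) ∈ Γ

theorem FieldGraph.O3_mem {Γ : Subring (ℂ × ℂ)} (hΓ : FieldGraph Γ) {a : ℂ} (ha : a ∈ O3) :
    (a, a) ∈ Γ := by
  obtain ⟨x, y, rfl⟩ := mem_O3_iff.1 ha
  exact add_mem (intCast_mem Γ x) (mul_mem (intCast_mem Γ y) hΓ.rho_mem)

theorem FieldGraph.eq_of_mem {Γ : Subring (ℂ × ℂ)} (hΓ : FieldGraph Γ) {x y y' : ℂ}
    (h : (x, y) ∈ Γ) (h' : (x, y') ∈ Γ) : y = y' := by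
  have := sub_mem h h'
  rw [Prod.mk_sub_mk, sub_self] at this
  exact sub_eq_zero.1 (hΓ.eq_zero this)

theorem exists_rat_of_mem_adjoin {x : ℂ} (hx : x ∈ IntermediateField.adjoin ℚ {ρ3}) :
    ∃ a b : ℚ, x = a + b * ρ3 := by
  induction hx using IntermediateField.adjoin_induction with
  | mem x hx => exact ⟨0, 1, by simpa using hx⟩
  | algebraMap x => exact ⟨x, 0, by simp⟩
  | add x y _ _ hx hy =>
    obtain ⟨a, b, rfl⟩ := hx
    obtain ⟨c, d, rfl⟩ := hy
    exact ⟨a + c, b + d, by push_cast; ring⟩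
  | mul x y _ _ hx hy =>
    obtain ⟨a, b, rfl⟩ := hx
    obtain ⟨c, d, rfl⟩ := hy
    exact ⟨a * c - b * d, a * d + b * c - b * d, by
      push_cast; linear_combination (b * d : ℂ) * ρ3_quad⟩
  | inv x _ hx =>
    obtain ⟨a, b, rfl⟩ := hx
    by_cases h0 : (a : ℂ) + b * ρ3 = 0
    · exact ⟨0, 0, by simp [h0]⟩
    · have hN : ((a : ℂ) + b * ρ3) * (a - b - b * ρ3) = a ^ 2 - a * b + b ^ 2 := by
        linear_combination -(b ^ 2 : ℂ) * ρ3_quad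
      have h1 : (a : ℂ) - b - b * ρ3 ≠ 0 := by
        intro h1
        have := int_add_mul_ρ3_eq_zero (a := (a - b : ℝ)) (b := -b) (by push_cast; linear_combination h1)
        have hb : b = 0 := by exact_mod_cast neg_eq_zero.1 this.2
        have ha : a = b := by exact_mod_cast sub_eq_zero.1 this.1
        simp [ha, hb] at h0
      refine ⟨(a - b) / (a ^ 2 - a * b + b ^ 2), -b / (a ^ 2 - a * b + b ^ 2), ?_⟩
      push_cast
      rw [← hN]
      field_simp
      ring

theorem exists_int_of_isIntegral_rat {q : ℚ} (h : IsIntegral ℤ (q : ℂ)) : ∃ n : ℤ, q = n := by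
  have h1 : IsIntegral ℤ q := (isIntegral_algebraMap_iff (B := ℂ) (RingHom.injective _)).1 (by simpa using h)
  obtain ⟨n, hn⟩ := IsIntegrallyClosed.isIntegral_iff.1 h1
  exact ⟨n, by simpa using hn.symm⟩

theorem mem_O3_of_isIntegral {x : ℂ} (hx : IsIntegral ℤ x)
    (hK : x ∈ IntermediateField.adjoin ℚ {ρ3}) : x ∈ O3 := by
  obtain ⟨a, b, rfl⟩ := exists_rat_of_mem_adjoin hK
  have hρ : IsIntegral ℤ ρ3 := IsIntegral.of_pow (n := 3) (by norm_num) (by rw [ρ3_cube]; exact isIntegral_one)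
  have hconj : IsIntegral ℤ ((a : ℂ) + b * ρ3 ^ 2) := by
    have := hx.map ((starRingEnd ℂ).toIntAlgHom)
    simpa [conj_ρ3] using this
  obtain ⟨u, hu⟩ := exists_int_of_isIntegral_rat (q := 2 * a - b) (by
    rw [show ((2 * a - b : ℚ) : ℂ) = (a + b * ρ3) + (a + b * ρ3 ^ 2) by
      push_cast; linear_combination -(b : ℂ) * ρ3_quad]
    exact hx.add hconj)
  obtain ⟨t, ht⟩ := exists_int_of_isIntegral_rat (q := 2 * b - a) (by
    rw [show ((2 * b - a : ℚ) : ℂ) = (a + b * ρ3) * ρ3 ^ 2 + (a + b * ρ3 ^ 2) * ρ3 by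
      push_cast; linear_combination (-(a : ℂ)) * ρ3_quad - 2 * b * ρ3_cube]
    exact (hx.mul (hρ.pow 2)).add (hconj.mul hρ))
  obtain ⟨N, hN⟩ := exists_int_of_isIntegral_rat (q := a ^ 2 - a * b + b ^ 2) (by
    rw [show ((a ^ 2 - a * b + b ^ 2 : ℚ) : ℂ) = (a + b * ρ3) * (a + b * ρ3 ^ 2) by
      push_cast; linear_combination (-(a * b) : ℂ) * ρ3_quad - (b ^ 2 : ℂ) * ρ3_cube]
    exact hx.mul hconj)
  have h3 : u ^ 2 + u * t + t ^ 2 = 3 * N := by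
    have : (u : ℚ) ^ 2 + u * t + t ^ 2 = 3 * N := by rw [← hu, ← ht, ← hN]; ring
    exact_mod_cast this
  have hd : (3 : ℤ) ∣ u - t := by
    refine Int.prime_three.dvd_of_dvd_pow (n := 2) ⟨N - u * t, ?_⟩
    linear_combination h3
  obtain ⟨k, hk⟩ := hd
  have hk' : (u : ℚ) - t = 3 * k := by exact_mod_cast hk
  have hb : b = (t + k : ℤ) := by
    push_cast
    linear_combination (1 / 3 : ℚ) * hu + 2 / 3 * ht + 1 / 3 * hk'
  have ha : a = (t + 2 * k : ℤ) := by
    push_cast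
    linear_combination (2 / 3 : ℚ) * hu + 1 / 3 * ht + 2 / 3 * hk'
  rw [ha, hb]
  exact mem_O3_iff.2 ⟨_, _, by rw [Rat.cast_intCast, Rat.cast_intCast]⟩

/-- An algebraic integer fixed by all isomorphisms fixing `ρ` is an Eisenstein integer. -/
theorem mem_O3_of_forall_fieldGraph {x : ℂ} (hx : IsIntegral ℤ x)
    (h : ∀ Γ, FieldGraph Γ → (x, x) ∈ Γ) : x ∈ O3 := by
  refine mem_O3_of_isIntegral hx ?_
  set K := IntermediateField.adjoin ℚ {ρ3} with hK
  let Ω := algebraicClosure K ℂ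
  have hmem {y : ℂ} (hy : IsIntegral ℤ y) : y ∈ Ω :=
    mem_algebraicClosure_iff.2 (hy.tower_top (A := K)).isAlgebraic
  have : IsAlgClosure K Ω := algebraicClosure.isAlgClosure K ℂ
  have hfix (σ : Ω ≃ₐ[K] Ω) : σ ⟨x, hmem hx⟩ = ⟨x, hmem hx⟩ := by
    have hmemΓ {y z : ℂ} : (y, z) ∈ ((algebraMap Ω ℂ).prod ((algebraMap Ω ℂ).comp (σ : Ω →+* Ω))).range ↔
        ∃ u : Ω, (u : ℂ) = y ∧ (σ u : ℂ) = z := by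
      simp [RingHom.mem_range, Prod.ext_iff]
    have hΓ : FieldGraph ((algebraMap Ω ℂ).prod ((algebraMap Ω ℂ).comp (σ : Ω →+* Ω))).range := by
      constructor
      · intro y hy
        obtain ⟨u, hu, rfl⟩ := hmemΓ.1 hy
        have : u = 0 := Subtype.ext hu
        simp [this]
      · intro y hy
        obtain ⟨u, rfl, hu⟩ := hmemΓ.1 hy
        have : σ u = 0 := Subtype.ext hu
        have : u = 0 := by simpa using this
        simp [this]
      · intro y z hyz
        obtain ⟨u, rfl, rfl⟩ := hmemΓ.1 hyz
        exact hmemΓ.2 ⟨u⁻¹, by simp, by simp⟩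
      · have hρ : ρ3 ∈ K := IntermediateField.subset_adjoin ℚ {ρ3} rfl
        refine hmemΓ.2 ⟨algebraMap K Ω ⟨ρ3, hρ⟩, rfl, ?_⟩
        rw [AlgEquiv.commutes]
        rfl
      · intro y hy
        exact ⟨_, hmemΓ.2 ⟨⟨y, hmem hy⟩, rfl, rfl⟩⟩
    obtain ⟨u, hu, hσ⟩ := hmemΓ.1 (h _ hΓ)
    have : u = ⟨x, hmem hx⟩ := Subtype.ext hu
    rw [this] at hσ
    exact Subtype.ext hσ
  have : IsGalois K Ω := inferInstance
  obtain ⟨k, hk⟩ := IntermediateField.mem_bot.1 ((InfiniteGalois.mem_bot_iff_fixed (⟨x, hmem hx⟩ : Ω)).2 hfix)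
  have := congrArg (algebraMap Ω ℂ) hk
  have hx' : (k : ℂ) = x := this
  exact hx' ▸ k.2

end Descent

section GaloisAction

theorem isIntegral_sF_cF {L : PeriodPair} [Hex27 L] {ω π : ℂ} {p : ℕ} (hω : IsGen L ω)
    (h : EisPrime π p) {n : ℤ} (hn : ¬ (p : ℤ) ∣ n) :
    IsIntegral ℤ (sF L (n * ω / π)) ∧ IsIntegral ℤ (cF L (n * ω / π)) :=
  ⟨isIntegral_of_forall_valuation_le_one fun A => valuation_sF_div_le_one A.valuation hω h hn,
    isIntegral_of_forall_valuation_le_one fun A => (valuation_cF_div A.valuation hω h hn).le⟩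

/-- The graph `Γ` takes the point `z` of the elliptic curve to the point `w`. -/
structure Transports (Γ : Subring (ℂ × ℂ)) (L : PeriodPair) (z w : ℂ) : Prop where
  reg : Reg L z
  reg' : Reg L w
  sF_mem : (sF L z, sF L w) ∈ Γ
  cF_mem : (cF L z, cF L w) ∈ Γ

variable {Γ : Subring (ℂ × ℂ)} {L : PeriodPair}

theorem Transports.congr {z w z' w' : ℂ} (h : Transports Γ L z w) (hz : z' - z ∈ L.lattice)
    (hw : w' - w ∈ L.lattice) : Transports Γ L z' w' :=
  ⟨(reg_congr hz).2 h.reg, (reg_congr hw).2 h.reg', by rw [sF_congr hz, sF_congr hw]; exact h.sF_mem,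
    by rw [cF_congr hz, cF_congr hw]; exact h.cF_mem⟩

theorem Transports.cF_ne_zero (hΓ : FieldGraph Γ) {z w : ℂ} (h : Transports Γ L z w)
    (hc : cF L z ≠ 0) : cF L w ≠ 0 := by
  intro h0
  have := h.cF_mem
  rw [h0] at this
  exact hc (hΓ.eq_zero' this)

theorem Transports.neg (hΓ : FieldGraph Γ) {z w : ℂ} (h : Transports Γ L z w)
    (hc : cF L z ≠ 0) : Transports Γ L (-z) (-w) := by
  have hc' := h.cF_ne_zero hΓ hc
  refine ⟨(cF_ne_zero_iff h.reg).1 hc, (cF_ne_zero_iff h.reg').1 hc', ?_, ?_⟩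
  · rw [sF_neg h.reg hc, sF_neg h.reg' hc', div_eq_mul_inv, div_eq_mul_inv]
    exact mul_mem (neg_mem h.sF_mem) (hΓ.inv_mem h.cF_mem)
  · rw [cF_neg h.reg hc, cF_neg h.reg' hc', one_div, one_div]
    exact hΓ.inv_mem h.cF_mem

variable [Hex27 L] (hΓ : FieldGraph Γ)
include hΓ

theorem exists_transports {z : ℂ} (hz : Reg L z) (hs : IsIntegral ℤ (sF L z))
    (hc : IsIntegral ℤ (cF L z)) : ∃ w, Transports Γ L z w := by
  obtain ⟨a, ha⟩ := hΓ.exists_mem hs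
  obtain ⟨b, hb⟩ := hΓ.exists_mem hc
  have h1 := add_mem (pow_mem ha 3) (pow_mem hb 3)
  rw [Prod.pow_mk, Prod.pow_mk, Prod.mk_add_mk, sF_cube_add hz] at h1
  obtain ⟨w, hw, rfl, rfl⟩ := exists_sF_cF_eq (L := L) (hΓ.eq_of_mem h1 (one_mem Γ))
  exact ⟨w, hz, hw, ha, hb⟩

namespace Transports

theorem sub_mem_lattice {z w w' : ℂ} (h : Transports Γ L z w) (h' : Transports Γ L z w') :
    w - w' ∈ L.lattice :=
  sub_mem_of_eq h.reg' h'.reg' (hΓ.eq_of_mem h.sF_mem h'.sF_mem) (hΓ.eq_of_mem h.cF_mem h'.cF_mem)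

theorem ρ3_mul {z w : ℂ} (h : Transports Γ L z w) : Transports Γ L (ρ3 * z) (ρ3 * w) :=
  ⟨reg_rho.2 h.reg, reg_rho.2 h.reg', by
    rw [sF_rho, sF_rho]; exact mul_mem hΓ.rho_mem h.sF_mem, by
    rw [cF_rho, cF_rho]; exact h.cF_mem⟩

theorem add_of_ne_zero {u v u' v' : ℂ} (h : Transports Γ L u u') (h' : Transports Γ L v v')
    (hD : cF L v + sF L u * cF L u * sF L v ^ 2 ≠ 0) : Transports Γ L (u + v) (u' + v') := by
  have hDm : (cF L v + sF L u * cF L u * sF L v ^ 2,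
      cF L v' + sF L u' * cF L u' * sF L v' ^ 2) ∈ Γ :=
    add_mem h'.cF_mem (mul_mem (mul_mem h.sF_mem h.cF_mem) (pow_mem h'.sF_mem 2))
  have hD' : cF L v' + sF L u' * cF L u' * sF L v' ^ 2 ≠ 0 := by
    intro h0
    rw [h0] at hDm
    exact hD (hΓ.eq_zero' hDm)
  have hr := reg_add_of_ne_zero h.reg h'.reg hD
  have hr' := reg_add_of_ne_zero h.reg' h'.reg' hD'
  obtain ⟨h1, h2⟩ := addition_law h.reg h'.reg hr
  obtain ⟨h3, h4⟩ := addition_law h.reg' h'.reg' hr'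
  refine ⟨hr, hr', ?_, ?_⟩
  · rw [eq_div_of_mul_eq hD h1, eq_div_of_mul_eq hD' h3, div_eq_mul_inv, div_eq_mul_inv]
    exact mul_mem (add_mem h.sF_mem (mul_mem (mul_mem (pow_mem h.cF_mem 2) h'.sF_mem) h'.cF_mem))
      (hΓ.inv_mem hDm)
  · rw [eq_div_of_mul_eq hD h2, eq_div_of_mul_eq hD' h4, div_eq_mul_inv, div_eq_mul_inv]
    exact mul_mem (sub_mem (mul_mem h.cF_mem (pow_mem h'.cF_mem 2))
      (mul_mem (pow_mem h.sF_mem 2) h'.sF_mem)) (hΓ.inv_mem hDm)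

theorem add {u v u' v' : ℂ} (h : Transports Γ L u u') (h' : Transports Γ L v v')
    (hr : Reg L (u + v)) (hs : sF L v ≠ 0) (hc : cF L v ≠ 0) :
    Transports Γ L (u + v) (u' + v') := by
  by_cases hD : cF L v + sF L u * cF L u * sF L v ^ 2 = 0
  · by_cases hD' : cF L u + sF L v * cF L v * sF L u ^ 2 = 0
    · exfalso
      obtain ⟨h1, -⟩ := addition_law h.reg h'.reg hr
      obtain ⟨h2, -⟩ := addition_law h'.reg h.reg (add_comm u v ▸ hr)
      rw [hD, mul_zero] at h1
      rw [hD', mul_zero] at h2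
      have h3 := sF_cube_add h.reg
      generalize sF L u = a at *
      generalize cF L u = b at *
      generalize sF L v = c at *
      generalize cF L v = d at *
      have e1 : (a * c) ^ 3 = 1 := by
        refine mul_left_cancel₀ hc ?_
        linear_combination a * c ^ 2 * hD' - hD
      have ea : a ^ 3 * c ^ 3 = 1 := by linear_combination e1
      have e2 : b ^ 3 = -1 := by
        refine mul_left_cancel₀ hs ?_
        linear_combination -h2 - a * b * (d - a * b * c ^ 2) * hD - b ^ 3 * c * ea
      have e3 : (b * c) ^ 3 = 1 := by
        have ha : a ≠ 0 := by rintro rfl; simp at ea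
        refine mul_left_cancel₀ ha ?_
        linear_combination h1 + b ^ 2 * c * hD
      have e4 : c ^ 3 = -1 := by linear_combination -e3 + c ^ 3 * e2
      have e5 : a ^ 3 = -1 := by linear_combination -ea + a ^ 3 * e4
      rw [e5, e2] at h3
      norm_num at h3
    · rw [add_comm u, add_comm u']
      exact h'.add_of_ne_zero hΓ h hD'
  · exact h.add_of_ne_zero hΓ h' hD

end Transports

variable {ω π : ℂ} {p : ℕ} (hω : IsGen L ω) (h : EisPrime π p)
include hω h

theorem transports_nsmul {w : ℂ} (hw : Transports Γ L (ω / π) w) {n : ℕ} (hn : 1 ≤ n)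
    (hnp : n < p) : Transports Γ L (n * ω / π) (n * w) := by
  induction n, hn using Nat.le_induction with
  | base => simpa using hw
  | succ n hn ih =>
    have hg {m : ℕ} (h1 : 1 ≤ m) (h2 : m < p) :=
      generic_div_of_mem_Icc hω h (Finset.mem_Icc.2 ⟨h1, Nat.le_sub_one_of_lt h2⟩)
    obtain ⟨-, hs, hc⟩ := hg le_rfl h.prime.one_lt
    rw [Nat.cast_one, one_mul] at hs hc
    have he : (n : ℂ) * ω / π + ω / π = (n + 1 : ℕ) * ω / π := by push_cast; ring
    have := (ih (by omega)).add hΓ hw (by rw [he]; exact (hg (by omega) hnp).1) hs hc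
    rw [he] at this
    convert this using 1
    push_cast; ring

/-- Isomorphisms act on the `π`-torsion by multiplication by a residue class. -/
theorem exists_transports_mul : ∃ μ : ℤ, ¬ (p : ℤ) ∣ μ ∧ ∀ n : ℤ, ¬ (p : ℤ) ∣ n →
    Transports Γ L (n * ω / π) ((n * μ : ℤ) * ω / π) := by
  have h0 := h.ne_zero
  have hp1 := h.prime.one_lt
  have h1p : ¬ (p : ℤ) ∣ 1 := by
    intro hd
    have := Int.le_of_dvd one_pos hd
    omega
  have hint := isIntegral_sF_cF hω h h1p
  obtain ⟨hr, hs, hc⟩ := generic_div hω h h1p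
  rw [Int.cast_one, one_mul] at hint hr hs hc
  obtain ⟨w, hw⟩ := exists_transports hΓ hr hint.1 hint.2
  have hpw : (p : ℂ) * w ∈ L.lattice := by
    have h1 := transports_nsmul hΓ hω h hw (n := p - 1) (by have := h.prime.two_le; omega)
      (by omega)
    have h2 := (hw.neg hΓ hc).congr (z' := (p - 1 : ℕ) * ω / π) (w' := -w) ?_ (by simp)
    · have := h1.sub_mem_lattice hΓ h2
      rw [Nat.cast_sub hp1.le] at this
      convert this using 1
      push_cast; ring
    · refine (hω.mem_iff _).2 ⟨(starRingEnd ℂ) π, conj_mem_O3 h.mem, ?_⟩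
      rw [Nat.cast_sub hp1.le, h.cast_eq]
      field_simp
      push_cast; ring
  have hred (n : ℤ) (hn : ¬ (p : ℤ) ∣ n) : Transports Γ L (n * ω / π) (n * w) := by
    have hp0 : (p : ℤ) ≠ 0 := by omega
    obtain ⟨m, hm⟩ := Int.eq_ofNat_of_zero_le (Int.emod_nonneg n hp0)
    have hlt := Int.emod_lt_of_pos n (b := p) (by omega)
    have hne : n % p ≠ 0 := fun h => hn (Int.dvd_of_emod_eq_zero h)
    have hdm : (n : ℂ) = m + p * (n / p : ℤ) := by
      exact_mod_cast (hm ▸ (Int.emod_add_mul_ediv n p)).symm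
    refine (transports_nsmul hΓ hω h hw (n := m) (by omega) (by omega)).congr ?_ ?_
    · refine (hω.mem_iff _).2 ⟨(starRingEnd ℂ) π * (n / p : ℤ),
        mul_mem (conj_mem_O3 h.mem) (int_mem_O3 _), ?_⟩
      rw [h.cast_eq] at hdm
      field_simp
      linear_combination ω * hdm
    · convert mul_mem_lattice (int_mem_O3 (n / p)) hpw using 1
      linear_combination w * hdm
  obtain ⟨m, b, hb, hm⟩ := h.exists_int_sub_ρ3
  have hmp : ¬ (p : ℤ) ∣ m := by
    rintro ⟨t, rfl⟩
    have h1 : ((1 : ℤ) : ℂ) = π * (ρ3 ^ 2 * ((starRingEnd ℂ) π * t + b)) := by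
      push_cast at hm ⊢
      linear_combination -ρ3_cube + ρ3 ^ 2 * hm - ρ3 ^ 2 * t * h.norm
    exact h1p (h.dvd_of_eq_mul (mul_mem (pow_mem ρ3_mem 2)
      (add_mem (mul_mem (conj_mem_O3 h.mem) (int_mem_O3 t)) hb)) h1)
  have hρw : m * w - ρ3 * w ∈ L.lattice := by
    refine (hred m hmp).sub_mem_lattice hΓ ((hw.ρ3_mul hΓ).congr ?_ (by simp))
    refine (hω.mem_iff _).2 ⟨-b, neg_mem hb, ?_⟩
    field_simp
    linear_combination -ω * hm
  have hπw : π * w ∈ L.lattice := by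
    obtain ⟨x, y, hxy⟩ := mem_O3_iff.1 h.mem
    have h1 : ((x + y * m : ℤ) : ℂ) = π * (1 - y * b) := by
      push_cast
      linear_combination -hxy - (y : ℂ) * hm
    obtain ⟨t, ht⟩ := h.dvd_of_eq_mul (sub_mem (one_mem _) (mul_mem (int_mem_O3 y) hb)) h1
    have ht' : (x : ℂ) + y * m = p * t := by exact_mod_cast ht
    convert sub_mem (mul_mem_lattice (int_mem_O3 t) hpw) (mul_mem_lattice (int_mem_O3 y) hρw) using 1
    linear_combination w * hxy + w * ht'
  obtain ⟨β, hβ, hwβ⟩ := (hω.mem_iff _).1 hπw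
  obtain ⟨μ, b', hb', rfl⟩ := h.exists_int hβ
  have hwμ : w - μ * ω / π ∈ L.lattice := by
    refine (hω.mem_iff _).2 ⟨b', hb', ?_⟩
    field_simp
    linear_combination hwβ
  refine ⟨μ, ?_, fun n hn => (hred n hn).congr (by simp) ?_⟩
  · rintro ⟨t, rfl⟩
    have hwΛ : w ∈ L.lattice := by
      have h2 : ((p * t : ℤ) : ℂ) * ω / π ∈ L.lattice := by
        refine (hω.mem_iff _).2 ⟨(starRingEnd ℂ) π * t, mul_mem (conj_mem_O3 h.mem) (int_mem_O3 t), ?_⟩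
        push_cast
        rw [h.cast_eq]
        field_simp
      simpa using add_mem hwμ h2
    have := hw.sF_mem
    rw [sF_of_mem hwΛ] at this
    exact hs (hΓ.eq_zero' this)
  · convert neg_mem (mul_mem_lattice (int_mem_O3 n) hwμ) using 1
    push_cast; ring

end GaloisAction

section Congruences

theorem ECong.symm {a b c : ℂ} : ECong a b c → ECong b a c := by
  rintro ⟨d, hd, h⟩
  exact ⟨-d, neg_mem hd, by linear_combination -h⟩

theorem ECong.trans {a b c m : ℂ} : ECong a b m → ECong b c m → ECong a c m := by
  rintro ⟨d, hd, h⟩ ⟨d', hd', h'⟩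
  exact ⟨d + d', add_mem hd hd', by linear_combination h + h'⟩

theorem ECong.mul_left {a b m c : ℂ} (hc : c ∈ O3) : ECong a b m → ECong (c * a) (c * b) m := by
  rintro ⟨d, hd, h⟩
  exact ⟨c * d, mul_mem hc hd, by linear_combination c * h⟩

theorem ECong.prod {ι : Type*} {T : Finset ι} {f g : ι → ℂ} {m : ℂ}
    (hf : ∀ i ∈ T, f i ∈ O3) (hg : ∀ i ∈ T, g i ∈ O3) (h : ∀ i ∈ T, ECong (f i) (g i) m) :
    ECong (∏ i ∈ T, f i) (∏ i ∈ T, g i) m := by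
  classical
  induction T using Finset.induction_on with
  | empty => exact ⟨0, zero_mem _, by simp⟩
  | insert i T hi ih =>
    rw [Finset.prod_insert hi, Finset.prod_insert hi]
    simp only [Finset.forall_mem_insert] at hf hg h
    refine ((ih hf.2 hg.2 h.2).mul_left hf.1).trans ?_
    rw [mul_comm, mul_comm (g i)]
    exact h.1.mul_left (prod_mem hg.2)

theorem ECoprime.congr {a b m : ℂ} (h : ECoprime a m) : ECong a b m → ECoprime b m := by
  obtain ⟨u, hu, v, hv, h⟩ := h
  rintro ⟨d, hd, hd'⟩
  exact ⟨u, hu, u * d + v, add_mem (mul_mem hu hd) hv, by linear_combination h - u * hd'⟩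

theorem ECoprime.mul {a b m : ℂ} (ha : a ∈ O3) (h : ECoprime a m)
    (h' : ECoprime b m) : ECoprime (a * b) m := by
  obtain ⟨u, hu, v, hv, h⟩ := h
  obtain ⟨u', hu', v', hv', h'⟩ := h'
  exact ⟨u * u', mul_mem hu hu', v + u * a * v',
    add_mem hv (mul_mem (mul_mem hu ha) hv'), by
      linear_combination h + u * a * h'⟩

theorem ECoprime.cancel {a b c m : ℂ} (ha : a ∈ O3) (hb : b ∈ O3) (hc : ECoprime c m) :
    ECong (c * a) (c * b) m → ECong a b m := by
  obtain ⟨u, hu, v, hv, h⟩ := hc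
  rintro ⟨d, hd, hd'⟩
  exact ⟨u * d + v * (a - b), add_mem (mul_mem hu hd) (mul_mem hv (sub_mem ha hb)), by
    linear_combination u * hd' - (a - b) * h⟩

theorem ECoprime.of_pow_eq_one {x m : ℂ} (hx : x ∈ O3) (h : x ^ 3 = 1) : ECoprime x m :=
  ⟨x ^ 2, pow_mem hx 2, 0, zero_mem _, by linear_combination h⟩

theorem mem_O3_of_cube_eq_one {x : ℂ} (h : x ^ 3 = 1) : x ∈ O3 := by
  have h1 : (x - 1) * ((x - ρ3) * (x - ρ3 ^ 2)) = 0 := by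
    linear_combination h + (-x ^ 2 + x) * ρ3_quad + (x - 1) * ρ3_cube
  rcases mul_eq_zero.1 h1 with h2 | h2
  · rw [sub_eq_zero.1 h2]; exact one_mem _
  rcases mul_eq_zero.1 h2 with h2 | h2
  · rw [sub_eq_zero.1 h2]; exact ρ3_mem
  · rw [sub_eq_zero.1 h2]; exact pow_mem ρ3_mem 2

theorem not_dvd_of_mem_Icc {p r : ℕ} (hr : r ∈ Finset.Icc 1 (p - 1)) : ¬ (p : ℤ) ∣ r := by
  intro hd
  rw [Finset.mem_Icc] at hr
  have := Nat.le_of_dvd (by omega) (Int.natCast_dvd_natCast.1 hd)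
  omega

namespace EisPrime

variable {π : ℂ} {p : ℕ} (h : EisPrime π p)
include h

theorem eq_of_cube_eq_one {x y : ℂ} (hx : x ^ 3 = 1) (hy : y ^ 3 = 1) (hxy : ECong x y π) :
    x = y := by
  by_contra hne
  obtain ⟨d, hd, hd'⟩ := hxy
  have hyO := mem_O3_of_cube_eq_one hy
  have h1 : x ^ 2 + x * y + y ^ 2 = 0 := by
    refine (mul_eq_zero.1 ?_).resolve_left (sub_ne_zero.2 hne)
    linear_combination hx - hy
  obtain rfl : x = y + π * d := by linear_combination hd'
  refine h.not_three_dvd (h.dvd_of_eq_mul (a := -(3 * d * y ^ 2 + π * d ^ 2 * y)) ?_ ?_)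
  · have h3 : (3 : ℂ) ∈ O3 := ofNat_mem O3 3
    exact neg_mem (add_mem (mul_mem (mul_mem h3 hd) (pow_mem hyO 2))
      (mul_mem (mul_mem h.mem (pow_mem hd 2)) hyO))
  · push_cast
    linear_combination y * h1 - 3 * hy

theorem econg_int_iff {m n : ℤ} : ECong m n π ↔ (p : ℤ) ∣ m - n := by
  constructor
  · rintro ⟨d, hd, hd'⟩
    exact h.dvd_of_eq_mul hd (by push_cast; exact hd')
  · rintro ⟨t, ht⟩
    refine ⟨(starRingEnd ℂ) π * t, mul_mem (conj_mem_O3 h.mem) (int_mem_O3 t), ?_⟩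
    have : (m : ℂ) - n = p * t := by exact_mod_cast ht
    rw [this, h.cast_eq]; ring

theorem ecoprime_int_iff {n : ℤ} : ECoprime n π ↔ ¬ (p : ℤ) ∣ n := by
  constructor
  · rintro ⟨u, hu, v, hv, huv⟩ ⟨t, rfl⟩
    have h1 := h.dvd_of_eq_mul (n := 1)
      (add_mem (mul_mem (mul_mem hu (conj_mem_O3 h.mem)) (int_mem_O3 t)) hv) (by
        push_cast at huv ⊢
        rw [h.cast_eq] at huv
        linear_combination -huv)
    have := Int.le_of_dvd one_pos h1
    have := h.prime.one_lt
    omega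
  · intro hn
    obtain ⟨a, b, hab⟩ :=
      ((Int.prime_iff_natAbs_prime.2 (by simpa using h.prime)).coprime_iff_not_dvd.2 hn).symm
    refine ⟨a, int_mem_O3 a, b * (starRingEnd ℂ) π, mul_mem (int_mem_O3 b) (conj_mem_O3 h.mem), ?_⟩
    rw [mul_assoc, ← h.cast_eq]
    exact_mod_cast hab

theorem exists_int_econg {a : ℂ} (ha : a ∈ O3) (hc : ECoprime a π) :
    ∃ n : ℤ, ¬ (p : ℤ) ∣ n ∧ ECong a n π := by
  obtain ⟨n, b, hb, hab⟩ := h.exists_int ha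
  have hn : ECong a n π := ⟨b, hb, by rw [hab]; ring⟩
  exact ⟨n, h.ecoprime_int_iff.1 (hc.congr hn), hn⟩

theorem exists_mem_Icc_econg {a : ℂ} (ha : a ∈ O3) (hc : ECoprime a π) :
    ∃ r ∈ Finset.Icc 1 (p - 1), ECong a (r : ℂ) π := by
  obtain ⟨n, hn, han⟩ := h.exists_int_econg ha hc
  have hp0 := h.prime.pos
  obtain ⟨m, hm⟩ := Int.eq_ofNat_of_zero_le (Int.emod_nonneg n (b := p) (by omega))
  have hlt := Int.emod_lt_of_pos n (b := p) (by omega)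
  have hne : n % p ≠ 0 := fun h => hn (Int.dvd_of_emod_eq_zero h)
  refine ⟨m, Finset.mem_Icc.2 (by omega), han.trans ?_⟩
  have := h.econg_int_iff.2 (Int.dvd_self_sub_emod (x := n) (m := p))
  rw [hm] at this
  exact_mod_cast this

theorem eq_of_mem_Icc {r s : ℕ} (hr : r ∈ Finset.Icc 1 (p - 1)) (hs : s ∈ Finset.Icc 1 (p - 1))
    (hrs : ECong r s π) : r = s := by
  have h1 := h.econg_int_iff (m := r) (n := s)
  push_cast at h1
  rw [Finset.mem_Icc] at hr hs
  have h2 : ((r : ℤ) - s) = 0 :=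
    Int.eq_zero_of_abs_lt_dvd (h1.1 hrs) (abs_lt.2 (by omega))
  omega

end EisPrime

end Congruences

section ThirdSets

theorem mem_cubeRoots_iff {ε : ℂ} :
    ε ∈ ({1, ρ3, ρ3 ^ 2} : Set ℂ) ↔ ∃ i : Fin 3, ε = ρ3 ^ (i : ℕ) := by
  simp [Fin.exists_fin_succ]

theorem pow_ρ3_injective : Function.Injective fun i : Fin 3 => ρ3 ^ (i : ℕ) := by
  intro i j hij
  have h := ρ3_ne_one
  have h0 := ρ3_ne_zero
  have h2 : ρ3 ^ 2 ≠ 1 := fun h2 => h (by linear_combination ρ3_cube - ρ3 * h2)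
  have h3 : ρ3 ^ 2 ≠ ρ3 := fun h3 => h (mul_left_cancel₀ h0 (by linear_combination h3))
  fin_cases i <;> fin_cases j <;> simp_all [eq_comm]

variable {π : ℂ} {p : ℕ} {S : Finset ℂ} (hS : IsThirdSet π S) (h : EisPrime π p)
include hS h

@[to_additive]
theorem EisPrime.prod_Icc_eq {M : Type*} [CommMonoid M] {H : ℂ → M}
    (hH : ∀ a ∈ O3, ∀ b ∈ O3, ECong a b π → H a = H b) :
    ∏ r ∈ Finset.Icc 1 (p - 1), H r = ∏ ν ∈ S, (H ν * H (ρ3 * ν) * H (ρ3 ^ 2 * ν)) := by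
  have hO (i : Fin 3) {ν : ℂ} (hν : ν ∈ S) : ρ3 ^ (i : ℕ) * ν ∈ O3 ∧ ECoprime (ρ3 ^ (i : ℕ) * ν) π :=
    ⟨mul_mem (pow_mem ρ3_mem _) (hS.1 ν hν).1, ECoprime.mul (pow_mem ρ3_mem _)
      (.of_pow_eq_one (pow_mem ρ3_mem _) (by rw [← pow_mul, mul_comm, pow_mul, ρ3_cube, one_pow]))
      (hS.1 ν hν).2⟩
  choose! res hres hcong using fun (a : ℂ) (ha : a ∈ O3 ∧ ECoprime a π) =>
    h.exists_mem_Icc_econg ha.1 ha.2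
  have h1 (ν : ℂ) : H ν * H (ρ3 * ν) * H (ρ3 ^ 2 * ν) = ∏ i : Fin 3, H (ρ3 ^ (i : ℕ) * ν) := by
    simp [Fin.prod_univ_three]
  simp_rw [h1]
  rw [← Finset.prod_product' S Finset.univ fun ν (i : Fin 3) => H (ρ3 ^ (i : ℕ) * ν)]
  symm
  refine Finset.prod_nbij (fun x => res (ρ3 ^ (x.2 : ℕ) * x.1)) ?_ ?_ ?_ ?_
  · rintro ⟨ν, i⟩ hx
    exact hres _ (hO i (Finset.mem_product.1 hx).1)
  · rintro ⟨ν, i⟩ hx ⟨μ, j⟩ hy hxy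
    have hν := (Finset.mem_product.1 hx).1
    have hμ := (Finset.mem_product.1 hy).1
    have h2 := hcong _ (hO i hν)
    simp only at hxy
    rw [hxy] at h2
    obtain ⟨rfl, h3⟩ := hS.2.2 ν hν μ hμ _ (mem_cubeRoots_iff.2 ⟨i, rfl⟩) _
      (mem_cubeRoots_iff.2 ⟨j, rfl⟩) (h2.trans (hcong _ (hO j hμ)).symm)
    rw [pow_ρ3_injective h3]
  · intro r hr
    have hr' : ECoprime (r : ℂ) π := by
      have := h.ecoprime_int_iff.2 (not_dvd_of_mem_Icc hr)
      exact_mod_cast this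
    obtain ⟨ν, hν, ε, hε, hrν⟩ := hS.2.1 r (nat_mem_O3 r) hr'
    obtain ⟨i, rfl⟩ := mem_cubeRoots_iff.1 hε
    refine ⟨(ν, i), by simpa using hν, ?_⟩
    exact (h.eq_of_mem_Icc hr (hres _ (hO i hν)) (hrν.trans (hcong _ (hO i hν)))).symm
  · rintro ⟨ν, i⟩ hx
    have hν := (Finset.mem_product.1 hx).1
    exact hH _ (hO i hν).1 _ (nat_mem_O3 _) (hcong _ (hO i hν))

theorem EisPrime.card_thirdSet : p - 1 = S.card * 3 := by
  have := EisPrime.sum_Icc_eq hS h (H := fun _ => (1 : ℕ)) fun _ _ _ _ _ => rfl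
  simpa using this

omit h in
/-- Multiplication by a unit permutes a third set up to cube roots of unity. -/
theorem IsThirdSet.exists_perm {μ : ℂ} (hμ : μ ∈ O3) (hc : ECoprime μ π) :
    ∃ σ ε : ℂ → ℂ, (∀ ν ∈ S, (∃ i : Fin 3, ε ν = ρ3 ^ (i : ℕ)) ∧ ECong (μ * ν) (ε ν * σ ν) π) ∧
      S.image σ = S ∧ Set.InjOn σ S := by
  have key (ν : ℂ) (hν : ν ∈ S) : ∃ ν' ε : ℂ, ν' ∈ S ∧ (∃ i : Fin 3, ε = ρ3 ^ (i : ℕ)) ∧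
      ECong (μ * ν) (ε * ν') π := by
    obtain ⟨ν', hν', ε, hε, h⟩ := hS.2.1 (μ * ν) (mul_mem hμ (hS.1 ν hν).1)
      (hc.mul hμ (hS.1 ν hν).2)
    exact ⟨ν', ε, hν', mem_cubeRoots_iff.1 hε, h⟩
  choose! σ ε hσ hε using key
  have hinj : Set.InjOn σ S := by
    intro ν hν ν' hν' hνν'
    obtain ⟨⟨i, hi⟩, h1⟩ := hε ν hν
    obtain ⟨⟨j, hj⟩, h2⟩ := hε ν' hν'
    have hνO := (hS.1 ν hν).1
    have hνO' := (hS.1 ν' hν').1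
    have h3 : ECong (μ * (ε ν' * ν)) (μ * (ε ν * ν')) π := by
      have e1 := h1.mul_left (hj ▸ pow_mem ρ3_mem j : ε ν' ∈ O3)
      have e2 := h2.mul_left (hi ▸ pow_mem ρ3_mem i : ε ν ∈ O3)
      rw [← hνν'] at e2
      convert e1.trans (c := ε ν * (μ * ν')) ?_ using 1
      · ring
      · ring
      · convert e2.symm using 1
        ring
    rw [hi, hj] at h3
    exact (hS.2.2 ν hν ν' hν' _ (mem_cubeRoots_iff.2 ⟨j, rfl⟩) _ (mem_cubeRoots_iff.2 ⟨i, rfl⟩)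
      (hc.cancel (mul_mem (pow_mem ρ3_mem _) hνO) (mul_mem (pow_mem ρ3_mem _) hνO') h3)).1
  exact ⟨σ, ε, hε, Finset.eq_of_subset_of_card_le (Finset.image_subset_iff.2 hσ)
    (Finset.card_image_of_injOn hinj).ge, hinj⟩

end ThirdSets

section EllipticGaussSums

variable {L : PeriodPair} {ω π : ℂ} {p : ℕ} {S : Finset ℂ} {χ g : ℂ → ℂ} {e : ℤ}

theorem div_sub_div_mem_lattice (hω : IsGen L ω) (h : EisPrime π p) {a b : ℂ}
    (hab : ECong a b π) : a * ω / π - b * ω / π ∈ L.lattice := by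
  obtain ⟨d, hd, hd'⟩ := hab
  have := h.ne_zero
  refine (hω.mem_iff _).2 ⟨d, hd, ?_⟩
  field_simp
  linear_combination ω * hd'

theorem sum_thirdSet_mul (hS : IsThirdSet π S) {μ : ℂ} (hμ : μ ∈ O3) (hc : ECoprime μ π) {F : ℂ → ℂ}
    (hF : ∀ a ∈ O3, ∀ b ∈ O3, ECong a b π → F a = F b) (hρ : ∀ a ∈ O3, F (ρ3 * a) = F a) :
    ∑ ν ∈ S, F (μ * ν) = ∑ ν ∈ S, F ν := by
  obtain ⟨σ, ε, hσ, him, hinj⟩ := hS.exists_perm hμ hc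
  have hpow (i : ℕ) {a : ℂ} (ha : a ∈ O3) : F (ρ3 ^ i * a) = F a := by
    induction i with
    | zero => simp
    | succ i ih => rw [pow_succ', mul_assoc, hρ _ (mul_mem (pow_mem ρ3_mem i) ha), ih]
  conv_rhs => rw [← him, Finset.sum_image hinj]
  refine Finset.sum_congr rfl fun ν hν => ?_
  obtain ⟨⟨i, hi⟩, h1⟩ := hσ ν hν
  have hσO : σ ν ∈ O3 := (hS.1 _ (him ▸ Finset.mem_image_of_mem σ hν)).1
  rw [← hpow i hσO, ← hi]
  exact hF _ (mul_mem hμ (hS.1 ν hν).1) _ (mul_mem (hi ▸ pow_mem ρ3_mem _) hσO) h1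

theorem prod_thirdSet_mul (hS : IsThirdSet π S) (h : EisPrime π p) (hχ : IsCubicChar π p χ)
    {μ : ℂ} (hμ : μ ∈ O3) (hc : ECoprime μ π) {F : ℂ → ℂ}
    (hF : ∀ a ∈ O3, ∀ b ∈ O3, ECong a b π → F a = F b) (hρ : ∀ a ∈ O3, F (ρ3 * a) = ρ3 * F a) :
    ∏ ν ∈ S, F (μ * ν) = χ μ * ∏ ν ∈ S, F ν := by
  obtain ⟨σ, ε, hσ, him, hinj⟩ := hS.exists_perm hμ hc
  have hpow (i : ℕ) {a : ℂ} (ha : a ∈ O3) : F (ρ3 ^ i * a) = ρ3 ^ i * F a := by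
    induction i with
    | zero => simp
    | succ i ih =>
      rw [pow_succ', mul_assoc, hρ _ (mul_mem (pow_mem ρ3_mem i) ha), ih, mul_assoc]
  have hεO {ν : ℂ} (hν : ν ∈ S) : ε ν ∈ O3 := by
    obtain ⟨⟨i, hi⟩, -⟩ := hσ ν hν
    exact hi ▸ pow_mem ρ3_mem _
  have hσO {ν : ℂ} (hν : ν ∈ S) : σ ν ∈ O3 := (hS.1 _ (him ▸ Finset.mem_image_of_mem σ hν)).1
  have hprod (f : ℂ → ℂ) : ∏ ν ∈ S, f (σ ν) = ∏ ν ∈ S, f ν := by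
    conv_rhs => rw [← him, Finset.prod_image hinj]
  have hE : χ μ = ∏ ν ∈ S, ε ν := by
    refine h.eq_of_cube_eq_one (hχ.cube μ hμ hc) ?_ ((hχ.euler μ hμ hc).trans ?_)
    · rw [← Finset.prod_pow]
      refine Finset.prod_eq_one fun ν hν => ?_
      obtain ⟨⟨i, hi⟩, -⟩ := hσ ν hν
      rw [hi, ← pow_mul, mul_comm, pow_mul, ρ3_cube, one_pow]
    · rw [EisPrime.card_thirdSet hS h, Nat.mul_div_cancel _ three_pos]
      refine ECoprime.cancel (c := ∏ ν ∈ S, ν) (pow_mem hμ _) (prod_mem fun ν hν => hεO hν) ?_ ?_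
      · exact Finset.prod_induction _ (fun x => x ∈ O3 ∧ ECoprime x π)
          (fun a b ha hb => ⟨mul_mem ha.1 hb.1, ha.2.mul ha.1 hb.2⟩)
          ⟨one_mem _, .of_pow_eq_one (one_mem _) (one_pow 3)⟩ hS.1 |>.2
      · have := ECong.prod (T := S) (fun ν hν => mul_mem hμ (hS.1 ν hν).1)
          (fun ν hν => mul_mem (hεO hν) (hσO hν)) fun ν hν => (hσ ν hν).2
        rw [Finset.prod_mul_distrib, Finset.prod_mul_distrib, hprod fun x => x,
          Finset.prod_const] at this
        rwa [mul_comm, mul_comm (∏ ν ∈ S, ν)]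
  rw [hE, ← hprod F, ← Finset.prod_mul_distrib]
  refine Finset.prod_congr rfl fun ν hν => ?_
  obtain ⟨⟨i, hi⟩, h1⟩ := hσ ν hν
  rw [hi, ← hpow i (hσO hν), ← hi]
  exact hF _ (mul_mem hμ (hS.1 ν hν).1) _ (mul_mem (hεO hν) (hσO hν)) h1

/-- The functions `g` on residue classes whose Gauss sum `∑ χ(ν) g(ν)` is divisible by the square
of the canonical cubic root, with `e` the residue of `g` modulo `√−3`. -/
structure IsGaussKernel (L : PeriodPair) (ω π : ℂ) (p : ℕ) (χ g : ℂ → ℂ) (e : ℤ) : Prop where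
  periodic : ∀ a ∈ O3, ∀ b ∈ O3, ECong a b π → g a = g b
  rho_mul : ∀ a ∈ O3, χ ρ3 * g (ρ3 * a) = g a
  transports : ∀ Γ, FieldGraph Γ → ∀ m n : ℤ, Transports Γ L (m * ω / π) (n * ω / π) →
    (g m, g n) ∈ Γ
  valuation_le : ∀ A : ValuationSubring ℂ, ∀ n : ℤ, ¬ (p : ℤ) ∣ n →
    A.valuation (g n * sF L (n * ω / π)) ≤ 1
  valuation_sub_lt : ∀ A : ValuationSubring ℂ, A.valuation sqrtm3 < 1 → ∀ n : ℤ, ¬ (p : ℤ) ∣ n →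
    A.valuation (g n - e) < 1

theorem EisPrime.cubicChar_ρ3 (h : EisPrime π p) (hχ : IsCubicChar π p χ) :
    χ ρ3 = ρ3 ^ ((p - 1) / 3) := by
  have hc : ECoprime ρ3 π := .of_pow_eq_one ρ3_mem ρ3_cube
  refine h.eq_of_cube_eq_one (hχ.cube _ ρ3_mem hc) ?_ (hχ.euler _ ρ3_mem hc)
  rw [← pow_mul, mul_comm, pow_mul, ρ3_cube, one_pow]

variable (hω : IsGen L ω) (h : EisPrime π p) (hχ : IsCubicChar π p χ) (hS : IsThirdSet π S)

include h hχ hS in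
theorem IsGaussKernel.sum_Icc_eq (hg : IsGaussKernel L ω π p χ g e) :
    1 / 3 * ∑ r ∈ Finset.Icc 1 (p - 1), χ r * g r = ∑ ν ∈ S, χ ν * g ν := by
  have hρ {a : ℂ} (ha : a ∈ O3) : χ (ρ3 * a) * g (ρ3 * a) = χ a * g a := by
    rw [hχ.resChar.map_mul _ ρ3_mem _ ha, ← hg.rho_mul a ha]; ring
  rw [EisPrime.sum_Icc_eq hS h (H := fun a => χ a * g a) fun a ha b hb hab => by
    rw [hχ.resChar.periodic a ha b hb hab, hg.periodic a ha b hb hab], Finset.mul_sum]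
  refine Finset.sum_congr rfl fun ν hν => ?_
  have hνO := (hS.1 ν hν).1
  rw [sq, mul_assoc, hρ (mul_mem ρ3_mem hνO), hρ hνO]
  ring

variable [Hex27 L]

include hω h hS in
/-- The product of `sF` over a third set is a cube root of `π`. -/
theorem prod_thirdSet_sF_pow : (∏ ν ∈ S, sF L (ν * ω / π)) ^ 3 = π := by
  rw [← Finset.prod_pow]
  conv_rhs => rw [← prod_sF_eq hω h]
  rw [EisPrime.prod_Icc_eq hS h (H := fun a => sF L (a * ω / π))
    fun a _ b _ hab => sF_congr (div_sub_div_mem_lattice hω h hab)]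
  refine Finset.prod_congr rfl fun ν _ => ?_
  rw [show ρ3 ^ 2 * ν * ω / π = ρ3 * (ρ3 * (ν * ω / π)) by ring,
    show ρ3 * ν * ω / π = ρ3 * (ν * ω / π) by ring, sF_rho, sF_rho, sF_rho]
  linear_combination -sF L (ν * ω / π) ^ 3 * ρ3_cube

include hω h hχ hS in
theorem IsGaussKernel.mul_prod_mem_O3 (hg : IsGaussKernel L ω π p χ g e)
    (hint : IsIntegral ℤ ((∑ ν ∈ S, χ ν * g ν) * ∏ ν ∈ S, sF L (ν * ω / π))) :
    (∑ ν ∈ S, χ ν * g ν) * ∏ ν ∈ S, sF L (ν * ω / π) ∈ O3 := by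
  refine mem_O3_of_forall_fieldGraph hint fun Γ hΓ => ?_
  obtain ⟨μ, hμp, hμ⟩ := exists_transports_mul hΓ hω h
  have hμO := int_mem_O3 μ
  have hμc := h.ecoprime_int_iff.2 hμp
  have hper : ∀ a ∈ O3, ∀ b ∈ O3, ECong a b π → sF L (a * ω / π) = sF L (b * ω / π) :=
    fun a _ b _ hab => sF_congr (div_sub_div_mem_lattice hω h hab)
  have hχO {a : ℂ} (ha : a ∈ O3) (hc : ECoprime a π) : χ a ∈ O3 :=
    mem_O3_of_cube_eq_one (hχ.cube a ha hc)
  have hmem {ν : ℂ} (hν : ν ∈ S) : (g ν, g (μ * ν)) ∈ Γ ∧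
      (sF L (ν * ω / π), sF L (μ * ν * ω / π)) ∈ Γ := by
    obtain ⟨hνO, hνc⟩ := hS.1 ν hν
    obtain ⟨n, hn, hνn⟩ := h.exists_int_econg hνO hνc
    have hμν : ECong (μ * ν) (n * μ : ℤ) π := by
      convert hνn.mul_left hμO using 1
      push_cast; ring
    have ht := hμ n hn
    rw [hg.periodic _ hνO _ (int_mem_O3 n) hνn, hg.periodic _ (mul_mem hμO hνO) _ (int_mem_O3 _) hμν,
      hper _ hνO _ (int_mem_O3 n) hνn, hper _ (mul_mem hμO hνO) _ (int_mem_O3 _) hμν]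
    exact ⟨hg.transports Γ hΓ _ _ ht, ht.sF_mem⟩
  have hsum : (∑ ν ∈ S, χ ν * g ν, ∑ ν ∈ S, χ ν * g (μ * ν)) ∈ Γ := by
    rw [prod_mk_sum]
    exact sum_mem fun ν hν => mul_mem (hΓ.O3_mem (hχO (hS.1 ν hν).1 (hS.1 ν hν).2)) (hmem hν).1
  have hprod : (∏ ν ∈ S, sF L (ν * ω / π), ∏ ν ∈ S, sF L (μ * ν * ω / π)) ∈ Γ := by
    rw [prod_mk_prod]
    exact prod_mem fun ν hν => (hmem hν).2
  have e1 : χ μ * ∑ ν ∈ S, χ ν * g (μ * ν) = ∑ ν ∈ S, χ ν * g ν := by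
    rw [← sum_thirdSet_mul hS hμO hμc (F := fun a => χ a * g a), Finset.mul_sum]
    · refine Finset.sum_congr rfl fun ν hν => ?_
      rw [hχ.resChar.map_mul _ hμO _ (hS.1 ν hν).1, mul_assoc]
    · intro a ha b hb hab
      rw [hχ.resChar.periodic a ha b hb hab, hg.periodic a ha b hb hab]
    · intro a ha
      rw [hχ.resChar.map_mul _ ρ3_mem _ ha, ← hg.rho_mul a ha]; ring
  have e2 := prod_thirdSet_mul hS h hχ hμO hμc (F := fun a => sF L (a * ω / π)) hper fun a _ => by
    rw [mul_assoc, mul_div_assoc, sF_rho]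
  convert mul_mem hsum hprod using 1
  rw [Prod.mk_mul_mk, e2, ← e1]
  congr 1
  ring

include hω h hχ hS in
theorem IsGaussKernel.valuation_sum_le (hg : IsGaussKernel L ω π p χ g e) (A : ValuationSubring ℂ) :
    A.valuation ((∑ ν ∈ S, χ ν * g ν) * sF L ((1 : ℤ) * ω / π)) ≤ 1 := by
  rw [Finset.sum_mul]
  refine A.valuation.map_sum_le fun ν hν => ?_
  obtain ⟨hνO, hνc⟩ := hS.1 ν hν
  obtain ⟨n, hn, hνn⟩ := h.exists_int_econg hνO hνc
  rw [mul_assoc, map_mul, valuation_eq_one_of_pow _ three_ne_zero (by rw [hχ.cube ν hνO hνc, map_one]),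
    one_mul, hg.periodic _ hνO _ (int_mem_O3 n) hνn, map_mul,
    valuation_sF_div_eq A.valuation hω h (h.ecoprime_int_iff.1
      (.of_pow_eq_one (int_mem_O3 1) (by norm_num))) hn, ← map_mul]
  exact hg.valuation_le A n hn

end EllipticGaussSums

section Main

variable {L : PeriodPair} [Hex27 L] {ω π : ℂ} {p : ℕ} {S : Finset ℂ} {χ g : ℂ → ℂ} {e : ℤ}
  (hω : IsGen L ω) (h : EisPrime π p) (hχ : IsCubicChar π p χ) (hS : IsThirdSet π S)
include hω h hχ hS

theorem IsGaussKernel.valuation_sum_mul_prod (hg : IsGaussKernel L ω π p χ g e)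
    (A : ValuationSubring ℂ) :
    A.valuation ((∑ ν ∈ S, χ ν * g ν) * ∏ ν ∈ S, sF L (ν * ω / π)) ≤ 1 ∧
      (A.valuation π < 1 →
        A.valuation ((∑ ν ∈ S, χ ν * g ν) * ∏ ν ∈ S, sF L (ν * ω / π)) < 1) := by
  have h1p : ¬ (p : ℤ) ∣ (1 : ℤ) :=
    h.ecoprime_int_iff.1 (.of_pow_eq_one (int_mem_O3 1) (by norm_num))
  have ha := valuation_sF_div_le_one A.valuation hω h h1p
  have hpow := valuation_sF_div_pow A.valuation hω h h1p
  have hG := hg.valuation_sum_le hω h hχ hS A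
  have hp5 : 5 ≤ p := by
    have := h.prime.two_le
    have := h.mod_three
    have : p ≠ 4 := by rintro rfl; exact absurd h.prime (by norm_num)
    omega
  rw [show p - 1 = 3 + (p - 4) by omega, pow_add] at hpow
  have key : A.valuation ((∑ ν ∈ S, χ ν * g ν) * ∏ ν ∈ S, sF L (ν * ω / π)) ^ 3 =
      A.valuation ((∑ ν ∈ S, χ ν * g ν) * sF L ((1 : ℤ) * ω / π)) ^ 3 *
        A.valuation (sF L ((1 : ℤ) * ω / π)) ^ (p - 4) := by
    rw [map_mul, mul_pow, ← map_pow _ (∏ ν ∈ S, _), prod_thirdSet_sF_pow hω h hS, ← hpow, map_mul,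
      mul_pow, mul_assoc]
  constructor
  · rw [← pow_le_one_iff (n := 3) (by norm_num), key]
    exact mul_le_one' (pow_le_one' hG _) (pow_le_one' ha _)
  · intro hπ
    have ha1 : A.valuation (sF L ((1 : ℤ) * ω / π)) < 1 := by
      refine lt_of_le_of_ne ha fun h1 => ?_
      rw [h1, one_pow, one_pow, one_mul] at hpow
      exact hπ.ne hpow.symm
    rw [← pow_lt_one_iff (n := 3) (by norm_num), key, mul_comm]
    exact mul_lt_one_of_lt_of_le (pow_lt_one₀ zero_le ha1 (by omega)) (pow_le_one' hG _)

theorem IsGaussKernel.exists_eq_mul (hg : IsGaussKernel L ω π p χ g e) :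
    ∃ α ∈ O3, (∑ ν ∈ S, χ ν * g ν) * ∏ ν ∈ S, sF L (ν * ω / π) = π * α := by
  obtain ⟨A, hA⟩ := h.exists_valuation
  refine h.dvd_of_valuation_lt_one _ hA (hg.mul_prod_mem_O3 hω h hχ hS
    (isIntegral_of_forall_valuation_le_one fun A =>
      (hg.valuation_sum_mul_prod hω h hχ hS A).1)) ?_
  exact (hg.valuation_sum_mul_prod hω h hχ hS A).2 hA

omit [Hex27 L] hω in
theorem IsGaussKernel.valuation_sum_sub_lt (hg : IsGaussKernel L ω π p χ g e)
    {A : ValuationSubring ℂ} (hA : A.valuation sqrtm3 < 1) :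
    A.valuation ((∑ ν ∈ S, χ ν * g ν) - S.card * e) < 1 := by
  rw [← nsmul_eq_mul, ← Finset.sum_const, ← Finset.sum_sub_distrib]
  refine A.valuation.map_sum_lt one_ne_zero fun ν hν => ?_
  obtain ⟨hνO, hνc⟩ := hS.1 ν hν
  obtain ⟨n, hn, hνn⟩ := h.exists_int_econg hνO hνc
  have h1 := hg.valuation_sub_lt A hA n hn
  rw [← hg.periodic _ hνO _ (int_mem_O3 n) hνn] at h1
  have hχ1 : A.valuation (χ ν) = 1 :=
    valuation_eq_one_of_pow _ three_ne_zero (by rw [hχ.cube ν hνO hνc, map_one])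
  have h2 : A.valuation (1 + -χ ν) < 1 := by
    refine valuation_one_add_lt_one _ hA (by rw [Valuation.map_neg, hχ1]) ?_
    rw [neg_pow, hχ.cube ν hνO hνc]
    norm_num
  rw [show χ ν * g ν - e = χ ν * (g ν - e) - (1 + -χ ν) * e by ring]
  refine A.valuation.map_sub_lt ?_ ?_
  · rwa [map_mul, hχ1, one_mul]
  · rw [map_mul]
    exact mul_lt_one_of_lt_of_le h2 (valuation_intCast_le_one _ e)

/-- The elliptic Gauss sum is the square of the canonical cubic root of `π` times an Eisenstein
integer with known residue modulo `√−3`. -/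
theorem IsGaussKernel.gaussSum_eq (hg : IsGaussKernel L ω π p χ g e) {γ πt : ℂ} (hγ : γ ^ 3 = 1)
    (hπt : πt = γ⁻¹ * ∏ ν ∈ S, sF L (ν * ω / π)) :
    πt ≠ 0 ∧ (πt ^ 2)⁻¹ * ∑ ν ∈ S, χ ν * g ν ∈ O3 ∧
      ECong ((πt ^ 2)⁻¹ * ∑ ν ∈ S, χ ν * g ν) (S.card * e) sqrtm3 := by
  have hcube : πt ^ 3 = π := by
    rw [hπt, mul_pow, inv_pow, hγ, prod_thirdSet_sF_pow hω h hS, inv_one, one_mul]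
  have h0 : πt ≠ 0 := by
    rintro rfl
    exact h.ne_zero (by rw [← hcube]; norm_num)
  obtain ⟨β, hβ, hβ'⟩ := hg.exists_eq_mul hω h hχ hS
  have hγO := mem_O3_of_cube_eq_one hγ
  set G := ∑ ν ∈ S, χ ν * g ν
  have hα : (πt ^ 2)⁻¹ * G = γ ^ 2 * β := by
    have hγ0 : γ ≠ 0 := by rintro rfl; norm_num at hγ
    have h1 : G * πt * γ = πt ^ 3 * β := by
      rw [hcube, ← hβ', hπt, mul_assoc, mul_right_comm, inv_mul_cancel₀ hγ0, one_mul]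
    field_simp
    refine mul_left_cancel₀ (mul_ne_zero h0 hγ0) ?_
    linear_combination h1 - β * πt ^ 3 * hγ
  have hαO : γ ^ 2 * β ∈ O3 := mul_mem (pow_mem hγO 2) hβ
  refine ⟨h0, hα ▸ hαO, ?_⟩
  rw [hα]
  obtain ⟨A, hA⟩ := exists_valuation_sqrtm3
  have hG := hg.valuation_sum_sub_lt h hχ hS hA
  have hcO : (S.card * e : ℂ) ∈ O3 := mul_mem (nat_mem_O3 _) (int_mem_O3 e)
  have hGle : A.valuation G ≤ 1 := by
    rw [show G = (G - S.card * e) + S.card * e by ring]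
    exact A.valuation.map_add_le hG.le (valuation_O3_le_one _ hcO)
  have hπ1 : A.valuation (1 + -π) < 1 := by
    obtain ⟨d, hd, hd'⟩ := h.primary
    rw [hd', show 1 + -(1 + 3 * d) = -(3 * d) by ring, Valuation.map_neg, map_mul]
    exact mul_lt_one_of_lt_of_le (valuation_three_lt_one _ hA) (valuation_O3_le_one _ hd)
  have hπt1 : A.valuation (1 + -πt) < 1 := by
    refine valuation_one_add_lt_one _ hA ?_ ?_
    · rw [Valuation.map_neg, valuation_eq_one_of_pow _ three_ne_zero
        (by rw [hcube, h.valuation_eq_one _ hA])]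
    · rwa [neg_pow, hcube, show (-1 : ℂ) ^ 3 * π = -π by ring]
  obtain ⟨b, hb, hb'⟩ := sqrtm3_dvd_of_valuation_lt_one A.valuation hA (sub_mem hαO hcO) (by
    have h1 : γ ^ 2 * β * π = G * πt := by
      rw [← hα, ← hcube]
      field_simp
    rw [show γ ^ 2 * β - S.card * e = (1 + -π) * (γ ^ 2 * β) - (1 + -πt) * G + (G - S.card * e) by
      linear_combination h1]
    refine A.valuation.map_add_lt (A.valuation.map_sub_lt ?_ ?_) hG
    · rw [map_mul]
      exact mul_lt_one_of_lt_of_le hπ1 (valuation_O3_le_one _ hαO)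
    · rw [map_mul]
      exact mul_lt_one_of_lt_of_le hπt1 hGle)
  exact ⟨b, hb, hb'⟩

end Main

section Kernels

variable {L : PeriodPair} [Hex27 L] {ω π : ℂ} {p : ℕ} {χ : ℂ → ℂ}
  (hω : IsGen L ω) (h : EisPrime π p) (hχ : IsCubicChar π p χ)
include hω h hχ

theorem isGaussKernel_sF (hp : (p - 1) / 3 % 3 = 2) :
    IsGaussKernel L ω π p χ (fun a => sF L (a * ω / π)) (-1) where
  periodic a _ b _ hab := sF_congr (div_sub_div_mem_lattice hω h hab)
  rho_mul a _ := by
    rw [h.cubicChar_ρ3 hχ, ← Nat.div_add_mod ((p - 1) / 3) 3, hp, mul_assoc ρ3, mul_div_assoc, sF_rho,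
      pow_add, pow_mul, ρ3_cube, one_pow]
    linear_combination sF L (a * ω / π) * ρ3_cube
  transports _ _ _ _ ht := ht.sF_mem
  valuation_le A n hn := by
    have := valuation_sF_div_le_one A.valuation hω h hn
    rw [map_mul]
    exact mul_le_one' this this
  valuation_sub_lt A hA n hn := by
    have := (valuation_one_add_div_lt_one A.valuation hω h hA hn).1
    convert this using 2
    push_cast; ring

theorem isGaussKernel_inv_sF (hp : (p - 1) / 3 % 3 = 1) :
    IsGaussKernel L ω π p χ (fun a => (sF L (a * ω / π))⁻¹) (-1) where
  periodic a _ b _ hab := by rw [sF_congr (div_sub_div_mem_lattice hω h hab)]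
  rho_mul a _ := by
    rw [h.cubicChar_ρ3 hχ, ← Nat.div_add_mod ((p - 1) / 3) 3, hp, mul_assoc ρ3, mul_div_assoc, sF_rho,
      pow_add, pow_mul, ρ3_cube, one_pow, mul_inv, one_mul, pow_one, mul_inv_cancel_left₀ ρ3_ne_zero]
  transports _ hΓ _ _ ht := hΓ.inv_mem ht.sF_mem
  valuation_le A n hn := by rw [inv_mul_cancel₀ (generic_div hω h hn).2.1, map_one]
  valuation_sub_lt A hA n hn := by
    have h0 := (generic_div hω h hn).2.1
    have h1 := (valuation_one_add_div_lt_one A.valuation hω h hA hn).1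
    have h2 := valuation_sF_div_eq_one A.valuation hω h hA hn
    rw [show (sF L (n * ω / π))⁻¹ - ((-1 : ℤ) : ℂ) =
      (sF L (n * ω / π))⁻¹ * (1 + sF L (n * ω / π)) by push_cast; field_simp; ring, map_mul, map_inv₀, h2,
      inv_one, one_mul]
    exact h1

theorem isGaussKernel_neg_cF (hp : (p - 1) / 3 % 3 = 0) :
    IsGaussKernel L ω π p χ (fun a => -cF L (a * ω / π)) 1 where
  periodic a _ b _ hab := by rw [cF_congr (div_sub_div_mem_lattice hω h hab)]
  rho_mul a _ := by
    rw [h.cubicChar_ρ3 hχ, ← Nat.div_add_mod ((p - 1) / 3) 3, hp, mul_assoc ρ3, mul_div_assoc, cF_rho,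
      pow_add, pow_mul, ρ3_cube, one_pow, pow_zero, one_mul, one_mul]
  transports _ _ _ _ ht := neg_mem ht.cF_mem
  valuation_le A n hn := by
    rw [map_mul, Valuation.map_neg, valuation_cF_div A.valuation hω h hn, one_mul]
    exact valuation_sF_div_le_one A.valuation hω h hn
  valuation_sub_lt A hA n hn := by
    have := (valuation_one_add_div_lt_one A.valuation hω h hA hn).2
    rw [← Valuation.map_neg] at this
    convert this using 2
    push_cast; ring

end Kernels

theorem econg_sqrtm3_of_sub_eq {a : ℂ} {m n : ℤ} (h : ECong a m sqrtm3) (hmn : (3 : ℤ) ∣ m - n) :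
    ECong a n sqrtm3 := by
  obtain ⟨t, ht⟩ := hmn
  have ht' : (m : ℂ) - n = 3 * t := by exact_mod_cast ht
  exact h.trans ⟨-sqrtm3 * t, mul_mem (neg_mem sqrtm3_mem) (int_mem_O3 t), by
    linear_combination ht' + (t : ℂ) * sqrtm3_sq⟩

/-- **Theorem I.1.** Let `π ∈ ℤ[ρ]` be a primary prime with `p = π·π̄ ≡ 1 (mod 3)`.
Then the elliptic Gauss sum is expressible as `G_π(χ_π, f) = α_π·π̃²`, where the
coefficient `α_π = π̃⁻²·G_π(χ_π, f)` is an algebraic integer lying in `ℤ[ρ]`; moreover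
`α_π ≡ 1 (mod √−3)` if `p ≡ 7 (mod 18)` (with `f = φ`), `α_π ≡ −1 (mod √−3)` if
`p ≡ 13 (mod 18)` (with `f = φ⁻¹`), and `α_π ≡ 0 (mod √−3)` if `p ≡ 1 (mod 18)`
(with `f = ψ`). -/
theorem stmt_0
    (p : ℕ) (hp : p.Prime) (hp3 : p % 3 = 1)
    (π : ℂ) (hπ : π ∈ O3) (hprimary : ECong π 1 3)
    (hnorm : (p : ℂ) = π * (starRingEnd ℂ) π)
    (χ : ℂ → ℂ) (hχ : IsCubicChar π p χ)
    (S : Finset ℂ) (hS : IsThirdSet π S)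
    (γ : ℂ) (hγ : IsGamma3 π S γ)
    (πt : ℂ) (hπt : πt = γ⁻¹ * ∏ ν ∈ S, phi3 (ν / π))
    (α₇ α₁₃ α₁ : ℂ)
    (hα₇ : α₇ = (πt ^ 2)⁻¹ * EGS3 p χ phi3 π)
    (hα₁₃ : α₁₃ = (πt ^ 2)⁻¹ * EGS3 p χ (fun u => (phi3 u)⁻¹) π)
    (hα₁ : α₁ = (πt ^ 2)⁻¹ * EGS3 p χ psi3 π) :
    (p % 18 = 7 →
      EGS3 p χ phi3 π = α₇ * πt ^ 2 ∧ α₇ ∈ O3 ∧ ECong α₇ 1 sqrtm3) ∧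
    (p % 18 = 13 →
      EGS3 p χ (fun u => (phi3 u)⁻¹) π = α₁₃ * πt ^ 2 ∧ α₁₃ ∈ O3 ∧
        ECong α₁₃ (-1) sqrtm3) ∧
    (p % 18 = 1 →
      EGS3 p χ psi3 π = α₁ * πt ^ 2 ∧ α₁ ∈ O3 ∧ ECong α₁ 0 sqrtm3) := by
  obtain ⟨L, hL, hω, hφ, hψ⟩ := exists_hex27_phi3_psi3
  have h : EisPrime π p := by
    obtain ⟨d, hd, hd'⟩ := hprimary
    exact ⟨hπ, ⟨d, hd, by linear_combination hd'⟩, hnorm.symm, hp, hp3⟩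
  have hdiv (a : ℂ) : (varpi1 : ℂ) * (a / π) = a * varpi1 / π := by ring
  simp only [hφ, hdiv] at hπt
  have key {f g : ℂ → ℂ} {e k : ℤ} (hg : IsGaussKernel L varpi1 π p χ g e)
      (hfg : ∀ r ∈ Finset.Icc 1 (p - 1), f ((r : ℂ) / π) = g r)
      (hk : (3 : ℤ) ∣ ((p - 1) / 3 : ℕ) * e - k) :
      EGS3 p χ f π = (πt ^ 2)⁻¹ * EGS3 p χ f π * πt ^ 2 ∧ (πt ^ 2)⁻¹ * EGS3 p χ f π ∈ O3 ∧
        ECong ((πt ^ 2)⁻¹ * EGS3 p χ f π) k sqrtm3 := by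
    have hG : EGS3 p χ f π = ∑ ν ∈ S, χ ν * g ν := by
      rw [EGS3, ← hg.sum_Icc_eq h hχ hS]
      congr 1
      exact Finset.sum_congr rfl fun r hr => by rw [hfg r hr]
    obtain ⟨h0, h1, h2⟩ := hg.gaussSum_eq hω h hχ hS hγ.1 hπt
    rw [hG]
    refine ⟨by field_simp, h1, econg_sqrtm3_of_sub_eq (m := ((p - 1) / 3 : ℕ) * e) ?_ hk⟩
    rw [EisPrime.card_thirdSet hS h, Nat.mul_div_cancel _ three_pos]
    exact_mod_cast h2
  refine ⟨fun h7 => ?_, fun h13 => ?_, fun h1 => ?_⟩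
  · have := key (f := phi3) (k := 1) (isGaussKernel_sF hω h hχ (by omega))
      (fun r _ => by rw [hφ, hdiv]) (by omega)
    rw [hα₇]
    exact_mod_cast this
  · have := key (f := fun u => (phi3 u)⁻¹) (k := -1) (isGaussKernel_inv_sF hω h hχ (by omega))
      (fun r _ => by rw [hφ, hdiv]) (by omega)
    rw [hα₁₃]
    exact_mod_cast this
  · have := key (f := psi3) (k := 0) (isGaussKernel_neg_cF hω h hχ (by omega))
      (fun r hr => by
        rw [hψ, hdiv]
        intro hmem
        have hs := (generic_div hω h (not_dvd_of_mem_Icc hr)).2.1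
        rw [hdiv] at hmem
        exact hs (sF_of_mem (by exact_mod_cast hmem))) (by omega)
    rw [hα₁]
    exact_mod_cast this

end
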